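/- Let L > 0 and T > 0. There exists a constant C > 0, depending only on L and T, such that every classical solution φ on [0,L]×[0,T] of the adjoint linear KdV system φ_t + φ_x + φ_{xxx} = 0 with boundary conditions φ(L,t) = 0, φ_x(L,t) = 0 and φ(0,t) + φ_{xx}(0,t) = 0 satisfies the hidden (sharp trace) regularity estimate sup over x ∈ [0,L] of ∫₀^T φ_x(x,t)² dt ≤ C ∫₀^L φ(x,0)² dx. -/

import Mathlib

open MeasureTheory Set


lemma hil_int (a : ℝ) (ha : 0 < a) :
    ∫ y in Ioi (0:ℝ), 1 / (√y * (a + y)) = Real.pi / √a := by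
  have hsa : 0 < √a := Real.sqrt_pos.2 ha
  have key := integral_Ioi_of_hasDerivAt_of_nonneg (a := (0:ℝ)) (l := 2 / √a * (Real.pi / 2))
    (g := fun y => 2 / √a * Real.arctan (√y / √a)) (g' := fun y => 1 / (√y * (a + y)))
    (by
      apply Continuous.continuousWithinAt
      have := Real.continuous_arctan
      fun_prop)
    (by
      intro y hy
      have hy : 0 < y := hy
      have hsy : 0 < √y := Real.sqrt_pos.2 hy
      have h1 := (((Real.hasDerivAt_sqrt hy.ne').div_const (√a)).arctan).const_mul (2 / √a)
      refine h1.congr_deriv ?_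
      have e1 : √a ^ 2 = a := Real.sq_sqrt ha.le
      have e2 : √y ^ 2 = y := Real.sq_sqrt hy.le
      have h3 : a + y ≠ 0 := by positivity
      have : 1 + (√y / √a) ^ 2 = (a + y) / a := by
        rw [div_pow, e1, e2]; field_simp
      rw [this]
      field_simp
      rw [e1])
    (by
      intro y hy
      have hy : 0 < y := hy
      positivity)
    (by
      apply Filter.Tendsto.const_mul
      have h1 := Real.tendsto_arctan_atTop
      have h2 : Filter.Tendsto (fun y : ℝ => √y / √a) Filter.atTop Filter.atTop :=
        Real.tendsto_sqrt_atTop.atTop_div_const hsa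
      exact (tendsto_nhds_of_tendsto_nhdsWithin h1).comp h2)
  rw [key]
  field_simp
  simp

lemma hil_lint (d x : ℝ) (hx : x ≠ d) :
    ∫⁻ y : ℝ, ENNReal.ofReal (1 / (|x - d| + |y - d|) * (1 / √|y - d|))
      ≤ ENNReal.ofReal (2 * Real.pi * (1 / √|x - d|)) := by
  set a := |x - d| with ha'
  have ha : 0 < a := abs_pos.2 (sub_ne_zero.2 hx)
  have h0 := lintegral_sub_right_eq_self (μ := volume)
    (fun y : ℝ => ENNReal.ofReal (1 / (a + |y|) * (1 / √|y|))) d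
  rw [h0]
  have h1 := integral_comp_abs (f := fun y => 1 / (√y * (a + y)))
  rw [hil_int a ha] at h1
  have hintg : Integrable (fun y : ℝ => 1 / (√|y| * (a + |y|))) := by
    by_contra hc
    rw [integral_undef hc] at h1
    have : 0 < 2 * (Real.pi / √a) := by
      have := Real.sqrt_pos.2 ha
      have := Real.pi_pos
      positivity
    linarith
  have e : ∀ y : ℝ, 1 / (a + |y|) * (1 / √|y|) = 1 / (√|y| * (a + |y|)) := by
    intro y
    rw [one_div_mul_one_div, mul_comm]
  simp_rw [e]
  rw [← ofReal_integral_eq_lintegral_ofReal hintg]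
  · rw [h1]
    apply ENNReal.ofReal_le_ofReal
    apply le_of_eq
    ring
  · filter_upwards with y
    positivity

lemma poi_lint (d x : ℝ) (hd : 0 < d) :
    ∫⁻ y : ℝ, ENNReal.ofReal (d / ((x - y) ^ 2 + d ^ 2)) ≤ ENNReal.ofReal Real.pi := by
  have e : ∀ y : ℝ, d / ((x - y) ^ 2 + d ^ 2) = d⁻¹ * (1 + ((y - x) / d) ^ 2)⁻¹ := by
    intro y
    have : (x - y) ^ 2 + d ^ 2 ≠ 0 := by positivity
    field_simp
    ring
  simp_rw [e]
  have i0 := integrable_inv_one_add_sq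
  have i1 : Integrable (fun y : ℝ => (1 + (y / d) ^ 2)⁻¹) := i0.comp_div hd.ne'
  have i2 : Integrable (fun y : ℝ => (1 + ((y - x) / d) ^ 2)⁻¹) := i1.comp_sub_right x
  rw [← ofReal_integral_eq_lintegral_ofReal (i2.const_mul _)]
  · apply ENNReal.ofReal_le_ofReal
    rw [integral_const_mul]
    have h1 := integral_sub_right_eq_self (μ := volume) (fun y : ℝ => (1 + (y / d) ^ 2)⁻¹) x
    have h2 := Measure.integral_comp_div (fun y : ℝ => (1 + y ^ 2)⁻¹) d
    rw [h1, h2, integral_univ_inv_one_add_sq, abs_of_pos hd, smul_eq_mul]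
    apply le_of_eq
    field_simp
  · filter_upwards with y
    positivity

/-- Schur test, quadratic form. -/
lemma schur_lint (μ : Measure ℝ) [SFinite μ] (κ : ℝ → ℝ → ℝ) (p : ℝ → ℝ) (M : ℝ) (hM : 0 ≤ M)
    (hκm : Measurable (Function.uncurry κ)) (hpm : Measurable p)
    (hκ : ∀ x y, 0 ≤ κ x y) (hsym : ∀ x y, κ x y = κ y x)
    (hp : ∀ᵐ x ∂μ, 0 < p x)
    (hS : ∀ᵐ x ∂μ, ∫⁻ y, ENNReal.ofReal (κ x y * p y) ∂μ ≤ ENNReal.ofReal (M * p x))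
    (f g : ℝ → ℝ) (hf : AEMeasurable f μ) (hg : AEMeasurable g μ) :
    ∫⁻ z, ENNReal.ofReal (κ z.1 z.2 * (|f z.1| * |g z.2|)) ∂(μ.prod μ)
      ≤ ENNReal.ofReal M * (∫⁻ x, ENNReal.ofReal (f x ^ 2) ∂μ
          + ∫⁻ x, ENNReal.ofReal (g x ^ 2) ∂μ) := by
  have one : ∀ f : ℝ → ℝ, AEMeasurable f μ →
      ∫⁻ x, ∫⁻ y, ENNReal.ofReal (κ x y * (f x ^ 2 * p y / p x)) ∂μ ∂μ
        ≤ ENNReal.ofReal M * ∫⁻ x, ENNReal.ofReal (f x ^ 2) ∂μ := by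
    intro f hf
    rw [← lintegral_const_mul' _ _ ENNReal.ofReal_ne_top]
    apply lintegral_mono_ae
    filter_upwards [hp, hS] with x hx hSx
    have e : ∀ y, ENNReal.ofReal (κ x y * (f x ^ 2 * p y / p x))
        = ENNReal.ofReal (f x ^ 2 / p x) * ENNReal.ofReal (κ x y * p y) := by
      intro y
      rw [← ENNReal.ofReal_mul (by positivity)]
      congr 1
      ring
    simp_rw [e]
    rw [lintegral_const_mul' _ _ ENNReal.ofReal_ne_top]
    calc _ ≤ ENNReal.ofReal (f x ^ 2 / p x) * ENNReal.ofReal (M * p x) := by gcongr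
      _ = _ := by
        rw [← ENNReal.ofReal_mul (by positivity), ← ENNReal.ofReal_mul hM]
        congr 1
        field_simp
  have hpx : ∀ᵐ z ∂(μ.prod μ), 0 < p z.1 := Measure.quasiMeasurePreserving_fst.ae hp
  have hpy : ∀ᵐ z ∂(μ.prod μ), 0 < p z.2 := Measure.quasiMeasurePreserving_snd.ae hp
  have hf1 : AEMeasurable (fun z : ℝ × ℝ => f z.1) (μ.prod μ) :=
    hf.comp_quasiMeasurePreserving Measure.quasiMeasurePreserving_fst
  have hg2 : AEMeasurable (fun z : ℝ × ℝ => g z.2) (μ.prod μ) :=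
    hg.comp_quasiMeasurePreserving Measure.quasiMeasurePreserving_snd
  have hp1 : Measurable (fun z : ℝ × ℝ => p z.1) := hpm.comp measurable_fst
  have hp2 : Measurable (fun z : ℝ × ℝ => p z.2) := hpm.comp measurable_snd
  have hκm' : Measurable (fun z : ℝ × ℝ => κ z.1 z.2) := hκm
  have m1 : AEMeasurable (fun z : ℝ × ℝ => ENNReal.ofReal (κ z.1 z.2 * (f z.1 ^ 2 * p z.2 / p z.1)))
      (μ.prod μ) :=
    (hκm'.aemeasurable.mul (((hf1.pow_const 2).mul hp2.aemeasurable).div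
      hp1.aemeasurable)).ennreal_ofReal
  have m2 : AEMeasurable (fun z : ℝ × ℝ => ENNReal.ofReal (κ z.1 z.2 * (g z.2 ^ 2 * p z.1 / p z.2)))
      (μ.prod μ) :=
    (hκm'.aemeasurable.mul (((hg2.pow_const 2).mul hp1.aemeasurable).div
      hp2.aemeasurable)).ennreal_ofReal
  calc _ ≤ ∫⁻ z, (ENNReal.ofReal (κ z.1 z.2 * (f z.1 ^ 2 * p z.2 / p z.1))
        + ENNReal.ofReal (κ z.1 z.2 * (g z.2 ^ 2 * p z.1 / p z.2))) ∂(μ.prod μ) := by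
        apply lintegral_mono_ae
        filter_upwards [hpx, hpy] with z h1 h2
        have hk := hκ z.1 z.2
        rw [← ENNReal.ofReal_add (by positivity) (by positivity)]
        apply ENNReal.ofReal_le_ofReal
        rw [← mul_add]
        apply mul_le_mul_of_nonneg_left _ hk
        set a := p z.1
        set b := p z.2
        have hab : (|f z.1| * b - |g z.2| * a) ^ 2 ≥ 0 := sq_nonneg _
        have e1 : f z.1 ^ 2 = |f z.1| ^ 2 := (sq_abs _).symm
        have e2 : g z.2 ^ 2 = |g z.2| ^ 2 := (sq_abs _).symm
        rw [e1, e2, div_add_div _ _ h1.ne' h2.ne', le_div_iff₀ (by positivity)]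
        have : 0 ≤ |f z.1| * |g z.2| * (a * b) := by positivity
        nlinarith
    _ = _ := by
        rw [lintegral_add_left' m1, lintegral_prod _ m1, lintegral_prod_symm _ m2]
    _ ≤ _ := by
        rw [mul_add]
        gcongr
        · exact one f hf
        · have := one g hg
          simp_rw [hsym]
          exact this

/-- The dominating kernel. -/
noncomputable def kap (d x y : ℝ) : ℝ := 1 / (|x - d| + |y - d|) + d / ((x - y) ^ 2 + d ^ 2)

lemma kap_nonneg (d x y : ℝ) (hd : 0 < d) : 0 ≤ kap d x y := by
  unfold kap; positivity

lemma kap_meas (d : ℝ) : Measurable (fun z : ℝ × ℝ => kap d z.1 z.2) := by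
  unfold kap
  fun_prop

lemma kap_lint (d L : ℝ) (hd : 0 < d) (f g : ℝ → ℝ)
    (hf : AEMeasurable f (volume.restrict (Icc 0 L))) (hg : AEMeasurable g (volume.restrict (Icc 0 L))) :
    ∫⁻ z, ENNReal.ofReal (kap d z.1 z.2 * (|f z.1| * |g z.2|))
      ∂((volume.restrict (Icc 0 L)).prod (volume.restrict (Icc 0 L)))
      ≤ ENNReal.ofReal 12 * (∫⁻ x, ENNReal.ofReal (f x ^ 2) ∂(volume.restrict (Icc 0 L))
          + ∫⁻ x, ENNReal.ofReal (g x ^ 2) ∂(volume.restrict (Icc 0 L))) := by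
  set μ := (volume : Measure ℝ).restrict (Icc 0 L)
  have hne : ∀ᵐ x ∂μ, x ≠ d := by
    apply ae_restrict_of_ae
    simp [ae_iff]
  have hpi := Real.pi_lt_four
  have A := schur_lint μ (fun x y => 1 / (|x - d| + |y - d|)) (fun y => 1 / √|y - d|) (2 * Real.pi)
    (by positivity) (by unfold Function.uncurry; fun_prop) (by fun_prop)
    (fun x y => by positivity) (fun x y => by rw [add_comm])
    (by filter_upwards [hne] with x hx
        have : 0 < |x - d| := abs_pos.2 (sub_ne_zero.2 hx)
        positivity)
    (by filter_upwards [hne] with x hx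
        exact (setLIntegral_le_lintegral _ _).trans (hil_lint d x hx)) f g hf hg
  have B := schur_lint μ (fun x y => d / ((x - y) ^ 2 + d ^ 2)) (fun y => 1) Real.pi
    (by positivity) (by unfold Function.uncurry; fun_prop) (by fun_prop)
    (fun x y => by positivity) (fun x y => by congr 2; ring)
    (by filter_upwards with x; norm_num)
    (by filter_upwards with x
        simp only [mul_one]
        exact (setLIntegral_le_lintegral _ _).trans (poi_lint d x hd)) f g hf hg
  have hf1 : AEMeasurable (fun z : ℝ × ℝ => f z.1) (μ.prod μ) :=
    hf.comp_quasiMeasurePreserving Measure.quasiMeasurePreserving_fst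
  have hg2 : AEMeasurable (fun z : ℝ × ℝ => g z.2) (μ.prod μ) :=
    hg.comp_quasiMeasurePreserving Measure.quasiMeasurePreserving_snd
  calc _ = ∫⁻ z, (ENNReal.ofReal (1 / (|z.1 - d| + |z.2 - d|) * (|f z.1| * |g z.2|))
      + ENNReal.ofReal (d / ((z.1 - z.2) ^ 2 + d ^ 2) * (|f z.1| * |g z.2|))) ∂(μ.prod μ) := by
        apply lintegral_congr
        intro z
        rw [← ENNReal.ofReal_add (by positivity) (by positivity)]
        unfold kap
        congr 1
        ring
    _ = _ := by
        rw [lintegral_add_left']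
        apply AEMeasurable.ennreal_ofReal
        apply AEMeasurable.mul (by fun_prop)
        exact (continuous_abs.measurable.comp_aemeasurable hf1).mul
          (continuous_abs.measurable.comp_aemeasurable hg2)
    _ ≤ _ := add_le_add A B
    _ = ENNReal.ofReal (3 * Real.pi) * _ := by
        rw [← add_mul, ← ENNReal.ofReal_add (by positivity) (by positivity)]
        congr 2
        ring
    _ ≤ _ := by
        gcongr
        linarith

lemma kap_bound (d L : ℝ) (hd : 0 < d) (f g : ℝ → ℝ)
    (hf : ContinuousOn f (Icc 0 L)) (hg : ContinuousOn g (Icc 0 L)) :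
    Integrable (fun z : ℝ × ℝ => kap d z.1 z.2 * (|f z.1| * |g z.2|))
      ((volume.restrict (Icc 0 L)).prod (volume.restrict (Icc 0 L))) ∧
    ∫ z, kap d z.1 z.2 * (|f z.1| * |g z.2|)
      ∂((volume.restrict (Icc 0 L)).prod (volume.restrict (Icc 0 L)))
      ≤ 12 * (∫ x, f x ^ 2 ∂(volume.restrict (Icc 0 L))
          + ∫ x, g x ^ 2 ∂(volume.restrict (Icc 0 L))) := by
  set μ := (volume : Measure ℝ).restrict (Icc 0 L)
  have hfa : AEMeasurable f μ := hf.aemeasurable measurableSet_Icc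
  have hga : AEMeasurable g μ := hg.aemeasurable measurableSet_Icc
  have hf1 : AEMeasurable (fun z : ℝ × ℝ => f z.1) (μ.prod μ) :=
    hfa.comp_quasiMeasurePreserving Measure.quasiMeasurePreserving_fst
  have hg2 : AEMeasurable (fun z : ℝ × ℝ => g z.2) (μ.prod μ) :=
    hga.comp_quasiMeasurePreserving Measure.quasiMeasurePreserving_snd
  have hm : AEMeasurable (fun z : ℝ × ℝ => kap d z.1 z.2 * (|f z.1| * |g z.2|)) (μ.prod μ) :=
    (kap_meas d).aemeasurable.mul ((continuous_abs.measurable.comp_aemeasurable hf1).mul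
          (continuous_abs.measurable.comp_aemeasurable hg2))
  have hnn : ∀ z : ℝ × ℝ, 0 ≤ kap d z.1 z.2 * (|f z.1| * |g z.2|) := fun z =>
    mul_nonneg (kap_nonneg _ _ _ hd) (by positivity)
  have fi : Integrable (fun x => f x ^ 2) μ := (hf.pow 2).integrableOn_compact isCompact_Icc
  have gi : Integrable (fun x => g x ^ 2) μ := (hg.pow 2).integrableOn_compact isCompact_Icc
  have key := kap_lint d L hd f g hfa hga
  rw [← ofReal_integral_eq_lintegral_ofReal fi (by filter_upwards with x; positivity),
    ← ofReal_integral_eq_lintegral_ofReal gi (by filter_upwards with x; positivity),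
    ← ENNReal.ofReal_add (by positivity) (by positivity), ← ENNReal.ofReal_mul (by norm_num)] at key
  have hI : Integrable (fun z : ℝ × ℝ => kap d z.1 z.2 * (|f z.1| * |g z.2|)) (μ.prod μ) := by
    refine ⟨hm.aestronglyMeasurable, ?_⟩
    rw [hasFiniteIntegral_iff_ofReal (by filter_upwards with z; exact hnn z)]
    exact key.trans_lt ENNReal.ofReal_lt_top
  refine ⟨hI, ?_⟩
  rw [← ofReal_integral_eq_lintegral_ofReal hI (by filter_upwards with z; exact hnn z)] at key
  exact (ENNReal.ofReal_le_ofReal_iff (by positivity)).1 key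


/-- Primitive cube root of unity. -/
noncomputable def om : ℂ := ⟨-1 / 2, √3 / 2⟩

lemma sqrt3_sq : √3 * √3 = (3:ℝ) := Real.mul_self_sqrt (by norm_num)
lemma sqrt3_pos : 0 < √(3:ℝ) := Real.sqrt_pos.2 (by norm_num)

lemma om_sq : om ^ 2 = -1 - om := by
  apply Complex.ext <;> simp [om, pow_two, Complex.mul_re, Complex.mul_im] <;>
    nlinarith [sqrt3_sq]

lemma om_cube : om ^ 3 = 1 := by
  have : om ^ 3 = om * om ^ 2 := by ring
  rw [this, om_sq]
  have h := om_sq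
  linear_combination -h

lemma om_normSq (X Y : ℝ) : Complex.normSq ((Y:ℂ) - om * X) = X ^ 2 + X * Y + Y ^ 2 := by
  simp [om, Complex.normSq_apply, Complex.mul_re, Complex.mul_im]
  nlinarith [sqrt3_sq]

lemma om2_normSq (X Y : ℝ) : Complex.normSq ((Y:ℂ) - om ^ 2 * X) = X ^ 2 + X * Y + Y ^ 2 := by
  rw [om_sq]
  simp [om, Complex.normSq_apply, Complex.mul_re, Complex.mul_im]
  nlinarith [sqrt3_sq]

lemma half_le (X Y : ℝ) : ((|X| + |Y|) / 2) ^ 2 ≤ X ^ 2 + X * Y + Y ^ 2 := by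
  have h1 : X ^ 2 = |X| ^ 2 := (sq_abs _).symm
  have h2 : Y ^ 2 = |Y| ^ 2 := (sq_abs _).symm
  have h3 : -(|X| * |Y|) ≤ X * Y := by rw [← abs_mul]; exact neg_abs_le _
  rw [h1, h2]
  nlinarith [sq_nonneg (|X| - |Y|)]

lemma om_norm (X Y : ℝ) : (|X| + |Y|) / 2 ≤ ‖(Y:ℂ) - om * X‖ := by
  have : ‖(Y:ℂ) - om * X‖ ^ 2 = X ^ 2 + X * Y + Y ^ 2 := by
    rw [← Complex.normSq_eq_norm_sq, om_normSq]
  exact abs_le_of_sq_le_sq' (by rw [this]; exact half_le X Y) (norm_nonneg _) |>.2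

lemma om2_norm (X Y : ℝ) : (|X| + |Y|) / 2 ≤ ‖(Y:ℂ) - om ^ 2 * X‖ := by
  have : ‖(Y:ℂ) - om ^ 2 * X‖ ^ 2 = X ^ 2 + X * Y + Y ^ 2 := by
    rw [← Complex.normSq_eq_norm_sq, om2_normSq]
  exact abs_le_of_sq_le_sq' (by rw [this]; exact half_le X Y) (norm_nonneg _) |>.2

lemma om_ne {x y d : ℝ} (h : x ≠ d ∨ y ≠ d) : (y:ℂ) - om * x - (1 - om) * d ≠ 0 := by
  have e : (y:ℂ) - om * x - (1 - om) * d = ((y - d : ℝ) : ℂ) - om * ((x - d : ℝ) : ℂ) := by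
    push_cast; ring
  rw [e]
  intro h0
  have := om_norm (x - d) (y - d)
  rw [h0, norm_zero] at this
  have a := abs_nonneg (x - d)
  have b := abs_nonneg (y - d)
  rcases h with h | h
  · have := abs_pos.2 (sub_ne_zero.2 h); linarith
  · have := abs_pos.2 (sub_ne_zero.2 h); linarith

lemma om_norm_one : ‖om‖ = 1 := by
  have := om_normSq 1 0
  have h2 : ‖om‖ ^ 2 = 1 := by
    rw [← Complex.normSq_eq_norm_sq]
    simpa using this
  nlinarith [norm_nonneg om]

/-- Interval measure. -/
noncomputable abbrev mu (L : ℝ) : Measure ℝ := volume.restrict (Icc 0 L)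

lemma mu_integral {E : Type*} [NormedAddCommGroup E] [NormedSpace ℝ E] {L : ℝ} (hL : 0 ≤ L)
    (f : ℝ → E) : ∫ x, f x ∂(mu L) = ∫ x in (0:ℝ)..L, f x := by
  rw [intervalIntegral.integral_of_le hL, ← integral_Icc_eq_integral_Ioc]

lemma mu_ftc {L : ℝ} (hL : 0 ≤ L) (f f' : ℝ → ℂ) (h : ∀ x ∈ Icc 0 L, HasDerivAt f (f' x) x)
    (hi : Integrable f' (mu L)) : ∫ x, f' x ∂(mu L) = f L - f 0 := by
  rw [mu_integral hL]
  apply intervalIntegral.integral_eq_sub_of_hasDerivAt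
  · rw [uIcc_of_le hL]; exact h
  · rw [intervalIntegrable_iff_integrableOn_Icc_of_le hL]
    exact hi

lemma mu_ne (L d : ℝ) : ∀ᵐ x ∂(mu L), x ≠ d := by
  apply ae_restrict_of_ae
  simp [ae_iff]

lemma mu_mem (L : ℝ) : ∀ᵐ x ∂(mu L), x ∈ Icc 0 L := ae_restrict_mem measurableSet_Icc

lemma green0 {L : ℝ} (hL : 0 ≤ L) (d : ℝ) (ζ : ℂ) (h h' : ℂ → ℂ) (G Gx Gy : ℝ → ℝ → ℂ)
    (hh : ∀ x ∈ Icc 0 L, ∀ y ∈ Icc 0 L, (x ≠ d ∨ y ≠ d) →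
      HasDerivAt h (h' (y - ζ * x)) (y - ζ * x))
    (hGx : ∀ x ∈ Icc 0 L, ∀ y ∈ Icc 0 L, HasDerivAt (fun x => G x y) (Gx x y) x)
    (hGy : ∀ x ∈ Icc 0 L, ∀ y ∈ Icc 0 L, HasDerivAt (fun y => G x y) (Gy x y) y)
    (i1 : Integrable (fun p : ℝ × ℝ => h (p.2 - ζ * p.1) * Gx p.1 p.2
      - ζ * h' (p.2 - ζ * p.1) * G p.1 p.2) ((mu L).prod (mu L)))
    (i2 : Integrable (fun p : ℝ × ℝ => h (p.2 - ζ * p.1) * Gy p.1 p.2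
      + h' (p.2 - ζ * p.1) * G p.1 p.2) ((mu L).prod (mu L))) :
    ∫ p, h (p.2 - ζ * p.1) * (Gx p.1 p.2 + ζ * Gy p.1 p.2) ∂((mu L).prod (mu L))
      = (∫ y, (h (y - ζ * L) * G L y - h y * G 0 y) ∂(mu L))
        + ζ * ∫ x, (h (L - ζ * x) * G x L - h (-ζ * x) * G x 0) ∂(mu L) := by
  have e : ∀ p : ℝ × ℝ, h (p.2 - ζ * p.1) * (Gx p.1 p.2 + ζ * Gy p.1 p.2)
      = (h (p.2 - ζ * p.1) * Gx p.1 p.2 - ζ * h' (p.2 - ζ * p.1) * G p.1 p.2)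
        + ζ * (h (p.2 - ζ * p.1) * Gy p.1 p.2 + h' (p.2 - ζ * p.1) * G p.1 p.2) := by
    intro p; ring
  simp_rw [e]
  rw [integral_add i1 (i2.const_mul ζ), integral_const_mul]
  congr 1
  · rw [integral_prod_symm _ i1]
    apply integral_congr_ae
    filter_upwards [i1.prod_left_ae, mu_ne L d, mu_mem L] with y hy hne hmem
    have := mu_ftc hL (fun x => h (y - ζ * x) * G x y) _ (fun x hx => by
      have a1 := hh x hx y hmem (Or.inr hne)
      have a2 : HasDerivAt (fun x : ℝ => (y:ℂ) - ζ * (x:ℂ)) (-(ζ * 1)) x :=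
        ((hasDerivAt_id x).ofReal_comp.const_mul ζ).const_sub _
      have a3 := (a1.comp x a2).mul (hGx x hx y hmem)
      refine a3.congr_deriv (g' := h (y - ζ * x) * Gx x y - ζ * h' (y - ζ * x) * G x y) ?_
      simp only [Function.comp]
      ring) hy
    rw [this]
    simp
  · congr 1
    rw [integral_prod _ i2]
    apply integral_congr_ae
    filter_upwards [i2.prod_right_ae, mu_ne L d, mu_mem L] with x hx hne hmem
    have := mu_ftc hL (fun y => h (y - ζ * x) * G x y) _ (fun y hy => by
      have a1 := hh x hmem y hy (Or.inl hne)
      have a2 : HasDerivAt (fun y : ℝ => (y:ℂ) - ζ * (x:ℂ)) 1 y :=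
        ((hasDerivAt_id y).ofReal_comp).sub_const _
      have a3 := (a1.comp y a2).mul (hGy x hmem y hy)
      refine a3.congr_deriv (g' := h (y - ζ * x) * Gy x y + h' (y - ζ * x) * G x y) ?_
      simp only [Function.comp]
      ring) hx
    rw [this]
    simp

lemma box_int {L : ℝ} (f : ℝ × ℝ → ℂ) (hf : ContinuousOn f (Icc 0 L ×ˢ Icc 0 L)) :
    Integrable f ((mu L).prod (mu L)) := by
  have : Integrable f ((volume.prod volume).restrict (Icc 0 L ×ˢ Icc 0 L)) :=
    hf.integrableOn_compact (isCompact_Icc.prod isCompact_Icc)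
  rwa [← Measure.prod_restrict] at this

/-- Regular Green identity. -/
lemma green_reg {L : ℝ} (hL : 0 ≤ L) (ζ : ℂ) (h : ℂ → ℂ) (G Gx Gy : ℝ → ℝ → ℂ)
    (hh : ∀ x ∈ Icc 0 L, ∀ y ∈ Icc 0 L, AnalyticAt ℂ h (y - ζ * x))
    (hGx : ∀ x ∈ Icc 0 L, ∀ y ∈ Icc 0 L, HasDerivAt (fun x => G x y) (Gx x y) x)
    (hGy : ∀ x ∈ Icc 0 L, ∀ y ∈ Icc 0 L, HasDerivAt (fun y => G x y) (Gy x y) y)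
    (cG : ContinuousOn (fun p : ℝ × ℝ => G p.1 p.2) (Icc 0 L ×ˢ Icc 0 L))
    (cGx : ContinuousOn (fun p : ℝ × ℝ => Gx p.1 p.2) (Icc 0 L ×ˢ Icc 0 L))
    (cGy : ContinuousOn (fun p : ℝ × ℝ => Gy p.1 p.2) (Icc 0 L ×ˢ Icc 0 L)) :
    ∫ p, h (p.2 - ζ * p.1) * (Gx p.1 p.2 + ζ * Gy p.1 p.2) ∂((mu L).prod (mu L))
      = (∫ y, (h (y - ζ * L) * G L y - h y * G 0 y) ∂(mu L))
        + ζ * ∫ x, (h (L - ζ * x) * G x L - h (-ζ * x) * G x 0) ∂(mu L) := by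
  have c1 : ContinuousOn (fun p : ℝ × ℝ => h (p.2 - ζ * p.1)) (Icc 0 L ×ˢ Icc 0 L) := by
    intro p hp
    have a : ContinuousAt h (p.2 - ζ * p.1) := (hh p.1 hp.1 p.2 hp.2).continuousAt
    have b : ContinuousAt (fun p : ℝ × ℝ => (p.2:ℂ) - ζ * p.1) p := by fun_prop
    exact (ContinuousAt.comp (f := fun p : ℝ × ℝ => (p.2:ℂ) - ζ * p.1) a b).continuousWithinAt
  have c2 : ContinuousOn (fun p : ℝ × ℝ => deriv h (p.2 - ζ * p.1)) (Icc 0 L ×ˢ Icc 0 L) := by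
    intro p hp
    have a : ContinuousAt (deriv h) (p.2 - ζ * p.1) := (hh p.1 hp.1 p.2 hp.2).deriv.continuousAt
    have b : ContinuousAt (fun p : ℝ × ℝ => (p.2:ℂ) - ζ * p.1) p := by fun_prop
    exact (ContinuousAt.comp (f := fun p : ℝ × ℝ => (p.2:ℂ) - ζ * p.1) a b).continuousWithinAt
  apply green0 hL 0 ζ h (deriv h) G Gx Gy _ hGx hGy
  · exact box_int _ ((c1.mul cGx).sub ((continuousOn_const.mul c2).mul cG))
  · exact box_int _ ((c1.mul cGy).add (c2.mul cG))
  · intro x hx y hy _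
    exact (hh x hx y hy).differentiableAt.hasDerivAt


lemma om_re : om.re = -1 / 2 := rfl
lemma om_im : om.im = √3 / 2 := rfl

lemma contour {L d : ℝ} (hd : 0 < d) (hdL : d < L) :
    (∫ y, ((((y:ℂ) - om * L) - (1 - om) * d)⁻¹ - ((y:ℂ) - (1 - om) * d)⁻¹) ∂(mu L))
      + om * ∫ x, ((((L:ℂ) - om * x) - (1 - om) * d)⁻¹ - (-om * (x:ℂ) - (1 - om) * d)⁻¹) ∂(mu L)
      = 2 * Real.pi * Complex.I := by
  have hL : 0 ≤ L := by linarith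
  have s3 := sqrt3_pos
  -- right side
  have sl1 : ∀ y ∈ Icc 0 L, ((y:ℂ) - om * L - (1 - om) * d) ∈ Complex.slitPlane := by
    intro y hy
    right
    simp [om_re, om_im]
    intro h
    have : √3 * (L - d) = 0 := by linarith
    rcases mul_eq_zero.1 this with h | h <;> linarith
  have sl2 : ∀ y ∈ Icc 0 L, ((y:ℂ) - (1 - om) * d) ∈ Complex.slitPlane := by
    intro y hy
    right
    simp [om_re, om_im]
    exact hd.ne'
  have sl3 : ∀ x ∈ Icc 0 L, ((L:ℂ) - om * x - (1 - om) * d) ∈ Complex.slitPlane := by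
    intro x hx
    by_cases hxd : x = d
    · left
      simp [om_re, om_im, hxd]
      linarith
    · right
      simp [om_re, om_im]
      intro h
      have : √3 * (x - d) = 0 := by linarith
      rcases mul_eq_zero.1 this with h | h
      · linarith
      · exact hxd (by linarith)
  have sl4 : ∀ x ∈ Icc 0 L, (-(-om * (x:ℂ) - (1 - om) * d)) ∈ Complex.slitPlane := by
    intro x hx
    by_cases hxd : x = d
    · left
      simp [om_re, om_im, hxd]
      linarith
    · right
      simp [om_re, om_im]
      intro h
      have : √3 * (x - d) = 0 := by linarith
      rcases mul_eq_zero.1 this with h | h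
      · linarith
      · exact hxd (by linarith)
  have ci : ∀ f : ℝ → ℂ, ContinuousOn f (Icc 0 L) → (∀ x ∈ Icc 0 L, f x ≠ 0) →
      Integrable (fun x => (f x)⁻¹) (mu L) := by
    intro f hf h0
    exact (hf.inv₀ h0).integrableOn_compact isCompact_Icc
  have j1 := ci (fun y => (y:ℂ) - om * L - (1 - om) * d) (by fun_prop)
    (fun y hy => Complex.slitPlane_ne_zero (sl1 y hy))
  have j2 := ci (fun y => (y:ℂ) - (1 - om) * d) (by fun_prop)
    (fun y hy => Complex.slitPlane_ne_zero (sl2 y hy))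
  have j3 := ci (fun x => (L:ℂ) - om * x - (1 - om) * d) (by fun_prop)
    (fun y hy => Complex.slitPlane_ne_zero (sl3 y hy))
  have j4 := ci (fun x => -om * (x:ℂ) - (1 - om) * d) (by fun_prop)
    (fun y hy => neg_ne_zero.1 (Complex.slitPlane_ne_zero (sl4 y hy)))
  rw [integral_sub j1 j2, integral_sub j3 j4]
  have k1 := mu_ftc hL (fun y => Complex.log ((y:ℂ) - om * L - (1 - om) * d)) _ (fun y hy => by
    have a2 : HasDerivAt (fun y : ℝ => (y:ℂ) - om * L - (1 - om) * d) 1 y :=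
      (((hasDerivAt_id y).ofReal_comp).sub_const _).sub_const _
    have := a2.clog_real (sl1 y hy)
    simpa using this) (by simpa using j1)
  have k2 := mu_ftc hL (fun y => Complex.log ((y:ℂ) - (1 - om) * d)) _ (fun y hy => by
    have a2 : HasDerivAt (fun y : ℝ => (y:ℂ) - (1 - om) * d) 1 y :=
      (((hasDerivAt_id y).ofReal_comp).sub_const _)
    have := a2.clog_real (sl2 y hy)
    simpa using this) (by simpa using j2)
  have k3 := mu_ftc hL (fun x => Complex.log ((L:ℂ) - om * x - (1 - om) * d))
    (fun x => -om * ((L:ℂ) - om * x - (1 - om) * d)⁻¹) (fun x hx => by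
    have a2 : HasDerivAt (fun x : ℝ => (L:ℂ) - om * x - (1 - om) * d) (-(om * 1)) x :=
      (((hasDerivAt_id x).ofReal_comp.const_mul om).const_sub _).sub_const _
    have := a2.clog_real (sl3 x hx)
    refine this.congr_deriv ?_
    rw [div_eq_mul_inv, mul_one]) (by exact j3.const_mul _)
  have k4 := mu_ftc hL (fun x => Complex.log (-(-om * (x:ℂ) - (1 - om) * d)))
    (fun x => -om * (-om * (x:ℂ) - (1 - om) * d)⁻¹) (fun x hx => by
    have a2 : HasDerivAt (fun x : ℝ => -(-om * (x:ℂ) - (1 - om) * d)) (-(-om * 1)) x :=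
      (((hasDerivAt_id x).ofReal_comp.const_mul (-om)).sub_const _).neg
    have := a2.clog_real (sl4 x hx)
    refine this.congr_deriv ?_
    rw [div_eq_mul_inv, mul_one, inv_neg]
    ring) (by exact j4.const_mul _)
  rw [integral_const_mul] at k3 k4
  have l1 : Complex.log (-(-om * (L:ℂ) - (1 - om) * d))
      = Complex.log (((0:ℝ):ℂ) - om * L - (1 - om) * d) + Real.pi * Complex.I := by
    have e : -(-om * (L:ℂ) - (1 - om) * d) = -(((0:ℝ):ℂ) - om * L - (1 - om) * d) := by
      push_cast; ring
    rw [e, Complex.log, Complex.log, norm_neg, Complex.arg_neg_eq_arg_add_pi_of_im_neg]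
    · push_cast; ring
    · simp [om_re, om_im]
      nlinarith
  have l2 : Complex.log (-(-om * ((0:ℝ):ℂ) - (1 - om) * d))
      = Complex.log (((0:ℝ):ℂ) - (1 - om) * d) - Real.pi * Complex.I := by
    have e : -(-om * ((0:ℝ):ℂ) - (1 - om) * d) = -(((0:ℝ):ℂ) - (1 - om) * d) := by
      push_cast; ring
    rw [e, Complex.log, Complex.log, norm_neg, Complex.arg_neg_eq_arg_sub_pi_of_im_pos]
    · push_cast; ring
    · simp [om_re, om_im]
      nlinarith
  have l3 : Complex.log ((L:ℂ) - om * ((0:ℝ):ℂ) - (1 - om) * d)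
      = Complex.log ((L:ℂ) - (1 - om) * d) := by simp
  rw [l1, l2] at k4
  rw [l3] at k3
  simp only [mul_comm] at *
  linear_combination k1 - k2 - k3 + k4

lemma box_ae_mem (L : ℝ) : ∀ᵐ p ∂((mu L).prod (mu L)), p.1 ∈ Icc 0 L ∧ p.2 ∈ Icc 0 L := by
  have h1 : ∀ᵐ p ∂((mu L).prod (mu L)), p.1 ∈ Icc 0 L :=
    Measure.quasiMeasurePreserving_fst.ae (mu_mem L)
  have h2 : ∀ᵐ p ∂((mu L).prod (mu L)), p.2 ∈ Icc 0 L :=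
    Measure.quasiMeasurePreserving_snd.ae (mu_mem L)
  filter_upwards [h1, h2] with p a b using ⟨a, b⟩

lemma prod_ne (L d : ℝ) : ∀ᵐ p ∂((mu L).prod (mu L)), p.1 ≠ d :=
    Measure.quasiMeasurePreserving_fst.ae (mu_ne L d)

lemma kap_int (d L : ℝ) (hd : 0 < d) :
    Integrable (fun p : ℝ × ℝ => kap d p.1 p.2) ((mu L).prod (mu L)) := by
  have := (kap_bound d L hd (fun _ => 1) (fun _ => 1) continuousOn_const continuousOn_const).1
  simpa using this

lemma box_bdd {L : ℝ} (f : ℝ × ℝ → ℂ) (hf : ContinuousOn f (Icc 0 L ×ˢ Icc 0 L)) :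
    ∃ M, 0 ≤ M ∧ ∀ x ∈ Icc 0 L, ∀ y ∈ Icc 0 L, ‖f (x, y)‖ ≤ M := by
  obtain ⟨M, hM⟩ := (isCompact_Icc.prod isCompact_Icc).exists_bound_of_continuousOn hf
  exact ⟨max M 0, le_max_right _ _, fun x hx y hy => (hM (x, y) ⟨hx, hy⟩).trans (le_max_left _ _)⟩

lemma box_meas {L : ℝ} (f : ℝ × ℝ → ℂ) (hf : ContinuousOn f (Icc 0 L ×ˢ Icc 0 L)) :
    AEStronglyMeasurable f ((mu L).prod (mu L)) := (box_int f hf).aestronglyMeasurable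

/-- Cauchy-Pompeiu type identity. -/
lemma green_pole {L d : ℝ} (hd : 0 < d) (hdL : d < L) (G Gx Gy : ℝ → ℝ → ℂ)
    (hGx : ∀ x ∈ Icc 0 L, ∀ y ∈ Icc 0 L, HasDerivAt (fun x => G x y) (Gx x y) x)
    (hGy : ∀ x ∈ Icc 0 L, ∀ y ∈ Icc 0 L, HasDerivAt (fun y => G x y) (Gy x y) y)
    (cG : ContinuousOn (fun p : ℝ × ℝ => G p.1 p.2) (Icc 0 L ×ˢ Icc 0 L))
    (cGx : ContinuousOn (fun p : ℝ × ℝ => Gx p.1 p.2) (Icc 0 L ×ˢ Icc 0 L))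
    (cGy : ContinuousOn (fun p : ℝ × ℝ => Gy p.1 p.2) (Icc 0 L ×ˢ Icc 0 L))
    (h : ℂ → ℂ) (hh : h = fun w => (w - (1 - om) * d)⁻¹) :
    ∫ p, h (p.2 - om * p.1) * (Gx p.1 p.2 + om * Gy p.1 p.2) ∂((mu L).prod (mu L))
      = (∫ y, (h (y - om * L) * G L y - h y * G 0 y) ∂(mu L))
        + om * (∫ x, (h (L - om * x) * G x L - h (-om * x) * G x 0) ∂(mu L))
        - 2 * Real.pi * Complex.I * G d d := by
  have hL : 0 ≤ L := by linarith
  have hdm : d ∈ Icc 0 L := ⟨hd.le, hdL.le⟩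
  obtain ⟨Mx, hMx0, hMx⟩ := box_bdd _ cGx
  obtain ⟨My, hMy0, hMy⟩ := box_bdd _ cGy
  -- Lipschitz bound
  have lip : ∀ x ∈ Icc 0 L, ∀ y ∈ Icc 0 L, ‖G x y - G d d‖ ≤ (Mx + My) * (|x - d| + |y - d|) := by
    intro x hx y hy
    have a1 : ‖G x y - G d y‖ ≤ Mx * ‖x - d‖ :=
      (convex_Icc 0 L).norm_image_sub_le_of_norm_hasDerivWithin_le (f := fun x => G x y)
        (f' := fun x => Gx x y) (fun z hz => (hGx z hz y hy).hasDerivWithinAt)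
        (fun z hz => hMx z hz y hy) hdm hx
    have a2 : ‖G d y - G d d‖ ≤ My * ‖y - d‖ :=
      (convex_Icc 0 L).norm_image_sub_le_of_norm_hasDerivWithin_le (f := fun y => G d y)
        (f' := fun y => Gy d y) (fun z hz => (hGy d hdm z hz).hasDerivWithinAt)
        (fun z hz => hMy d hdm z hz) hdm hy
    have a3 : G x y - G d d = (G x y - G d y) + (G d y - G d d) := by ring
    rw [a3]
    rw [Real.norm_eq_abs] at a1 a2
    have b1 := abs_nonneg (x - d)
    have b2 := abs_nonneg (y - d)
    calc _ ≤ _ := norm_add_le _ _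
      _ ≤ _ := add_le_add a1 a2
      _ ≤ _ := by nlinarith
  have hnb : ∀ x y : ℝ, (x ≠ d) → ‖h (y - om * x)‖ ≤ 2 * (1 / (|x - d| + |y - d|)) ∧
      ‖-(((y:ℂ) - om * x - (1 - om) * d) ^ 2)⁻¹‖ ≤ 4 * (1 / (|x - d| + |y - d|)) * (1 / (|x - d| + |y - d|)) := by
    intro x y hx
    have e : (y:ℂ) - om * x - (1 - om) * d = ((y - d : ℝ) : ℂ) - om * ((x - d : ℝ) : ℂ) := by
      push_cast; ring
    have b := om_norm (x - d) (y - d)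
    have hp : 0 < |x - d| + |y - d| := by
      have := abs_pos.2 (sub_ne_zero.2 hx)
      positivity
    have b' : ‖(((y - d : ℝ) : ℂ) - om * ((x - d : ℝ) : ℂ))‖⁻¹ ≤ 2 * (1 / (|x - d| + |y - d|)) := by
      calc _ ≤ ((|x - d| + |y - d|) / 2)⁻¹ := inv_anti₀ (by positivity) b
        _ = _ := by field_simp
    constructor
    · rw [hh]
      simp only
      rw [e, norm_inv]
      exact b'
    · rw [e, norm_neg, norm_inv, norm_pow, ← inv_pow, pow_two]
      calc _ ≤ _ := mul_le_mul b' b' (by positivity) (by positivity)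
        _ = _ := by ring
  have hm : Measurable h := by rw [hh]; fun_prop
  have hm1 : AEStronglyMeasurable (fun p : ℝ × ℝ => h (p.2 - om * p.1)) ((mu L).prod (mu L)) := by
    apply Measurable.aestronglyMeasurable
    apply hm.comp
    fun_prop
  have hm2 : AEStronglyMeasurable (fun p : ℝ × ℝ => -(((p.2:ℂ) - om * p.1 - (1 - om) * d) ^ 2)⁻¹)
      ((mu L).prod (mu L)) := by
    apply Measurable.aestronglyMeasurable
    fun_prop
  have key := green0 hL d om h (fun w => -((w - (1 - om) * d) ^ 2)⁻¹) (fun x y => G x y - G d d) Gx Gy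
    (by
      intro x hx y hy hne
      have := (((hasDerivAt_id ((y:ℂ) - om * x)).sub_const ((1 - om) * d)).inv (om_ne hne))
      rw [hh]
      refine this.congr_deriv ?_
      simp only [id]
      rw [neg_div, one_div])
    (fun x hx y hy => (hGx x hx y hy).sub_const _)
    (fun x hx y hy => (hGy x hx y hy).sub_const _)
    (by
      refine ((kap_int d L hd).const_mul (2 * Mx + 4 * (Mx + My))).mono'
        ((hm1.mul (box_meas _ cGx)).sub ((hm2.const_mul om).mul
          (box_meas _ (cG.sub continuousOn_const)))) ?_
      filter_upwards [box_ae_mem L, prod_ne L d] with p hp hne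
      obtain ⟨n1, n2⟩ := hnb p.1 p.2 hne
      have l1 := lip p.1 hp.1 p.2 hp.2
      have l2 := hMx p.1 hp.1 p.2 hp.2
      have hpos : 0 < |p.1 - d| + |p.2 - d| := by
        have := abs_pos.2 (sub_ne_zero.2 hne)
        positivity
      have hk : 1 / (|p.1 - d| + |p.2 - d|) ≤ kap d p.1 p.2 := by
        unfold kap
        have : 0 ≤ d / ((p.1 - p.2) ^ 2 + d ^ 2) := by positivity
        linarith
      calc _ ≤ _ := norm_sub_le _ _
        _ ≤ 2 * (1 / (|p.1 - d| + |p.2 - d|)) * Mx + 1 * (4 * (1 / (|p.1 - d| + |p.2 - d|)) * (1 / (|p.1 - d| + |p.2 - d|))) * ((Mx + My) * (|p.1 - d| + |p.2 - d|)) := by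
          rw [norm_mul, norm_mul, norm_mul, om_norm_one]
          gcongr
        _ = (2 * Mx + 4 * (Mx + My)) * (1 / (|p.1 - d| + |p.2 - d|)) := by
          field_simp
        _ ≤ _ := by gcongr)
    (by
      refine ((kap_int d L hd).const_mul (2 * My + 4 * (Mx + My))).mono'
        ((hm1.mul (box_meas _ cGy)).add (hm2.mul
          (box_meas _ (cG.sub continuousOn_const)))) ?_
      filter_upwards [box_ae_mem L, prod_ne L d] with p hp hne
      obtain ⟨n1, n2⟩ := hnb p.1 p.2 hne
      have l1 := lip p.1 hp.1 p.2 hp.2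
      have l2 := hMy p.1 hp.1 p.2 hp.2
      have hpos : 0 < |p.1 - d| + |p.2 - d| := by
        have := abs_pos.2 (sub_ne_zero.2 hne)
        positivity
      have hk : 1 / (|p.1 - d| + |p.2 - d|) ≤ kap d p.1 p.2 := by
        unfold kap
        have : 0 ≤ d / ((p.1 - p.2) ^ 2 + d ^ 2) := by positivity
        linarith
      calc _ ≤ _ := norm_add_le _ _
        _ ≤ 2 * (1 / (|p.1 - d| + |p.2 - d|)) * My + (4 * (1 / (|p.1 - d| + |p.2 - d|)) * (1 / (|p.1 - d| + |p.2 - d|))) * ((Mx + My) * (|p.1 - d| + |p.2 - d|)) := by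
          rw [norm_mul, norm_mul]
          gcongr
        _ = (2 * My + 4 * (Mx + My)) * (1 / (|p.1 - d| + |p.2 - d|)) := by
          field_simp
        _ ≤ _ := by gcongr)
  rw [key]
  have cont := contour hd hdL
  -- boundary continuity
  have hc : ∀ v : ℝ → ℂ, ContinuousOn v (Icc 0 L) → (∀ x ∈ Icc 0 L, v x - (1 - om) * d ≠ 0) →
      ContinuousOn (fun x => h (v x)) (Icc 0 L) := by
    intro v hv h0
    rw [hh]
    exact (hv.sub continuousOn_const).inv₀ h0
  have c1 := hc (fun y => (y:ℂ) - om * L) (by fun_prop) (fun y hy => om_ne (Or.inl hdL.ne'))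
  have c2 := hc (fun y => (y:ℂ)) (by fun_prop) (fun y hy => by
    have := om_ne (x := 0) (y := y) (d := d) (Or.inl hd.ne)
    simpa using this)
  have c3 := hc (fun x => (L:ℂ) - om * x) (by fun_prop) (fun y hy => om_ne (Or.inr hdL.ne'))
  have c4 := hc (fun x => -om * (x:ℂ)) (by fun_prop) (fun x hx => by
    have := om_ne (x := x) (y := 0) (d := d) (Or.inr hd.ne)
    simpa using this)
  have g1 : ContinuousOn (fun y => G L y) (Icc 0 L) :=
    cG.comp (f := fun y => (L, y)) (by fun_prop) (fun y hy => ⟨⟨hL, le_rfl⟩, hy⟩)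
  have g2 : ContinuousOn (fun y => G 0 y) (Icc 0 L) :=
    cG.comp (f := fun y => (0, y)) (by fun_prop) (fun y hy => ⟨⟨le_rfl, hL⟩, hy⟩)
  have g3 : ContinuousOn (fun x => G x L) (Icc 0 L) :=
    cG.comp (f := fun x => (x, L)) (by fun_prop) (fun y hy => ⟨hy, ⟨hL, le_rfl⟩⟩)
  have g4 : ContinuousOn (fun x => G x 0) (Icc 0 L) :=
    cG.comp (f := fun x => (x, 0)) (by fun_prop) (fun y hy => ⟨hy, ⟨le_rfl, hL⟩⟩)
  have I1 : Integrable (fun y : ℝ => h (y - om * L) * G L y - h y * G 0 y) (mu L) :=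
    ((c1.mul g1).sub (c2.mul g2)).integrableOn_compact isCompact_Icc
  have I2 : Integrable (fun y : ℝ => h (y - om * L) - h y) (mu L) :=
    (c1.sub c2).integrableOn_compact isCompact_Icc
  have I3 : Integrable (fun x : ℝ => h (L - om * x) * G x L - h (-om * x) * G x 0) (mu L) :=
    ((c3.mul g3).sub (c4.mul g4)).integrableOn_compact isCompact_Icc
  have I4 : Integrable (fun x : ℝ => h (L - om * x) - h (-om * x)) (mu L) :=
    (c3.sub c4).integrableOn_compact isCompact_Icc
  have e1 : ∫ y : ℝ, (h (y - om * L) * (G L y - G d d) - h y * (G 0 y - G d d)) ∂(mu L)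
      = (∫ y : ℝ, (h (y - om * L) * G L y - h y * G 0 y) ∂(mu L))
        - (∫ y : ℝ, (h (y - om * L) - h y) ∂(mu L)) * G d d := by
    rw [← integral_mul_const, ← integral_sub I1 (I2.mul_const _)]
    congr 1; ext y; ring
  have e2 : ∫ x : ℝ, (h (L - om * x) * (G x L - G d d) - h (-om * x) * (G x 0 - G d d)) ∂(mu L)
      = (∫ x : ℝ, (h (L - om * x) * G x L - h (-om * x) * G x 0) ∂(mu L))
        - (∫ x : ℝ, (h (L - om * x) - h (-om * x)) ∂(mu L)) * G d d := by
    rw [← integral_mul_const, ← integral_sub I3 (I4.mul_const _)]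
    congr 1; ext y; ring
  have cont' : (∫ y : ℝ, (h (y - om * L) - h y) ∂(mu L))
      + om * (∫ x : ℝ, (h (L - om * x) - h (-om * x)) ∂(mu L)) = 2 * Real.pi * Complex.I := by
    rw [hh]; exact cont
  rw [e1, e2, ← cont']
  ring


lemma ker_int {L d : ℝ} (hd : 0 < d) (K : ℝ × ℝ → ℂ)
    (hK : AEStronglyMeasurable K ((mu L).prod (mu L))) (C0 : ℝ)
    (hb : ∀ᵐ p ∂((mu L).prod (mu L)), ‖K p‖ ≤ C0 * kap d p.1 p.2)
    (F : ℝ × ℝ → ℂ) (hF : ContinuousOn F (Icc 0 L ×ˢ Icc 0 L)) :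
    Integrable (fun p => K p * F p) ((mu L).prod (mu L)) := by
  obtain ⟨M, hM0, hM⟩ := box_bdd F hF
  refine Integrable.mono' (((kap_int d L hd).const_mul C0).mul_const M) (hK.mul (box_meas F hF)) ?_
  filter_upwards [hb, box_ae_mem L] with p h1 h2
  rw [norm_mul]
  have := hM p.1 h2.1 p.2 h2.2
  exact mul_le_mul h1 this (norm_nonneg _) ((norm_nonneg _).trans h1)

lemma ker_bd {L d : ℝ} (hd : 0 < d) (K : ℝ × ℝ → ℂ) (C0 : ℝ) (hC0 : 0 ≤ C0)
    (hb : ∀ᵐ p ∂((mu L).prod (mu L)), ‖K p‖ ≤ C0 * kap d p.1 p.2)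
    (f g : ℝ → ℝ) (hf : ContinuousOn f (Icc 0 L)) (hg : ContinuousOn g (Icc 0 L)) :
    ‖∫ p, K p * ((f p.1 : ℂ) * (g p.2 : ℂ)) ∂((mu L).prod (mu L))‖
      ≤ C0 * (12 * (∫ x, f x ^ 2 ∂(mu L) + ∫ x, g x ^ 2 ∂(mu L))) := by
  obtain ⟨h1, h2⟩ := kap_bound d L hd f g hf hg
  have : ‖∫ p, K p * ((f p.1 : ℂ) * (g p.2 : ℂ)) ∂((mu L).prod (mu L))‖
      ≤ ∫ p, C0 * (kap d p.1 p.2 * (|f p.1| * |g p.2|)) ∂((mu L).prod (mu L)) := by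
    apply norm_integral_le_of_norm_le (h1.const_mul C0)
    filter_upwards [hb] with p hp
    rw [norm_mul, norm_mul, Complex.norm_real, Complex.norm_real, Real.norm_eq_abs, Real.norm_eq_abs]
    have h0 : 0 ≤ |f p.1| * |g p.2| := by positivity
    have := mul_le_mul_of_nonneg_right hp h0
    linarith
  rw [integral_const_mul] at this
  exact this.trans (mul_le_mul_of_nonneg_left h2 hC0)

structure FD (L : ℝ) (f f1 q q1 ρ : ℝ → ℝ) : Prop where
  hf : ∀ x ∈ Icc 0 L, HasDerivAt f (f1 x) x
  hf1 : ∀ x ∈ Icc 0 L, HasDerivAt f1 (q x + ρ x) x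
  hq : ∀ x ∈ Icc 0 L, HasDerivAt q (q1 x) x
  cq1 : ContinuousOn q1 (Icc 0 L)
  cr : ContinuousOn ρ (Icc 0 L)
  fL : f L = 0
  f1L : f1 L = 0
  qL : q L = 0

namespace FD
variable {L : ℝ} {f f1 q q1 ρ : ℝ → ℝ}
lemma cf (H : FD L f f1 q q1 ρ) : ContinuousOn f (Icc 0 L) :=
  fun x hx => (H.hf x hx).continuousAt.continuousWithinAt
lemma cf1 (H : FD L f f1 q q1 ρ) : ContinuousOn f1 (Icc 0 L) :=
  fun x hx => (H.hf1 x hx).continuousAt.continuousWithinAt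
lemma cq (H : FD L f f1 q q1 ρ) : ContinuousOn q (Icc 0 L) :=
  fun x hx => (H.hq x hx).continuousAt.continuousWithinAt
end FD

lemma c_fst {L : ℝ} {f : ℝ → ℝ} (h : ContinuousOn f (Icc 0 L)) :
    ContinuousOn (fun p : ℝ × ℝ => (f p.1 : ℂ)) (Icc 0 L ×ˢ Icc 0 L) :=
  Complex.continuous_ofReal.comp_continuousOn (h.comp continuousOn_fst (fun _ hp => hp.1))
lemma c_snd {L : ℝ} {f : ℝ → ℝ} (h : ContinuousOn f (Icc 0 L)) :
    ContinuousOn (fun p : ℝ × ℝ => (f p.2 : ℂ)) (Icc 0 L ×ˢ Icc 0 L) :=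
  Complex.continuous_ofReal.comp_continuousOn (h.comp continuousOn_snd (fun _ hp => hp.2))

noncomputable def GG (f f1 q : ℝ → ℝ) (ζ : ℂ) (x y : ℝ) : ℂ :=
  q x * f y - ζ * (f1 x * f1 y) + ζ ^ 2 * (f x * q y)

/-- boundary functional -/
noncomputable def bdF (L : ℝ) (f f1 q : ℝ → ℝ) (ζ : ℂ) (h : ℂ → ℂ) : ℂ :=
  -(∫ y, h y * GG f f1 q ζ 0 y ∂(mu L)) - ζ * ∫ x, h (-ζ * x) * GG f f1 q ζ x 0 ∂(mu L)

section
variable {L d : ℝ} {f f1 q q1 ρ : ℝ → ℝ}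

/-- splitting integral -/
lemma split_int (H : FD L f f1 q q1 ρ) (hd : 0 < d) (ζ : ℂ) (K : ℝ × ℝ → ℂ)
    (hK : AEStronglyMeasurable K ((mu L).prod (mu L))) (C0 : ℝ)
    (hb : ∀ᵐ p ∂((mu L).prod (mu L)), ‖K p‖ ≤ C0 * kap d p.1 p.2) :
    ∫ p, K p * ((q1 p.1 * f p.2 + f p.1 * q1 p.2) - ζ * (ρ p.1 * f1 p.2) - ζ ^ 2 * (f1 p.1 * ρ p.2)) ∂((mu L).prod (mu L))
      = (∫ p, K p * (q1 p.1 * f p.2 + f p.1 * q1 p.2) ∂((mu L).prod (mu L)))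
        - ζ * (∫ p, K p * (ρ p.1 * f1 p.2) ∂((mu L).prod (mu L)))
        - ζ ^ 2 * (∫ p, K p * (f1 p.1 * ρ p.2) ∂((mu L).prod (mu L))) := by
  have i1 := ker_int hd K hK C0 hb (fun p => q1 p.1 * f p.2 + f p.1 * q1 p.2)
    (((c_fst H.cq1).mul (c_snd H.cf)).add ((c_fst H.cf).mul (c_snd H.cq1)))
  have i2 := (ker_int hd K hK C0 hb (fun p => ρ p.1 * f1 p.2) ((c_fst H.cr).mul (c_snd H.cf1))).const_mul ζ
  have i3 := (ker_int hd K hK C0 hb (fun p => f1 p.1 * ρ p.2) ((c_fst H.cf1).mul (c_snd H.cr))).const_mul (ζ^2)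
  rw [← integral_const_mul, ← integral_const_mul, ← integral_sub i1 i2]
  refine Eq.trans ?_ (integral_sub (i1.sub i2) i3)
  congr 1; ext p; ring

lemma split_bd (H : FD L f f1 q q1 ρ) (hd : 0 < d) (ζ : ℂ) (hz : ‖ζ‖ = 1) (K : ℝ × ℝ → ℂ)
    (hK : AEStronglyMeasurable K ((mu L).prod (mu L))) (C0 : ℝ) (hC0 : 0 ≤ C0)
    (hb : ∀ᵐ p ∂((mu L).prod (mu L)), ‖K p‖ ≤ C0 * kap d p.1 p.2) :
    ‖(∫ p, K p * (q1 p.1 * f p.2 + f p.1 * q1 p.2) ∂((mu L).prod (mu L))) -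
    ∫ p, K p * ((q1 p.1 * f p.2 + f p.1 * q1 p.2) - ζ * (ρ p.1 * f1 p.2) - ζ ^ 2 * (f1 p.1 * ρ p.2)) ∂((mu L).prod (mu L))‖
     ≤ 24 * C0 * (∫ x, ρ x ^ 2 ∂(mu L) + ∫ x, f1 x ^ 2 ∂(mu L)) := by
  rw [split_int H hd ζ K hK C0 hb]
  have b1 := ker_bd hd K C0 hC0 hb ρ f1 H.cr H.cf1
  have b2 := ker_bd hd K C0 hC0 hb f1 ρ H.cf1 H.cr
  set J1 := ∫ p, K p * (ρ p.1 * f1 p.2) ∂((mu L).prod (mu L))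
  set J2 := ∫ p, K p * (f1 p.1 * ρ p.2) ∂((mu L).prod (mu L))
  have : ∀ I : ℂ, I - (I - ζ * J1 - ζ ^ 2 * J2) = ζ * J1 + ζ ^ 2 * J2 := by intro I; ring
  rw [this]
  refine (norm_add_le _ _).trans ?_
  rw [norm_mul, norm_mul, norm_pow, hz, one_pow, one_mul, one_mul]
  linarith

lemma gg_derivs (H : FD L f f1 q q1 ρ) (ζ : ℂ) :
    (∀ x ∈ Icc 0 L, ∀ y ∈ Icc 0 L, HasDerivAt (fun x => GG f f1 q ζ x y)
      (q1 x * f y - ζ * (((q x + ρ x : ℝ):ℂ) * f1 y) + ζ ^ 2 * (f1 x * q y)) x) ∧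
    (∀ x ∈ Icc 0 L, ∀ y ∈ Icc 0 L, HasDerivAt (fun y => GG f f1 q ζ x y)
      (q x * f1 y - ζ * (f1 x * ((q y + ρ y : ℝ):ℂ)) + ζ ^ 2 * (f x * q1 y)) y) := by
  constructor
  · intro x hx y hy
    unfold GG
    exact (((H.hq x hx).ofReal_comp.mul_const _).sub (((H.hf1 x hx).ofReal_comp.mul_const _).const_mul ζ)).add
      (((H.hf x hx).ofReal_comp.mul_const _).const_mul _)
  · intro x hx y hy
    unfold GG
    exact (((H.hf y hy).ofReal_comp.const_mul _).sub (((H.hf1 y hy).ofReal_comp.const_mul _).const_mul ζ)).add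
      (((H.hq y hy).ofReal_comp.const_mul _).const_mul _)

lemma gg_cont (H : FD L f f1 q q1 ρ) (ζ : ℂ) :
    ContinuousOn (fun p : ℝ × ℝ => GG f f1 q ζ p.1 p.2) (Icc 0 L ×ˢ Icc 0 L) ∧
    ContinuousOn (fun p : ℝ × ℝ => (q1 p.1 * f p.2 - ζ * (((q p.1 + ρ p.1 : ℝ):ℂ) * f1 p.2) + ζ ^ 2 * (f1 p.1 * q p.2) : ℂ)) (Icc 0 L ×ˢ Icc 0 L) ∧
    ContinuousOn (fun p : ℝ × ℝ => (q p.1 * f1 p.2 - ζ * (f1 p.1 * ((q p.2 + ρ p.2 : ℝ):ℂ)) + ζ ^ 2 * (f p.1 * q1 p.2) : ℂ)) (Icc 0 L ×ˢ Icc 0 L) := by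
  refine ⟨?_, ?_, ?_⟩
  · unfold GG
    exact (((c_fst H.cq).mul (c_snd H.cf)).sub (continuousOn_const.mul ((c_fst H.cf1).mul (c_snd H.cf1)))).add
      (continuousOn_const.mul ((c_fst H.cf).mul (c_snd H.cq)))
  · exact (((c_fst H.cq1).mul (c_snd H.cf)).sub (continuousOn_const.mul ((c_fst (H.cq.add H.cr)).mul (c_snd H.cf1)))).add
      (continuousOn_const.mul ((c_fst H.cf1).mul (c_snd H.cq)))
  · exact (((c_fst H.cq).mul (c_snd H.cf1)).sub (continuousOn_const.mul ((c_fst H.cf1).mul (c_snd (H.cq.add H.cr))))).add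
      (continuousOn_const.mul ((c_fst H.cf).mul (c_snd H.cq1)))

lemma green_reg_f (H : FD L f f1 q q1 ρ) (hL : 0 ≤ L) (ζ : ℂ) (hz : ζ ^ 3 = 1) (h : ℂ → ℂ)
    (hh : ∀ x ∈ Icc 0 L, ∀ y ∈ Icc 0 L, AnalyticAt ℂ h (y - ζ * x)) :
    ∫ p, h (p.2 - ζ * p.1) * ((q1 p.1 * f p.2 + f p.1 * q1 p.2) - ζ * (ρ p.1 * f1 p.2) - ζ ^ 2 * (f1 p.1 * ρ p.2)) ∂((mu L).prod (mu L))
    = bdF L f f1 q ζ h := by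
  have := green_reg hL ζ h (GG f f1 q ζ) _ _ hh (gg_derivs H ζ).1 (gg_derivs H ζ).2 (gg_cont H ζ).1
    (gg_cont H ζ).2.1 (gg_cont H ζ).2.2
  have e1 : ∀ y, GG f f1 q ζ L y = 0 := by intro y; simp [GG, H.fL, H.f1L, H.qL]
  have e2 : ∀ x, GG f f1 q ζ x L = 0 := by intro y; simp [GG, H.fL, H.f1L, H.qL]
  simp only [e1, e2, mul_zero, zero_sub] at this
  rw [integral_neg, integral_neg, mul_neg, ← sub_eq_add_neg] at this
  unfold bdF
  rw [← this]
  congr 1; ext p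
  push_cast
  linear_combination (-h (p.2 - ζ * p.1) * (f p.1 * q1 p.2)) * hz

lemma green_pole_f (H : FD L f f1 q q1 ρ) (hd : 0 < d) (hdL : d < L) (h : ℂ → ℂ) (hh : h = fun w => (w - (1 - om) * d)⁻¹) :
    ∫ p, h (p.2 - om * p.1) * ((q1 p.1 * f p.2 + f p.1 * q1 p.2) - om * (ρ p.1 * f1 p.2) - om ^ 2 * (f1 p.1 * ρ p.2)) ∂((mu L).prod (mu L))
    = bdF L f f1 q om h + 2 * Real.pi * Complex.I * om * ((f d * q d + f1 d ^ 2 : ℝ) : ℂ) := by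
  have := green_pole hd hdL (GG f f1 q om) _ _ (gg_derivs H om).1 (gg_derivs H om).2 (gg_cont H om).1
    (gg_cont H om).2.1 (gg_cont H om).2.2 h hh
  have e1 : ∀ y, GG f f1 q om L y = 0 := by intro y; simp [GG, H.fL, H.f1L, H.qL]
  have e2 : ∀ x, GG f f1 q om x L = 0 := by intro y; simp [GG, H.fL, H.f1L, H.qL]
  simp only [e1, e2, mul_zero, zero_sub] at this
  rw [integral_neg, integral_neg, mul_neg, ← sub_eq_add_neg] at this
  have e3 : bdF L f f1 q om h + 2 * Real.pi * Complex.I * om * ((f d * q d + f1 d ^ 2 : ℝ) : ℂ)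
     = bdF L f f1 q om h - 2 * Real.pi * Complex.I * GG f f1 q om d d := by
    unfold GG
    push_cast
    linear_combination (2 * Real.pi * Complex.I * (f d * q d)) * om_sq
  rw [e3]
  unfold bdF
  rw [← this]
  congr 1; ext p
  push_cast
  linear_combination (-h (p.2 - om * p.1) * (f p.1 * q1 p.2)) * om_cube
end


/-- The good kernel property. -/
def GK (L d β : ℝ) : Prop := ∃ k : ℝ × ℝ → ℝ, AEStronglyMeasurable k ((mu L).prod (mu L)) ∧
  (∀ᵐ p ∂((mu L).prod (mu L)), |k p| ≤ 54 * kap d p.1 p.2) ∧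
  ∀ f f1 q q1 ρ : ℝ → ℝ, FD L f f1 q q1 ρ → (β = 0 → f 0 = 0 ∧ f1 0 = 0) →
    |(∫ p, k p * (q1 p.1 * f p.2 + f p.1 * q1 p.2) ∂((mu L).prod (mu L)))
      + 2 * Real.pi * (f d * q d + f1 d ^ 2)| ≤
      1296 * (∫ x, ρ x ^ 2 ∂(mu L) + ∫ x, f1 x ^ 2 ∂(mu L))
      + β * (108 * |q 0| * ∫ y, d / (y ^ 2 + d ^ 2) * |f y| ∂(mu L))

lemma om2_alt : om ^ 2 = -1 - om := om_sq

lemma inv_bd {w : ℂ} {s r : ℝ} (hs : 0 < s) (hr : 0 < r) (h : s / r ≤ ‖w‖) : ‖w⁻¹‖ ≤ r * (1 / s) := by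
  rw [norm_inv, mul_one_div]
  have : 0 < s / r := by positivity
  rw [inv_le_comm₀ (by linarith) (by positivity), inv_div]
  exact h

/-- kernel for the left end. -/
noncomputable def hN (d : ℝ) (w : ℂ) : ℂ := (w - (1 - om) * d)⁻¹
  + (om * (w - om * ((1 - om) * d))⁻¹ + om ^ 2 * (w - om ^ 2 * ((1 - om) * d))⁻¹)

noncomputable def hD (d : ℝ) (w : ℂ) : ℂ := (w - (1 - om) * d)⁻¹ - (w + (1 - om) * d)⁻¹

lemma one_sub_om_cube : (1 - om) ^ 3 = -(3 * √3 * Complex.I : ℂ) := by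
  apply Complex.ext
  · simp [pow_succ, om_re, om_im]; nlinarith [sqrt3_sq]
  · simp [pow_succ, om_re, om_im]; linear_combination (√3 / 8) * sqrt3_sq

lemma sub_cube_ne {d u : ℝ} (hd : 0 < d) : (u:ℂ) ^ 3 - ((1 - om) * d) ^ 3 ≠ 0 := by
  intro h
  rw [mul_pow, one_sub_om_cube] at h
  have := congrArg Complex.im h
  rw [← Complex.ofReal_pow, ← Complex.ofReal_pow] at this
  simp [-Complex.ofReal_pow, hd.ne'] at this

lemma hN_eq {d : ℝ} {w : ℂ} (h : w ^ 3 - ((1 - om) * d) ^ 3 ≠ 0) :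
    hN d w = 3 * ((1 - om) * d) ^ 2 / (w ^ 3 - ((1 - om) * d) ^ 3) := by
  unfold hN
  generalize (1 - om) * (d:ℂ) = g at h ⊢
  have hp : w ^ 3 - g ^ 3 = (w - g) * ((w - om * g) * (w - om ^ 2 * g)) := by
    linear_combination (w - g) * g * w * om_sq - (w - g) * g ^ 2 * om_cube
  have hne : w - g ≠ 0 ∧ w - om * g ≠ 0 ∧ w - om ^ 2 * g ≠ 0 := by
    rw [hp] at h
    exact ⟨left_ne_zero_of_mul h, left_ne_zero_of_mul (right_ne_zero_of_mul h),
      right_ne_zero_of_mul (right_ne_zero_of_mul h)⟩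
  obtain ⟨h1, h2, h3⟩ := hne
  rw [eq_div_iff h, hp]
  have : ((w - g)⁻¹ + (om * (w - om * g)⁻¹ + om ^ 2 * (w - om ^ 2 * g)⁻¹)) * ((w - g) * ((w - om * g) * (w - om ^ 2 * g)))
      = (w - om * g) * (w - om ^ 2 * g) + om * ((w - g) * (w - om ^ 2 * g)) + om ^ 2 * ((w - g) * (w - om * g)) := by
    generalize w - g = a at *
    generalize w - om * g = b at *
    generalize w - om ^ 2 * g = c at *
    field_simp
    ring
  rw [this]
  linear_combination (w ^ 2 - 2 * g * w) * om_sq + (3 * g ^ 2 - 2 * g * w) * om_cube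

lemma norm_sub_cube (d u : ℝ) : ‖(u:ℂ) ^ 3 - ((1 - om) * d) ^ 3‖ ^ 2 = u ^ 6 + 27 * d ^ 6 := by
  rw [← Complex.normSq_eq_norm_sq, mul_pow, one_sub_om_cube, ← Complex.ofReal_pow, ← Complex.ofReal_pow, Complex.normSq_apply]
  simp [-Complex.ofReal_pow]
  linear_combination (9 * d ^ 6) * sqrt3_sq

lemma norm_one_sub_om_sq : ‖(1 - om)‖ ^ 2 = 3 := by
  rw [← Complex.normSq_eq_norm_sq, Complex.normSq_apply]
  simp [om_re, om_im]
  nlinarith [sqrt3_sq]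

lemma hN_real {d : ℝ} (u : ℝ) (hd : 0 < d) : ‖hN d u‖ ≤ 18 * (d / (u ^ 2 + d ^ 2)) := by
  rw [hN_eq (sub_cube_ne hd), norm_div, norm_mul, norm_pow, norm_mul, mul_pow, norm_one_sub_om_sq]
  have h1 := norm_sub_cube d u
  set N := ‖(u:ℂ) ^ 3 - ((1 - om) * d) ^ 3‖
  have hN : 0 < N := norm_pos_iff.2 (sub_cube_ne hd)
  have h2 : d * (u ^ 2 + d ^ 2) ≤ 2 * N := by
    apply abs_le_of_sq_le_sq' _ (by positivity) |>.2
    rw [mul_pow, mul_pow, h1]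
    have a : (u^2 + d^2)^3 ≤ 4 * (u ^ 6 + d ^ 6) := by
      nlinarith [mul_nonneg (add_nonneg (sq_nonneg u) (sq_nonneg d)) (sq_nonneg (u^2-d^2))]
    have b : d ^ 2 * (u ^ 2 + d ^ 2) ^ 2 ≤ (u^2 + d^2)^3 := by
      nlinarith [mul_nonneg (sq_nonneg u) (sq_nonneg (u^2+d^2))]
    have : 0 ≤ d ^ 6 := by positivity
    linarith
  simp only [Complex.norm_real, Complex.norm_ofNat, Real.norm_eq_abs, sq_abs]
  rw [← mul_div_assoc, div_le_div_iff₀ hN (by positivity)]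
  nlinarith

lemma kap_ge1 {d x y : ℝ} (hd : 0 < d) : 1 / (|x - d| + |y - d|) ≤ kap d x y := by
  unfold kap
  have : 0 ≤ d / ((x - y) ^ 2 + d ^ 2) := by positivity
  linarith

lemma kap_ge2 {d x y : ℝ} : d / ((y - x) ^ 2 + d ^ 2) ≤ kap d x y := by
  unfold kap
  have : 0 ≤ 1 / (|x - d| + |y - d|) := by positivity
  rw [show (y - x)^2 = (x-y)^2 by ring]
  linarith

section
variable {d x y : ℝ}
lemma p1 : (y:ℂ) - om * x - (1 - om) * d = ((y - d : ℝ):ℂ) - om * ((x - d : ℝ):ℂ) := by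
  push_cast; ring
lemma p2 : (y:ℂ) - om * x - om * ((1 - om) * d) = ((y - d : ℝ):ℂ) - om * ((x + 2 * d : ℝ):ℂ) := by
  push_cast; linear_combination d * om_sq
lemma p3 : (y:ℂ) - om * x - om ^ 2 * ((1 - om) * d) = ((y + 2 * d : ℝ):ℂ) - om * ((x - d : ℝ):ℂ) := by
  push_cast; linear_combination d * om_cube - d * om_sq
lemma p4 : (y:ℂ) - om ^ 2 * x - (1 - om) * d = ((y - 2 * d : ℝ):ℂ) - om ^ 2 * ((x + d : ℝ):ℂ) := by
  push_cast; linear_combination d * om_sq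
lemma p5 : (y:ℂ) - om ^ 2 * x - om * ((1 - om) * d) = ((y + d : ℝ):ℂ) - om ^ 2 * ((x - 2 * d : ℝ):ℂ) := by
  push_cast; linear_combination - d * om_sq
lemma p6 : (y:ℂ) - om ^ 2 * x - om ^ 2 * ((1 - om) * d) = ((y + d : ℝ):ℂ) - om ^ 2 * ((x + d : ℝ):ℂ) := by
  push_cast; linear_combination d * om_cube
lemma p7 : (y:ℂ) - om * x + (1 - om) * d = ((y + d : ℝ):ℂ) - om * ((x + d : ℝ):ℂ) := by
  push_cast; ring

lemma sum_pos' (h : x ≠ d) : 0 < |x - d| + |y - d| := by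
  have := abs_pos.2 (sub_ne_zero.2 h)
  positivity

lemma b1 (h : x ≠ d) : ‖((y:ℂ) - om * x - (1 - om) * d)⁻¹‖ ≤ 2 * (1 / (|x - d| + |y - d|)) := by
  apply inv_bd (sum_pos' h) (by norm_num)
  rw [p1]; exact om_norm _ _
lemma b2 (hd : 0 < d) (hx : 0 ≤ x) (h : x ≠ d) : ‖((y:ℂ) - om * x - om * ((1 - om) * d))⁻¹‖ ≤ 2 * (1 / (|x - d| + |y - d|)) := by
  apply inv_bd (sum_pos' h) (by norm_num)
  rw [p2]; refine le_trans ?_ (om_norm _ _)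
  have : |x - d| ≤ |x + 2 * d| := by rw [abs_of_nonneg (a := x + 2 * d) (by linarith)]; exact abs_le.2 ⟨by linarith, by linarith⟩
  linarith
lemma b3 (hd : 0 < d) (hy : 0 ≤ y) (h : x ≠ d) : ‖((y:ℂ) - om * x - om ^ 2 * ((1 - om) * d))⁻¹‖ ≤ 2 * (1 / (|x - d| + |y - d|)) := by
  apply inv_bd (sum_pos' h) (by norm_num)
  rw [p3]; refine le_trans ?_ (om_norm _ _)
  have : |y - d| ≤ |y + 2 * d| := by rw [abs_of_nonneg (a := y + 2 * d) (by linarith)]; exact abs_le.2 ⟨by linarith, by linarith⟩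
  linarith
lemma b4 (hd : 0 < d) (hx : 0 ≤ x) (h : x ≠ d) : ‖((y:ℂ) - om ^ 2 * x - (1 - om) * d)⁻¹‖ ≤ 4 * (1 / (|x - d| + |y - d|)) := by
  apply inv_bd (sum_pos' h) (by norm_num)
  rw [p4]; refine le_trans ?_ (om2_norm _ _)
  have h1 : |x + d| = x + d := abs_of_nonneg (by linarith)
  have h2 : |x - d| ≤ x + d := abs_le.2 ⟨by linarith, by linarith⟩
  have h3 : |y - d| ≤ |y - 2 * d| + d := by
    have := abs_add_le (y - 2 * d) d
    rw [abs_of_pos hd] at this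
    have e : ∀ z : ℝ, z - 2 * d + d = z - d := by intro z; ring
    rwa [e] at this
  have := abs_nonneg (y - 2 * d)
  linarith
lemma b5 (hd : 0 < d) (hy : 0 ≤ y) (h : x ≠ d) : ‖((y:ℂ) - om ^ 2 * x - om * ((1 - om) * d))⁻¹‖ ≤ 4 * (1 / (|x - d| + |y - d|)) := by
  apply inv_bd (sum_pos' h) (by norm_num)
  rw [p5]; refine le_trans ?_ (om2_norm _ _)
  have h1 : |y + d| = y + d := abs_of_nonneg (by linarith)
  have h2 : |y - d| ≤ y + d := abs_le.2 ⟨by linarith, by linarith⟩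
  have h3 : |x - d| ≤ |x - 2 * d| + d := by
    have := abs_add_le (x - 2 * d) d
    rw [abs_of_pos hd] at this
    have e : ∀ z : ℝ, z - 2 * d + d = z - d := by intro z; ring
    rwa [e] at this
  have := abs_nonneg (x - 2 * d)
  linarith
lemma b6 (hd : 0 < d) (hx : 0 ≤ x) (hy : 0 ≤ y) (h : x ≠ d) : ‖((y:ℂ) - om ^ 2 * x - om ^ 2 * ((1 - om) * d))⁻¹‖ ≤ 4 * (1 / (|x - d| + |y - d|)) := by
  apply inv_bd (sum_pos' h) (by norm_num)
  rw [p6]; refine le_trans ?_ (om2_norm _ _)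
  have h1 : |y + d| = y + d := abs_of_nonneg (by linarith)
  have h2 : |y - d| ≤ y + d := abs_le.2 ⟨by linarith, by linarith⟩
  have h3 : |x + d| = x + d := abs_of_nonneg (by linarith)
  have h4 : |x - d| ≤ x + d := abs_le.2 ⟨by linarith, by linarith⟩
  linarith
lemma b7 (hd : 0 < d) (hx : 0 ≤ x) (hy : 0 ≤ y) (h : x ≠ d) : ‖((y:ℂ) - om * x + (1 - om) * d)⁻¹‖ ≤ 2 * (1 / (|x - d| + |y - d|)) := by
  apply inv_bd (sum_pos' h) (by norm_num)
  rw [p7]; refine le_trans ?_ (om_norm _ _)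
  have h1 : |y + d| = y + d := abs_of_nonneg (by linarith)
  have h2 : |y - d| ≤ y + d := abs_le.2 ⟨by linarith, by linarith⟩
  have h3 : |x + d| = x + d := abs_of_nonneg (by linarith)
  have h4 : |x - d| ≤ x + d := abs_le.2 ⟨by linarith, by linarith⟩
  linarith

lemma pos_ne {z : ℂ} {X Y : ℝ} (h : (|X| + |Y|) / 2 ≤ ‖z‖) (hXY : X ≠ 0 ∨ Y ≠ 0) : z ≠ 0 := by
  intro h0
  rw [h0, norm_zero] at h
  have := abs_nonneg X
  have := abs_nonneg Y
  rcases hXY with h1 | h1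
  · have := abs_pos.2 h1; linarith
  · have := abs_pos.2 h1; linarith

lemma n2 (hd : 0 < d) (hx : 0 ≤ x) : (y:ℂ) - om * x - om * ((1 - om) * d) ≠ 0 := by
  rw [p2]; exact pos_ne (om_norm _ _) (Or.inl (by positivity))
lemma n3 (hd : 0 < d) (hy : 0 ≤ y) : (y:ℂ) - om * x - om ^ 2 * ((1 - om) * d) ≠ 0 := by
  rw [p3]; exact pos_ne (om_norm _ _) (Or.inr (by positivity))
lemma n4 (hd : 0 < d) (hx : 0 ≤ x) : (y:ℂ) - om ^ 2 * x - (1 - om) * d ≠ 0 := by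
  rw [p4]; exact pos_ne (om2_norm _ _) (Or.inl (by positivity))
lemma n5 (hd : 0 < d) (hy : 0 ≤ y) : (y:ℂ) - om ^ 2 * x - om * ((1 - om) * d) ≠ 0 := by
  rw [p5]; exact pos_ne (om2_norm _ _) (Or.inr (by positivity))
lemma n6 (hd : 0 < d) (hx : 0 ≤ x) : (y:ℂ) - om ^ 2 * x - om ^ 2 * ((1 - om) * d) ≠ 0 := by
  rw [p6]; exact pos_ne (om2_norm _ _) (Or.inl (by positivity))
lemma n7 (hd : 0 < d) (hx : 0 ≤ x) : (y:ℂ) - om * x + (1 - om) * d ≠ 0 := by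
  rw [p7]; exact pos_ne (om_norm _ _) (Or.inl (by positivity))

lemma om2_norm_one : ‖om ^ 2‖ = 1 := by rw [norm_pow, om_norm_one, one_pow]

lemma tri3 (a b c : ℂ) (s r : ℝ) (ha : ‖a‖ ≤ r * s) (hb : ‖b‖ ≤ r * s) (hc : ‖c‖ ≤ r * s) :
    ‖a + (om * b + om ^ 2 * c)‖ ≤ 3 * r * s := by
  refine (norm_add_le _ _).trans ?_
  have := norm_add_le (om * b) (om ^ 2 * c)
  rw [norm_mul, norm_mul, om2_norm_one, om_norm_one] at this
  linarith

lemma hN_om (hd : 0 < d) (hx : 0 ≤ x) (hy : 0 ≤ y) (h : x ≠ d) :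
    ‖hN d (y - om * x)‖ ≤ 18 * kap d x y := by
  refine (tri3 _ _ _ _ _ (b1 h) (b2 hd hx h) (b3 hd hy h)).trans ?_
  have := kap_ge1 (x := x) (y := y) hd
  have := kap_nonneg d x y hd
  linarith
lemma hN_om2 (hd : 0 < d) (hx : 0 ≤ x) (hy : 0 ≤ y) (h : x ≠ d) :
    ‖hN d (y - om ^ 2 * x)‖ ≤ 18 * kap d x y := by
  refine (tri3 _ _ _ _ _ (b4 hd hx h) (b5 hd hy h) (b6 hd hx hy h)).trans ?_
  have := kap_ge1 (x := x) (y := y) hd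
  have := kap_nonneg d x y hd
  linarith
lemma hN_one (hd : 0 < d) : ‖hN d (y - 1 * x)‖ ≤ 18 * kap d x y := by
  rw [one_mul, ← Complex.ofReal_sub]
  refine (hN_real _ hd).trans ?_
  have := kap_ge2 (x := x) (y := y) (d := d)
  linarith

lemma hD_eq {w : ℂ} (h : w ^ 2 + 3 * om * d ^ 2 ≠ 0) :
    hD d w = 2 * ((1 - om) * d) / (w ^ 2 + 3 * om * d ^ 2) := by
  have hp : w ^ 2 + 3 * om * d ^ 2 = (w - (1 - om) * d) * (w + (1 - om) * d) := by
    linear_combination d ^ 2 * om_sq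
  unfold hD
  rw [hp] at h ⊢
  have h1 := left_ne_zero_of_mul h
  have h2 := right_ne_zero_of_mul h
  field_simp
  ring

lemma norm_D (d u : ℝ) : ‖(u:ℂ) ^ 2 + 3 * om * d ^ 2‖ ^ 2 = u ^ 4 - 3 * u ^ 2 * d ^ 2 + 9 * d ^ 4 := by
  rw [← Complex.normSq_eq_norm_sq, ← Complex.ofReal_pow, ← Complex.ofReal_pow, Complex.normSq_apply]
  simp [-Complex.ofReal_pow, om_re, om_im]
  linear_combination (9 / 4 * d ^ 4) * sqrt3_sq

lemma D_ge (d u : ℝ) : (u ^ 2 + d ^ 2) ^ 2 ≤ 10 * (u ^ 4 - 3 * u ^ 2 * d ^ 2 + 9 * d ^ 4) := by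
  nlinarith [sq_nonneg (3 * u ^ 2 - 16 / 3 * d ^ 2), sq_nonneg (d ^ 2)]

lemma D_ne (hd : 0 < d) (u : ℝ) : (u:ℂ) ^ 2 + 3 * om * d ^ 2 ≠ 0 := by
  intro h
  have h1 := norm_D d u
  rw [h] at h1
  have h2 := D_ge d u
  have : 0 < (u ^ 2 + d ^ 2) ^ 2 := by positivity
  simp at h1
  linarith

lemma hD_real (hd : 0 < d) (u : ℝ) : ‖hD d u‖ ≤ 14 * (d / (u ^ 2 + d ^ 2)) := by
  rw [hD_eq (D_ne hd u), norm_div, norm_mul, norm_mul]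
  have h1 := norm_D d u
  have h2 := D_ge d u
  rw [← h1] at h2
  have h3 : ‖1 - om‖ ≤ 2 := by
    have := norm_sub_le (1:ℂ) om
    rw [om_norm_one, norm_one] at this; linarith
  set N := ‖(u:ℂ) ^ 2 + 3 * om * d ^ 2‖
  have hN : 0 < N := norm_pos_iff.2 (D_ne hd u)
  have h4 : (u ^ 2 + d ^ 2) ≤ 3.5 * N := by
    apply abs_le_of_sq_le_sq' _ (by positivity) |>.2
    nlinarith
  simp only [Complex.norm_real, Complex.norm_ofNat, Real.norm_eq_abs, abs_of_pos hd]
  rw [← mul_div_assoc, div_le_div_iff₀ hN (by positivity)]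
  have h5 : 2 * (‖1 - om‖ * d) ≤ 4 * d := by nlinarith
  have h6 : 0 ≤ u ^ 2 + d ^ 2 := by positivity
  calc _ ≤ 4 * d * (u ^ 2 + d ^ 2) := by gcongr
    _ ≤ 4 * d * (3.5 * N) := by gcongr
    _ = _ := by ring

lemma hD_om (hd : 0 < d) (hx : 0 ≤ x) (hy : 0 ≤ y) (h : x ≠ d) :
    ‖hD d (y - om * x)‖ ≤ 18 * kap d x y := by
  have h1 := b1 (y := y) h
  have h2 := b7 hd hx hy h
  unfold hD
  refine (norm_sub_le _ _).trans ?_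
  have := kap_ge1 (x := x) (y := y) hd
  have := kap_nonneg d x y hd
  linarith
lemma hD_one (hd : 0 < d) : ‖hD d (y - 1 * x)‖ ≤ 18 * kap d x y := by
  rw [one_mul, ← Complex.ofReal_sub]
  refine (hD_real hd _).trans ?_
  have := kap_ge2 (x := x) (y := y) (d := d)
  have := kap_nonneg d x y hd
  linarith

lemma hD_imag (hd : 0 < d) (x : ℝ) :
    (Complex.I * om ^ 2 * (hD d (-1 * x) - hD d (-om * x))).re = 0 := by
  have n1 := D_ne hd x
  have e1 : ((-1 * x : ℂ)) ^ 2 + 3 * om * d ^ 2 = (x:ℂ) ^ 2 + 3 * om * d ^ 2 := by ring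
  have e2 : ((-om * x : ℂ)) ^ 2 + 3 * om * d ^ 2 = om ^ 2 * ((x:ℂ) ^ 2 + 3 * om ^ 2 * d ^ 2) := by
    linear_combination (-3 * om * d ^ 2) * om_cube
  have hprod : ((x:ℂ) ^ 2 + 3 * om * d ^ 2) * ((x:ℂ) ^ 2 + 3 * om ^ 2 * d ^ 2)
      = ((x ^ 4 - 3 * x ^ 2 * d ^ 2 + 9 * d ^ 4 : ℝ) : ℂ) := by
    push_cast
    linear_combination 3 * x ^ 2 * d ^ 2 * om_sq + 9 * d ^ 4 * om_cube
  have hpos : 0 < x ^ 4 - 3 * x ^ 2 * d ^ 2 + 9 * d ^ 4 := by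
    have := D_ge d x
    have : 0 < (x ^ 2 + d ^ 2) ^ 2 := by positivity
    linarith
  have n0 : ((x:ℂ) ^ 2 + 3 * om * d ^ 2) * ((x:ℂ) ^ 2 + 3 * om ^ 2 * d ^ 2) ≠ 0 := by
    rw [hprod]; exact_mod_cast hpos.ne'
  have n2 : (x:ℂ) ^ 2 + 3 * om ^ 2 * d ^ 2 ≠ 0 := right_ne_zero_of_mul n0
  have om0 : om ≠ 0 := by intro h; have := om_cube; rw [h] at this; norm_num at this
  rw [hD_eq (by rw [e1]; exact n1), hD_eq (by rw [e2]; exact mul_ne_zero (pow_ne_zero _ om0) n2), e1, e2]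
  have key : (Complex.I * om ^ 2 * (2 * ((1 - om) * d) / ((x:ℂ) ^ 2 + 3 * om * d ^ 2)
      - 2 * ((1 - om) * d) / (om ^ 2 * ((x:ℂ) ^ 2 + 3 * om ^ 2 * d ^ 2)))) *
      ((x ^ 4 - 3 * x ^ 2 * d ^ 2 + 9 * d ^ 4 : ℝ) : ℂ) = ((-6 * d * x ^ 2 : ℝ) : ℂ) * Complex.I := by
    rw [← hprod]
    have : ∀ A X Y : ℂ, X ≠ 0 → Y ≠ 0 →
        Complex.I * om ^ 2 * (A / X - A / (om ^ 2 * Y)) * (X * Y) = Complex.I * (om ^ 2 * A * Y - A * X) := by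
      intro A X Y hX hY
      field_simp
    rw [this _ _ _ n1 n2]
    push_cast
    linear_combination 2 * Complex.I * d * x ^ 2 * (om_sq - om_cube) + 6 * Complex.I * d ^ 3 * (1 - om) * om * om_cube
  have := congrArg Complex.re key
  rw [Complex.re_mul_ofReal] at this
  rw [Complex.re_ofReal_mul, Complex.I_re, mul_zero, mul_eq_zero] at this
  exact this.resolve_right hpos.ne'
end


lemma ia {α : Type*} [MeasurableSpace α] {μ : Measure α} {F G : α → ℂ} (h : Integrable F μ) (h2 : Integrable G μ) :
    Integrable (fun a => F a + G a) μ := h.add h2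
lemma ib {α : Type*} [MeasurableSpace α] {μ : Measure α} {F G : α → ℂ} (h : Integrable F μ) (h2 : Integrable G μ) :
    Integrable (fun a => F a - G a) μ := h.sub h2

section
variable {L d : ℝ} {f f1 q q1 ρ : ℝ → ℝ}

lemma gg_c0y (H : FD L f f1 q q1 ρ) (hL : 0 ≤ L) (ζ : ℂ) : ContinuousOn (fun y => GG f f1 q ζ 0 y) (Icc 0 L) :=
  (gg_cont H ζ).1.comp (f := fun y => ((0:ℝ), y)) (by fun_prop) (fun _ hy => ⟨⟨le_rfl, hL⟩, hy⟩)
lemma gg_cx0 (H : FD L f f1 q q1 ρ) (hL : 0 ≤ L) (ζ : ℂ) : ContinuousOn (fun x => GG f f1 q ζ x 0) (Icc 0 L) :=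
  (gg_cont H ζ).1.comp (f := fun x => (x, (0:ℝ))) (by fun_prop) (fun _ hy => ⟨hy, ⟨le_rfl, hL⟩⟩)

lemma bdF_add (H : FD L f f1 q q1 ρ) (hL : 0 ≤ L) (ζ : ℂ) (h1 h2 : ℂ → ℂ)
    (a1 : ContinuousOn (fun y : ℝ => h1 y) (Icc 0 L)) (a2 : ContinuousOn (fun y : ℝ => h2 y) (Icc 0 L))
    (b1 : ContinuousOn (fun x : ℝ => h1 (-ζ * x)) (Icc 0 L)) (b2 : ContinuousOn (fun x : ℝ => h2 (-ζ * x)) (Icc 0 L)) :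
    bdF L f f1 q ζ (fun w => h1 w + h2 w) = bdF L f f1 q ζ h1 + bdF L f f1 q ζ h2 := by
  unfold bdF
  simp only [add_mul]
  rw [integral_add, integral_add]
  · ring
  · exact (b1.mul (gg_cx0 H hL ζ)).integrableOn_compact isCompact_Icc
  · exact (b2.mul (gg_cx0 H hL ζ)).integrableOn_compact isCompact_Icc
  · exact (a1.mul (gg_c0y H hL ζ)).integrableOn_compact isCompact_Icc
  · exact (a2.mul (gg_c0y H hL ζ)).integrableOn_compact isCompact_Icc

lemma pole_meas (d : ℝ) : Measurable (fun p : ℝ × ℝ => ((p.2:ℂ) - om * p.1 - (1 - om) * d)⁻¹) := by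
  fun_prop

lemma an_cont {r : ℂ → ℂ} {ζ : ℂ} (hr : ∀ x ∈ Icc 0 L, ∀ y ∈ Icc 0 L, AnalyticAt ℂ r (y - ζ * x)) :
    ContinuousOn (fun p : ℝ × ℝ => r (p.2 - ζ * p.1)) (Icc 0 L ×ˢ Icc 0 L) := by
  intro p hp
  have a : ContinuousAt r (p.2 - ζ * p.1) := (hr p.1 hp.1 p.2 hp.2).continuousAt
  have b : ContinuousAt (fun p : ℝ × ℝ => (p.2:ℂ) - ζ * p.1) p := by fun_prop
  exact (ContinuousAt.comp (f := fun p : ℝ × ℝ => (p.2:ℂ) - ζ * p.1) a b).continuousWithinAt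

lemma green_full_f (H : FD L f f1 q q1 ρ) (hd : 0 < d) (hdL : d < L) (r : ℂ → ℂ)
    (hr : ∀ x ∈ Icc 0 L, ∀ y ∈ Icc 0 L, AnalyticAt ℂ r (y - om * x)) (h : ℂ → ℂ)
    (hh : h = fun w => (w - (1 - om) * d)⁻¹ + r w) :
    ∫ p, h (p.2 - om * p.1) * ((q1 p.1 * f p.2 + f p.1 * q1 p.2) - om * (ρ p.1 * f1 p.2) - om ^ 2 * (f1 p.1 * ρ p.2)) ∂((mu L).prod (mu L))
    = bdF L f f1 q om h + 2 * Real.pi * Complex.I * om * ((f d * q d + f1 d ^ 2 : ℝ) : ℂ) := by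
  have hL : 0 ≤ L := by linarith
  have e1 := green_reg_f H hL om om_cube r hr
  have e2 := green_pole_f H hd hdL _ rfl
  have cF : ContinuousOn (fun p : ℝ × ℝ => ((q1 p.1 * f p.2 + f p.1 * q1 p.2) - om * (ρ p.1 * f1 p.2) - om ^ 2 * (f1 p.1 * ρ p.2) : ℂ)) (Icc 0 L ×ˢ Icc 0 L) :=
    ((((c_fst H.cq1).mul (c_snd H.cf)).add ((c_fst H.cf).mul (c_snd H.cq1))).sub
      (continuousOn_const.mul ((c_fst H.cr).mul (c_snd H.cf1)))).sub
      (continuousOn_const.mul ((c_fst H.cf1).mul (c_snd H.cr)))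
  have i1 := ker_int (L := L) hd _ (pole_meas d).aestronglyMeasurable 2 (by
    filter_upwards [prod_ne L d] with p hp
    exact (b1 hp).trans (by gcongr; exact kap_ge1 hd)) _ cF
  have cr := an_cont hr
  have i2 := box_int (fun p : ℝ × ℝ => r (p.2 - om * p.1) * ((q1 p.1 * f p.2 + f p.1 * q1 p.2) - om * (ρ p.1 * f1 p.2) - om ^ 2 * (f1 p.1 * ρ p.2))) (cr.mul cF)
  have e3 : bdF L f f1 q om h = bdF L f f1 q om (fun w => (w - (1 - om) * d)⁻¹) + bdF L f f1 q om r := by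
    rw [hh]
    apply bdF_add H hL
    · apply ContinuousOn.inv₀ (by fun_prop)
      intro y hy
      have := om_ne (x := 0) (y := y) (d := d) (Or.inl hd.ne)
      simpa using this
    · have := cr.comp (f := fun y => ((0:ℝ), y)) (s := Icc 0 L) (by fun_prop) (fun _ hy => ⟨⟨le_rfl, hL⟩, hy⟩)
      simpa [Function.comp_def] using this
    · apply ContinuousOn.inv₀ (by fun_prop)
      intro x hy
      have := om_ne (x := x) (y := 0) (d := d) (Or.inr hd.ne)
      simpa using this
    · have := cr.comp (f := fun y => (y, (0:ℝ))) (s := Icc 0 L) (by fun_prop) (fun _ hy => ⟨hy, ⟨le_rfl, hL⟩⟩)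
      simpa [Function.comp_def] using this
  rw [e3, add_right_comm, ← e2, ← e1, ← integral_add i1 i2]
  congr 1; ext p
  rw [hh]
  ring
end

lemma re_int {α : Type*} [MeasurableSpace α] {μ : Measure α} {F : α → ℂ} (h : Integrable F μ) :
    ∫ a, (F a).re ∂μ = (∫ a, F a ∂μ).re := Complex.reCLM.integral_comp_comm h

lemma hN_meas (d : ℝ) : Measurable (hN d) := by unfold hN; fun_prop
lemma hD_meas (d : ℝ) : Measurable (hD d) := by unfold hD; fun_prop

lemma hN_an {d : ℝ} {w : ℂ} (h1 : w - (1 - om) * d ≠ 0) (h2 : w - om * ((1 - om) * d) ≠ 0)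
    (h3 : w - om ^ 2 * ((1 - om) * d) ≠ 0) : AnalyticAt ℂ (hN d) w := by
  unfold hN
  exact ((analyticAt_id.sub analyticAt_const).inv h1).add ((analyticAt_const.mul ((analyticAt_id.sub analyticAt_const).inv h2)).add
    (analyticAt_const.mul ((analyticAt_id.sub analyticAt_const).inv h3)))

lemma hN_an' {d : ℝ} {w : ℂ} (h : w ^ 3 - ((1 - om) * d) ^ 3 ≠ 0) : AnalyticAt ℂ (hN d) w := by
  apply hN_an
  · intro h0; apply h; rw [sub_eq_zero.1 h0]; ring
  · intro h0; apply h; rw [sub_eq_zero.1 h0]; linear_combination ((1 - om) * d) ^ 3 * om_cube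
  · intro h0; apply h; rw [sub_eq_zero.1 h0]; linear_combination ((1 - om) * d) ^ 3 * (om ^ 3 + 1) * om_cube

lemma hN_cont {d : ℝ} (hd : 0 < d) : Continuous (fun u : ℝ => hN d u) := by
  rw [continuous_iff_continuousAt]
  intro u
  exact ContinuousAt.comp (f := fun u : ℝ => (u:ℂ)) (hN_an' (sub_cube_ne hd)).continuousAt Complex.continuous_ofReal.continuousAt

lemma hN_rot {d : ℝ} (hd : 0 < d) (x : ℝ) (ζ : ℂ) (hz : ζ ^ 3 = 1) : hN d (-ζ * x) = hN d ((-x : ℝ):ℂ) := by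
  have e : (-ζ * x) ^ 3 = ((-x : ℝ) : ℂ) ^ 3 := by push_cast; linear_combination (-x ^ 3) * hz
  have := sub_cube_ne (u := -x) hd
  rw [hN_eq this, hN_eq (by rw [e]; exact this), e]

lemma Pf_int {L d : ℝ} (hd : 0 < d) {f : ℝ → ℝ} (hf : ContinuousOn f (Icc 0 L)) :
    Integrable (fun y => d / (y ^ 2 + d ^ 2) * |f y|) (mu L) := by
  refine ContinuousOn.integrableOn_compact isCompact_Icc ?_
  refine ContinuousOn.mul (Continuous.continuousOn ?_) hf.abs
  exact continuous_const.div (by fun_prop) (fun y => by positivity)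

lemma bd_single {L d : ℝ} (hd : 0 < d) {f : ℝ → ℝ} (hf : ContinuousOn f (Icc 0 L)) (h : ℝ → ℂ)
    (hb : ∀ y, ‖h y‖ ≤ 18 * (d / (y ^ 2 + d ^ 2))) :
    ‖∫ y, h y * f y ∂(mu L)‖ ≤ 18 * ∫ y, d / (y ^ 2 + d ^ 2) * |f y| ∂(mu L) := by
  rw [← integral_const_mul]
  refine norm_integral_le_of_norm_le ((Pf_int hd hf).const_mul 18) ?_
  filter_upwards with y
  rw [norm_mul, Complex.norm_real, Real.norm_eq_abs, ← mul_assoc]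
  exact mul_le_mul_of_nonneg_right (hb y) (abs_nonneg _)

lemma bdF_N {L d : ℝ} {f f1 q q1 ρ : ℝ → ℝ} (H : FD L f f1 q q1 ρ) (hd : 0 < d) :
    ‖bdF L f f1 q 1 (hN d) + bdF L f f1 q om (hN d) + bdF L f f1 q (om ^ 2) (hN d)‖
      ≤ 108 * |q 0| * ∫ y, d / (y ^ 2 + d ^ 2) * |f y| ∂(mu L) := by
  have cc : ∀ {g : ℝ → ℝ}, ContinuousOn g (Icc 0 L) → ContinuousOn (fun x => (g x : ℂ)) (Icc 0 L) :=
    fun h => Complex.continuous_ofReal.comp_continuousOn h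
  have c1 : ContinuousOn (fun y : ℝ => hN d y) (Icc 0 L) := (hN_cont hd).continuousOn
  have c2 : ContinuousOn (fun y : ℝ => hN d ((-y : ℝ):ℂ)) (Icc 0 L) :=
    ((hN_cont hd).comp continuous_neg).continuousOn
  have I : ∀ (k : ℝ → ℂ) (g : ℝ → ℝ), ContinuousOn k (Icc 0 L) → ContinuousOn g (Icc 0 L) →
      Integrable (fun y => k y * g y) (mu L) := fun k g hk hg =>
    (hk.mul (cc hg)).integrableOn_compact isCompact_Icc
  have E : ∀ ζ : ℂ, ζ ^ 3 = 1 → bdF L f f1 q ζ (hN d) =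
     -(q 0 * (∫ y : ℝ, hN d y * f y ∂(mu L)) - ζ * (f1 0 * ∫ y : ℝ, hN d y * f1 y ∂(mu L)) + ζ ^ 2 * (f 0 * ∫ y : ℝ, hN d y * q y ∂(mu L)))
     - ζ * ((f 0 * ∫ y : ℝ, hN d ((-y : ℝ):ℂ) * q y ∂(mu L)) - ζ * (f1 0 * ∫ y : ℝ, hN d ((-y : ℝ):ℂ) * f1 y ∂(mu L)) + ζ ^ 2 * (q 0 * ∫ y : ℝ, hN d ((-y : ℝ):ℂ) * f y ∂(mu L))) := by
    intro ζ hz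
    unfold bdF
    congr 2
    · simp only [← integral_const_mul]
      rw [← integral_sub, ← integral_add]
      · congr 1; ext y; unfold GG; ring
      · exact ((I _ _ c1 H.cf).const_mul _).sub (((I _ _ c1 H.cf1).const_mul _).const_mul _)
      · exact ((I _ _ c1 H.cq).const_mul _).const_mul _
      · exact (I _ _ c1 H.cf).const_mul _
      · exact ((I _ _ c1 H.cf1).const_mul _).const_mul _
    · simp only [← integral_const_mul]
      rw [← integral_sub, ← integral_add]
      · congr 1; ext y; rw [hN_rot hd _ ζ hz]; unfold GG; ring
      · exact ((I _ _ c2 H.cq).const_mul _).sub (((I _ _ c2 H.cf1).const_mul _).const_mul _)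
      · exact ((I _ _ c2 H.cf).const_mul _).const_mul _
      · exact (I _ _ c2 H.cq).const_mul _
      · exact ((I _ _ c2 H.cf1).const_mul _).const_mul _
  rw [E 1 (by norm_num), E om om_cube, E (om ^ 2) (by linear_combination (om ^ 3 + 1) * om_cube)]
  have b1 := bd_single hd H.cf (fun y => hN d y) (fun y => hN_real y hd)
  have b2 := bd_single hd H.cf (fun y => hN d ((-y:ℝ):ℂ)) (fun y => by simpa using hN_real (-y) hd)
  set P := ∫ y, d / (y ^ 2 + d ^ 2) * |f y| ∂(mu L)
  generalize (∫ y : ℝ, hN d y * f y ∂(mu L)) = a at *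
  generalize (∫ y : ℝ, hN d y * f1 y ∂(mu L)) = b at *
  generalize (∫ y : ℝ, hN d y * q y ∂(mu L)) = c at *
  generalize (∫ y : ℝ, hN d ((-y:ℝ):ℂ) * f y ∂(mu L)) = a' at *
  generalize (∫ y : ℝ, hN d ((-y:ℝ):ℂ) * f1 y ∂(mu L)) = b' at *
  generalize (∫ y : ℝ, hN d ((-y:ℝ):ℂ) * q y ∂(mu L)) = c' at *
  have e4 : om ^ 4 = om := by linear_combination om * om_cube
  have e6 : om ^ 6 = 1 := by linear_combination (om ^ 3 + 1) * om_cube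
  have : ∀ u v : ℂ, u = -(3 * q 0 * a) - 3 * q 0 * a' → ‖u‖ ≤ 108 * |q 0| * P := by
    intro u _ hu
    rw [hu]
    refine (norm_sub_le _ _).trans ?_
    rw [norm_neg, norm_mul, norm_mul, norm_mul, norm_mul, Complex.norm_real, Real.norm_eq_abs]
    simp only [Complex.norm_ofNat]
    have h0 := abs_nonneg (q 0)
    nlinarith [mul_le_mul_of_nonneg_left b1 h0, mul_le_mul_of_nonneg_left b2 h0]
  apply this _ 0
  ring_nf
  simp only [e4, e6, om_cube, om_sq]
  ring

theorem gkN {L d : ℝ} (hd : 0 < d) (hdL : d < L) : GK L d 1 := by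
  have hL : 0 ≤ L := by linarith
  set K : ℂ → ℝ × ℝ → ℂ := fun ζ p => hN d (p.2 - ζ * p.1) with hKdef
  have mK : ∀ ζ, AEStronglyMeasurable (K ζ) ((mu L).prod (mu L)) := fun ζ =>
    ((hN_meas d).comp (by fun_prop : Measurable (fun p : ℝ × ℝ => (p.2:ℂ) - ζ * p.1))).aestronglyMeasurable
  have bK1 : ∀ᵐ p ∂((mu L).prod (mu L)), ‖K 1 p‖ ≤ 18 * kap d p.1 p.2 := by
    filter_upwards with p using hN_one hd
  have bK2 : ∀ᵐ p ∂((mu L).prod (mu L)), ‖K om p‖ ≤ 18 * kap d p.1 p.2 := by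
    filter_upwards [box_ae_mem L, prod_ne L d] with p h1 h2 using hN_om hd h1.1.1 h1.2.1 h2
  have bK3 : ∀ᵐ p ∂((mu L).prod (mu L)), ‖K (om ^ 2) p‖ ≤ 18 * kap d p.1 p.2 := by
    filter_upwards [box_ae_mem L, prod_ne L d] with p h1 h2 using hN_om2 hd h1.1.1 h1.2.1 h2
  have hc0 : ‖Complex.I * om ^ 2‖ = 1 := by rw [norm_mul, om2_norm_one, Complex.norm_I, one_mul]
  refine ⟨fun p => (Complex.I * om ^ 2 * (K 1 p + K om p + K (om ^ 2) p)).re, ?_, ?_, ?_⟩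
  · exact Complex.continuous_re.comp_aestronglyMeasurable (((mK 1).add (mK om)).add (mK (om^2)) |>.const_mul _)
  · filter_upwards [bK1, bK2, bK3] with p h1 h2 h3
    refine (Complex.abs_re_le_norm _).trans ?_
    rw [norm_mul, hc0, one_mul]
    have := norm_add_le (K 1 p + K om p) (K (om ^ 2) p)
    have := norm_add_le (K 1 p) (K om p)
    linarith
  · intro f f1 q q1 ρ H _
    have cS : ContinuousOn (fun p : ℝ × ℝ => (q1 p.1 * f p.2 + f p.1 * q1 p.2 : ℂ)) (Icc 0 L ×ˢ Icc 0 L) :=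
      (((c_fst H.cq1).mul (c_snd H.cf)).add ((c_fst H.cf).mul (c_snd H.cq1)))
    have i1 := ker_int hd _ (mK 1) 18 bK1 _ cS
    have i2 := ker_int hd _ (mK om) 18 bK2 _ cS
    have i3 := ker_int hd _ (mK (om ^ 2)) 18 bK3 _ cS
    have s1 := split_bd H hd 1 (by simp) (K 1) (mK 1) 18 (by norm_num) bK1
    have s2 := split_bd H hd om om_norm_one (K om) (mK om) 18 (by norm_num) bK2
    have s3 := split_bd H hd (om ^ 2) om2_norm_one (K (om ^ 2)) (mK (om ^ 2)) 18 (by norm_num) bK3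
    have g1 := green_reg_f H hL 1 (by norm_num) (hN d) (fun x _ y _ => by
      rw [one_mul, ← Complex.ofReal_sub]; exact hN_an' (sub_cube_ne hd))
    have g3 := green_reg_f H hL (om ^ 2) (by linear_combination (om ^ 3 + 1) * om_cube) (hN d) (fun x hx y hy =>
      hN_an (n4 hd hx.1) (n5 hd hy.1) (n6 hd hx.1))
    have g2 := green_full_f H hd hdL (fun w => om * (w - om * ((1 - om) * d))⁻¹ + om ^ 2 * (w - om ^ 2 * ((1 - om) * d))⁻¹)
      (fun x hx y hy => ((analyticAt_const.mul ((analyticAt_id.sub analyticAt_const).inv (n2 hd hx.1))).add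
        (analyticAt_const.mul ((analyticAt_id.sub analyticAt_const).inv (n3 hd hy.1))))) (hN d) rfl
    have bd := bdF_N H hd
    simp only [hKdef] at s1 s2 s3
    rw [g1] at s1
    rw [g2] at s2
    rw [g3] at s3
    set R := ∫ x, ρ x ^ 2 ∂(mu L) + ∫ x, f1 x ^ 2 ∂(mu L)
    set PP := ∫ y, d / (y ^ 2 + d ^ 2) * |f y| ∂(mu L)
    have e : (∫ p, (Complex.I * om ^ 2 * (K 1 p + K om p + K (om ^ 2) p)).re * (q1 p.1 * f p.2 + f p.1 * q1 p.2) ∂((mu L).prod (mu L)))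
      = (Complex.I * om ^ 2 * ((∫ p, K 1 p * (q1 p.1 * f p.2 + f p.1 * q1 p.2) ∂((mu L).prod (mu L)))
        + (∫ p, K om p * (q1 p.1 * f p.2 + f p.1 * q1 p.2) ∂((mu L).prod (mu L)))
        + (∫ p, K (om ^ 2) p * (q1 p.1 * f p.2 + f p.1 * q1 p.2) ∂((mu L).prod (mu L))))).re := by
      rw [← integral_add i1 i2, ← integral_add (ia i1 i2) i3, ← integral_const_mul]
      have := re_int ((ia (ia i1 i2) i3).const_mul (Complex.I * om ^ 2))
      refine Eq.trans ?_ this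
      congr 1; ext p
      rw [← Complex.re_mul_ofReal]
      congr 1
      push_cast
      ring
    simp only [hKdef] at e
    rw [e]
    set J1 := ∫ p, hN d (p.2 - 1 * p.1) * (q1 p.1 * f p.2 + f p.1 * q1 p.2) ∂((mu L).prod (mu L))
    set J2 := ∫ p, hN d (p.2 - om * p.1) * (q1 p.1 * f p.2 + f p.1 * q1 p.2) ∂((mu L).prod (mu L))
    set J3 := ∫ p, hN d (p.2 - om ^ 2 * p.1) * (q1 p.1 * f p.2 + f p.1 * q1 p.2) ∂((mu L).prod (mu L))
    set m := f d * q d + f1 d ^ 2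
    set B1 := bdF L f f1 q 1 (hN d)
    set B2 := bdF L f f1 q om (hN d)
    set B3 := bdF L f f1 q (om ^ 2) (hN d)
    have key : Complex.I * om ^ 2 * (J1 + J2 + J3) + ((2 * Real.pi * m : ℝ):ℂ)
      = Complex.I * om ^ 2 * ((J1 - B1) + (J2 - (B2 + 2 * Real.pi * Complex.I * om * m)) + (J3 - B3) + (B1 + B2 + B3)) := by
      push_cast
      linear_combination (2 * Real.pi * m * Complex.I ^ 2) * om_cube + (2 * Real.pi * m) * Complex.I_sq
    have : ‖Complex.I * om ^ 2 * (J1 + J2 + J3) + ((2 * Real.pi * m : ℝ):ℂ)‖ ≤ 1296 * R + 108 * |q 0| * PP := by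
      rw [key, norm_mul, hc0, one_mul]
      refine (norm_add_le _ _).trans ?_
      have := norm_add_le ((J1 - B1) + (J2 - (B2 + 2 * Real.pi * Complex.I * om * m))) (J3 - B3)
      have := norm_add_le ((J1 - B1)) (J2 - (B2 + 2 * Real.pi * Complex.I * om * m))
      linarith
    have h5 := (Complex.abs_re_le_norm _).trans this
    rw [Complex.add_re, Complex.ofReal_re] at h5
    linarith

lemma hD_an {d : ℝ} {w : ℂ} (h1 : w - (1 - om) * d ≠ 0) (h2 : w + (1 - om) * d ≠ 0) : AnalyticAt ℂ (hD d) w := by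
  unfold hD
  exact ((analyticAt_id.sub analyticAt_const).inv h1).sub ((analyticAt_id.add analyticAt_const).inv h2)

lemma D_ne1 {d : ℝ} (hd : 0 < d) (u : ℝ) : (u:ℂ) - (1 - om) * d ≠ 0 := by
  intro h0; apply D_ne hd u; linear_combination (u + (1 - om) * d) * h0 + d ^ 2 * om_sq
lemma D_ne2 {d : ℝ} (hd : 0 < d) (u : ℝ) : (u:ℂ) + (1 - om) * d ≠ 0 := by
  intro h0; apply D_ne hd u; linear_combination (u - (1 - om) * d) * h0 + d ^ 2 * om_sq

lemma bdF_D {L d : ℝ} {f f1 q q1 ρ : ℝ → ℝ} (H : FD L f f1 q q1 ρ) (hd : 0 < d) (h0 : f 0 = 0) (h10 : f1 0 = 0) :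
    (Complex.I * om ^ 2 * (bdF L f f1 q om (hD d) - bdF L f f1 q 1 (hD d))).re = 0 := by
  have cf : ContinuousOn (fun x => (f x : ℂ)) (Icc 0 L) := Complex.continuous_ofReal.comp_continuousOn H.cf
  have c1 : ContinuousOn (fun y : ℝ => hD d (-1 * y)) (Icc 0 L) := by
    intro y hy
    have a : ContinuousAt (hD d) (-1 * y) := (hD_an (by simpa using D_ne1 hd (-y)) (by simpa using D_ne2 hd (-y))).continuousAt
    exact (ContinuousAt.comp (f := fun p : ℝ => -1 * (p:ℂ)) a (by fun_prop)).continuousWithinAt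
  have c2 : ContinuousOn (fun y : ℝ => hD d (-om * y)) (Icc 0 L) := by
    intro y hy
    have a : ContinuousAt (hD d) (-om * y) := (hD_an
      (by have := om_ne (x := y) (y := 0) (d := d) (Or.inr hd.ne); simpa using this)
      (by have := n7 (x := y) (y := 0) hd hy.1; simpa using this)).continuousAt
    exact (ContinuousAt.comp (f := fun p : ℝ => -om * (p:ℂ)) a (by fun_prop)).continuousWithinAt
  have i1 : Integrable (fun y : ℝ => hD d (-1 * y) * f y) (mu L) := (c1.mul cf).integrableOn_compact isCompact_Icc
  have i2 : Integrable (fun y : ℝ => hD d (-om * y) * f y) (mu L) := (c2.mul cf).integrableOn_compact isCompact_Icc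
  have e : Complex.I * om ^ 2 * (bdF L f f1 q om (hD d) - bdF L f f1 q 1 (hD d))
      = ∫ y : ℝ, Complex.I * om ^ 2 * (hD d (-1 * y) * f y - hD d (-om * y) * f y) * q 0 ∂(mu L) := by
    rw [integral_mul_const, integral_const_mul, integral_sub i1 i2]
    have a1 : ∀ ζ y, GG f f1 q ζ 0 y = q 0 * f y := by intro ζ y; simp [GG, h0, h10]
    have a2 : ∀ ζ x, GG f f1 q ζ x 0 = ζ ^ 2 * q 0 * f x := by intro ζ y; simp [GG, h0, h10]; ring
    have a3 : ∀ ζ : ℂ, ∫ x : ℝ, hD d (-ζ * x) * (ζ ^ 2 * q 0 * f x) ∂(mu L) = ζ ^ 2 * q 0 * ∫ x : ℝ, hD d (-ζ * x) * f x ∂(mu L) := by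
      intro ζ
      rw [← integral_const_mul]; congr 1; ext x; ring
    unfold bdF
    simp only [a1, a2, a3]
    linear_combination (-Complex.I * om ^ 2 * q 0 * ∫ x : ℝ, hD d (-om * x) * f x ∂(mu L)) * om_cube
  rw [e, ← re_int (((ib i1 i2).const_mul _).mul_const _)]
  have : ∀ y : ℝ, (Complex.I * om ^ 2 * (hD d (-1 * y) * f y - hD d (-om * y) * f y) * q 0).re = 0 := by
    intro y
    have e1 : Complex.I * om ^ 2 * (hD d (-1 * y) * f y - hD d (-om * y) * f y) * q 0
      = Complex.I * om ^ 2 * (hD d (-1 * y) - hD d (-om * y)) * ((f y * q 0 : ℝ):ℂ) := by push_cast; ring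
    rw [e1, Complex.re_mul_ofReal, hD_imag hd, zero_mul]
  simp only [this, integral_zero]

theorem gkD {L d : ℝ} (hd : 0 < d) (hdL : d < L) : GK L d 0 := by
  have hL : 0 ≤ L := by linarith
  set K : ℂ → ℝ × ℝ → ℂ := fun ζ p => hD d (p.2 - ζ * p.1) with hKdef
  have mK : ∀ ζ, AEStronglyMeasurable (K ζ) ((mu L).prod (mu L)) := fun ζ =>
    ((hD_meas d).comp (by fun_prop : Measurable (fun p : ℝ × ℝ => (p.2:ℂ) - ζ * p.1))).aestronglyMeasurable
  have bK1 : ∀ᵐ p ∂((mu L).prod (mu L)), ‖K 1 p‖ ≤ 18 * kap d p.1 p.2 := by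
    filter_upwards with p using hD_one hd
  have bK2 : ∀ᵐ p ∂((mu L).prod (mu L)), ‖K om p‖ ≤ 18 * kap d p.1 p.2 := by
    filter_upwards [box_ae_mem L, prod_ne L d] with p h1 h2 using hD_om hd h1.1.1 h1.2.1 h2
  have hc0 : ‖Complex.I * om ^ 2‖ = 1 := by rw [norm_mul, om2_norm_one, Complex.norm_I, one_mul]
  refine ⟨fun p => (Complex.I * om ^ 2 * (K om p - K 1 p)).re, ?_, ?_, ?_⟩
  · exact Complex.continuous_re.comp_aestronglyMeasurable ((mK om).sub (mK 1) |>.const_mul _)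
  · filter_upwards [bK1, bK2] with p h1 h2
    refine (Complex.abs_re_le_norm _).trans ?_
    rw [norm_mul, hc0, one_mul]
    have := norm_sub_le (K om p) (K 1 p)
    have := kap_nonneg d p.1 p.2 hd
    linarith
  · intro f f1 q q1 ρ H h00
    obtain ⟨h0, h10⟩ := h00 rfl
    have cS : ContinuousOn (fun p : ℝ × ℝ => (q1 p.1 * f p.2 + f p.1 * q1 p.2 : ℂ)) (Icc 0 L ×ˢ Icc 0 L) :=
      (((c_fst H.cq1).mul (c_snd H.cf)).add ((c_fst H.cf).mul (c_snd H.cq1)))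
    have i1 := ker_int hd _ (mK 1) 18 bK1 _ cS
    have i2 := ker_int hd _ (mK om) 18 bK2 _ cS
    have s1 := split_bd H hd 1 (by simp) (K 1) (mK 1) 18 (by norm_num) bK1
    have s2 := split_bd H hd om om_norm_one (K om) (mK om) 18 (by norm_num) bK2
    have g1 := green_reg_f H hL 1 (by norm_num) (hD d) (fun x _ y _ => by
      rw [one_mul, ← Complex.ofReal_sub]; exact hD_an (D_ne1 hd _) (D_ne2 hd _))
    have g2 := green_full_f H hd hdL (fun w => -(w + (1 - om) * d)⁻¹)
      (fun x hx y hy => ((analyticAt_id.add analyticAt_const).inv (n7 hd hx.1)).neg) (hD d)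
      (by ext w; unfold hD; ring)
    have bd := bdF_D H hd h0 h10
    simp only [hKdef] at s1 s2
    rw [g1] at s1
    rw [g2] at s2
    have hR : 0 ≤ ∫ x, ρ x ^ 2 ∂(mu L) + ∫ x, f1 x ^ 2 ∂(mu L) :=
      add_nonneg (integral_nonneg (fun x => sq_nonneg _)) (integral_nonneg (fun x => sq_nonneg _))
    set R := ∫ x, ρ x ^ 2 ∂(mu L) + ∫ x, f1 x ^ 2 ∂(mu L)
    have e : (∫ p, (Complex.I * om ^ 2 * (K om p - K 1 p)).re * (q1 p.1 * f p.2 + f p.1 * q1 p.2) ∂((mu L).prod (mu L)))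
      = (Complex.I * om ^ 2 * ((∫ p, K om p * (q1 p.1 * f p.2 + f p.1 * q1 p.2) ∂((mu L).prod (mu L)))
        - (∫ p, K 1 p * (q1 p.1 * f p.2 + f p.1 * q1 p.2) ∂((mu L).prod (mu L))))).re := by
      rw [← integral_sub i2 i1, ← integral_const_mul]
      have := re_int ((ib i2 i1).const_mul (Complex.I * om ^ 2))
      refine Eq.trans ?_ this
      congr 1; ext p
      rw [← Complex.re_mul_ofReal]
      congr 1
      push_cast
      ring
    simp only [hKdef] at e
    rw [e]
    set J1 := ∫ p, hD d (p.2 - 1 * p.1) * (q1 p.1 * f p.2 + f p.1 * q1 p.2) ∂((mu L).prod (mu L))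
    set J2 := ∫ p, hD d (p.2 - om * p.1) * (q1 p.1 * f p.2 + f p.1 * q1 p.2) ∂((mu L).prod (mu L))
    set m := f d * q d + f1 d ^ 2
    set B1 := bdF L f f1 q 1 (hD d)
    set B2 := bdF L f f1 q om (hD d)
    have key : Complex.I * om ^ 2 * (J2 - J1) + ((2 * Real.pi * m : ℝ):ℂ) - Complex.I * om ^ 2 * (B2 - B1)
      = Complex.I * om ^ 2 * ((J2 - (B2 + 2 * Real.pi * Complex.I * om * m)) - (J1 - B1)) := by
      push_cast
      linear_combination (2 * Real.pi * m * Complex.I ^ 2) * om_cube + (2 * Real.pi * m) * Complex.I_sq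
    have : ‖Complex.I * om ^ 2 * (J2 - J1) + ((2 * Real.pi * m : ℝ):ℂ) - Complex.I * om ^ 2 * (B2 - B1)‖ ≤ 1296 * R := by
      rw [key, norm_mul, hc0, one_mul]
      refine (norm_sub_le _ _).trans ?_
      linarith
    have h5 := (Complex.abs_re_le_norm _).trans this
    rw [Complex.sub_re, Complex.add_re, Complex.ofReal_re, bd, sub_zero] at h5
    linarith


lemma kerR_int {L d : ℝ} (hd : 0 < d) (k : ℝ × ℝ → ℝ)
    (hK : AEStronglyMeasurable k ((mu L).prod (mu L)))
    (hb : ∀ᵐ p ∂((mu L).prod (mu L)), |k p| ≤ 54 * kap d p.1 p.2)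
    (F : ℝ × ℝ → ℝ) (hF : ContinuousOn F (Icc 0 L ×ˢ Icc 0 L)) :
    Integrable (fun p => k p * F p) ((mu L).prod (mu L)) := by
  have h1 := ker_int hd (fun p => (k p : ℂ)) (Complex.continuous_ofReal.comp_aestronglyMeasurable hK) 54
    (by filter_upwards [hb] with p hp; simpa using hp) (fun p => (F p : ℂ))
    (Complex.continuous_ofReal.comp_continuousOn hF)
  have := h1.re
  simpa using this

lemma kerR_bd {L d : ℝ} (hd : 0 < d) (k : ℝ × ℝ → ℝ)
    (hb : ∀ᵐ p ∂((mu L).prod (mu L)), |k p| ≤ 54 * kap d p.1 p.2)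
    (f g : ℝ → ℝ) (hf : ContinuousOn f (Icc 0 L)) (hg : ContinuousOn g (Icc 0 L)) :
    |∫ p, k p * (f p.1 * g p.2) ∂((mu L).prod (mu L))|
      ≤ 648 * (∫ x, f x ^ 2 ∂(mu L) + ∫ x, g x ^ 2 ∂(mu L)) := by
  have h := ker_bd hd (fun p => (k p : ℂ)) 54 (by norm_num)
    (by filter_upwards [hb] with p hp; simpa using hp) f g hf hg
  have e : ∫ p, (k p : ℂ) * ((f p.1 : ℂ) * (g p.2 : ℂ)) ∂((mu L).prod (mu L))
    = ((∫ p, k p * (f p.1 * g p.2) ∂((mu L).prod (mu L)) : ℝ) : ℂ) := by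
    rw [← integral_complex_ofReal]; congr 1; ext p; push_cast; ring
  rw [e, Complex.norm_real, Real.norm_eq_abs] at h
  linarith

lemma mu_int {L : ℝ} {f : ℝ → ℝ} (hf : ContinuousOn f (Icc 0 L)) : Integrable f (mu L) :=
  hf.integrableOn_compact isCompact_Icc

lemma mu_mono {L : ℝ} {f g : ℝ → ℝ} (hf : ContinuousOn f (Icc 0 L)) (hg : ContinuousOn g (Icc 0 L))
    (h : ∀ x ∈ Icc 0 L, f x ≤ g x) : ∫ x, f x ∂(mu L) ≤ ∫ x, g x ∂(mu L) := by
  apply integral_mono_ae (mu_int hf) (mu_int hg)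
  filter_upwards [mu_mem L] with x hx using h x hx

lemma P_int_le {L d : ℝ} (hd : 0 < d) : ∫ y, d / (y ^ 2 + d ^ 2) ∂(mu L) ≤ 4 := by
  have h := poi_lint d 0 hd
  have hi : Integrable (fun y : ℝ => d / (y ^ 2 + d ^ 2)) (mu L) :=
    mu_int (Continuous.continuousOn (continuous_const.div (by fun_prop) (fun y => by positivity)))
  have h2 : ∫⁻ y, ENNReal.ofReal (d / (y ^ 2 + d ^ 2)) ∂(mu L) ≤ ENNReal.ofReal Real.pi := by
    refine le_trans (lintegral_mono' Measure.restrict_le_self le_rfl) ?_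
    simpa using h
  rw [← ofReal_integral_eq_lintegral_ofReal hi (by filter_upwards with y; positivity)] at h2
  have := (ENNReal.ofReal_le_ofReal_iff Real.pi_pos.le).1 h2
  linarith [Real.pi_le_four]

lemma cP {L d : ℝ} (hd : 0 < d) : ContinuousOn (fun y : ℝ => d / (y ^ 2 + d ^ 2)) (Icc 0 L) :=
  Continuous.continuousOn (continuous_const.div (by fun_prop) (fun y => by positivity))

structure UD (L : ℝ) (u u1 u2 u3 : ℝ → ℝ) : Prop where
  h0 : ∀ x ∈ Icc 0 L, HasDerivAt u (u1 x) x
  h1 : ∀ x ∈ Icc 0 L, HasDerivAt u1 (u2 x) x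
  h2 : ∀ x ∈ Icc 0 L, HasDerivAt u2 (u3 x) x
  c3 : ContinuousOn u3 (Icc 0 L)

lemma ud_fd {L : ℝ} {u u1 u2 u3 : ℝ → ℝ} (H : UD L u u1 u2 u3) :
    FD L (fun x => (L - x) ^ 3 * u x) (fun x => -3 * (L - x) ^ 2 * u x + (L - x) ^ 3 * u1 x)
      (fun x => (L - x) ^ 3 * u2 x + 3 * (L - x) ^ 2 * u1 x + 6 * (L - x) * u x)
      (fun x => (L - x) ^ 3 * u3 x - 6 * u x) (fun x => -9 * (L - x) ^ 2 * u1 x) := by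
  have hl : ∀ x : ℝ, HasDerivAt (fun x => L - x) (-1) x := fun x => by
    simpa using (hasDerivAt_id x).const_sub L
  have d2 : ∀ x : ℝ, HasDerivAt (fun x => (L - x) ^ 2) (2 * (L - x) * (-1)) x := fun x => by
    exact ((hl x).fun_pow 2).congr_deriv (by push_cast; ring)
  have d3 : ∀ x : ℝ, HasDerivAt (fun x => (L - x) ^ 3) (3 * (L - x) ^ 2 * (-1)) x := fun x => by
    exact ((hl x).fun_pow 3).congr_deriv (by push_cast; ring)
  have c0 : ContinuousOn u (Icc 0 L) := fun x hx => (H.h0 x hx).continuousAt.continuousWithinAt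
  have c1 : ContinuousOn u1 (Icc 0 L) := fun x hx => (H.h1 x hx).continuousAt.continuousWithinAt
  have c3 := H.c3
  refine ⟨?_, ?_, ?_, ?_, ?_, ?_, ?_, ?_⟩
  · intro x hx
    exact ((d3 x).fun_mul (H.h0 x hx)).congr_deriv (by ring)
  · intro x hx
    exact ((((d2 x).const_mul (-3)).fun_mul (H.h0 x hx)).fun_add ((d3 x).fun_mul (H.h1 x hx))).congr_deriv (by ring)
  · intro x hx
    exact ((((d3 x).fun_mul (H.h2 x hx)).fun_add (((d2 x).const_mul 3).fun_mul (H.h1 x hx))).fun_add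
      (((hl x).const_mul 6).fun_mul (H.h0 x hx))).congr_deriv (by ring)
  · fun_prop
  · fun_prop
  · simp
  · simp
  · simp

lemma sq3_le (a b c : ℝ) : (a + b + c) ^ 2 ≤ 3 * (a ^ 2 + b ^ 2 + c ^ 2) := by
  nlinarith [sq_nonneg (a - b), sq_nonneg (b - c), sq_nonneg (a - c)]

set_option maxHeartbeats 2000000 in
lemma fixed_time {L d β : ℝ} (hL : 0 < L) (hd : 0 < d) (hβ : 0 ≤ β) (k : ℝ × ℝ → ℝ)
    (hK : AEStronglyMeasurable k ((mu L).prod (mu L)))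
    (hb : ∀ᵐ p ∂((mu L).prod (mu L)), |k p| ≤ 54 * kap d p.1 p.2)
    (hGK : ∀ f f1 q q1 ρ : ℝ → ℝ, FD L f f1 q q1 ρ → (β = 0 → f 0 = 0 ∧ f1 0 = 0) →
    |(∫ p, k p * (q1 p.1 * f p.2 + f p.1 * q1 p.2) ∂((mu L).prod (mu L)))
      + 2 * Real.pi * (f d * q d + f1 d ^ 2)| ≤
      1296 * (∫ x, ρ x ^ 2 ∂(mu L) + ∫ x, f1 x ^ 2 ∂(mu L))
      + β * (108 * |q 0| * ∫ y, d / (y ^ 2 + d ^ 2) * |f y| ∂(mu L)))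
    {u u1 u2 u3 v : ℝ → ℝ} (H : UD L u u1 u2 u3) (hv : ∀ x ∈ Icc 0 L, v x + u1 x + u3 x = 0)
    (h00 : β = 0 → u 0 = 0 ∧ u1 0 = 0) :
    |(∫ p, k p * ((L - p.1) ^ 3 * (L - p.2) ^ 3 * (v p.1 * u p.2 + u p.1 * v p.2)) ∂((mu L).prod (mu L)))
      - 2 * Real.pi * (((L - d) ^ 3) ^ 2 * (u d * u2 d + u1 d ^ 2) - 3 * (L - d) ^ 5 * (u d * u1 d) + 15 * (L - d) ^ 4 * u d ^ 2)|
    ≤ 300000 * (1 + L) ^ 6 * (∫ x, (u x ^ 2 + u1 x ^ 2) ∂(mu L))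
      + β * (100000 * (1 + L) ^ 6 * (u 0 ^ 2 + u1 0 ^ 2 + u2 0 ^ 2 + ∫ y, d / (y ^ 2 + d ^ 2) * u y ^ 2 ∂(mu L))) := by
  have HF := ud_fd H
  have c0 : ContinuousOn u (Icc 0 L) := fun x hx => (H.h0 x hx).continuousAt.continuousWithinAt
  have c1 : ContinuousOn u1 (Icc 0 L) := fun x hx => (H.h1 x hx).continuousAt.continuousWithinAt
  have key := hGK _ _ _ _ _ HF (by intro hb0; obtain ⟨a, b⟩ := h00 hb0; simp [a, b])
  set M := 1 + L with hM
  have hM1 : 1 ≤ M := by linarith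
  have pw : ∀ x ∈ Icc 0 L, 0 ≤ L - x ∧ L - x ≤ M := fun x hx => ⟨by linarith [hx.2], by linarith [hx.1]⟩
  have pwn : ∀ n : ℕ, n ≤ 6 → ∀ x ∈ Icc 0 L, (L - x) ^ n ≤ M ^ 6 := fun n hn x hx =>
    (pow_le_pow_left₀ (pw x hx).1 (pw x hx).2 n).trans (pow_le_pow_right₀ hM1 hn)
  have hM6 : 1 ≤ M ^ 6 := one_le_pow₀ hM1
  set N := ∫ x, (u x ^ 2 + u1 x ^ 2) ∂(mu L) with hN
  have cN : ∀ c : ℝ, ContinuousOn (fun x => c * (u x ^ 2 + u1 x ^ 2)) (Icc 0 L) := fun c => by fun_prop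
  -- bounds
  have B1 : ∫ x, (-9 * (L - x) ^ 2 * u1 x) ^ 2 ∂(mu L) ≤ 81 * M ^ 6 * N := by
    rw [hN, ← integral_const_mul]
    apply mu_mono (by fun_prop) (cN _)
    intro x hx
    have h4 := pwn 4 (by norm_num) x hx
    have := mul_le_mul_of_nonneg_right h4 (sq_nonneg (u1 x))
    nlinarith [mul_nonneg (by positivity : 0 ≤ M ^ 6) (sq_nonneg (u x))]
  have B2 : ∫ x, (-3 * (L - x) ^ 2 * u x + (L - x) ^ 3 * u1 x) ^ 2 ∂(mu L) ≤ 18 * M ^ 6 * N := by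
    rw [hN, ← integral_const_mul]
    apply mu_mono (by fun_prop) (cN _)
    intro x hx
    have h4 := mul_le_mul_of_nonneg_right (pwn 4 (by norm_num) x hx) (sq_nonneg (u x))
    have h6 := mul_le_mul_of_nonneg_right (pwn 6 (by norm_num) x hx) (sq_nonneg (u1 x))
    nlinarith [mul_nonneg (by positivity : 0 ≤ M ^ 6) (sq_nonneg (u1 x)), sq_nonneg (3 * (L - x) ^ 2 * u x + (L - x) ^ 3 * u1 x)]
  have B3 : ∫ x, (-6 * u x - (L - x) ^ 3 * u1 x) ^ 2 ∂(mu L) ≤ 72 * M ^ 6 * N := by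
    rw [hN, ← integral_const_mul]
    apply mu_mono (by fun_prop) (cN _)
    intro x hx
    have h4 := mul_le_mul_of_nonneg_right hM6 (sq_nonneg (u x))
    have h6 := mul_le_mul_of_nonneg_right (pwn 6 (by norm_num) x hx) (sq_nonneg (u1 x))
    nlinarith [mul_nonneg (by positivity : 0 ≤ M ^ 6) (sq_nonneg (u1 x)), sq_nonneg (6 * u x - (L - x) ^ 3 * u1 x)]
  have B4 : ∫ x, ((L - x) ^ 3 * u x) ^ 2 ∂(mu L) ≤ M ^ 6 * N := by
    rw [hN, ← integral_const_mul]
    apply mu_mono (by fun_prop) (cN _)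
    intro x hx
    have h6 := mul_le_mul_of_nonneg_right (pwn 6 (by norm_num) x hx) (sq_nonneg (u x))
    nlinarith [mul_nonneg (by positivity : 0 ≤ M ^ 6) (sq_nonneg (u1 x))]
  have B5 : |(L - 0) ^ 3 * u2 0 + 3 * (L - 0) ^ 2 * u1 0 + 6 * (L - 0) * u 0| *
      (∫ y, d / (y ^ 2 + d ^ 2) * |(L - y) ^ 3 * u y| ∂(mu L)) ≤
      216 * M ^ 6 * (u 0 ^ 2 + u1 0 ^ 2 + u2 0 ^ 2) + M ^ 6 * ∫ y, d / (y ^ 2 + d ^ 2) * u y ^ 2 ∂(mu L) := by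
    set q0 := (L - 0) ^ 3 * u2 0 + 3 * (L - 0) ^ 2 * u1 0 + 6 * (L - 0) * u 0 with hq0
    have m0 : (0:ℝ) ∈ Icc 0 L := ⟨le_rfl, hL.le⟩
    have a1 : q0 ^ 2 ≤ 108 * M ^ 6 * (u 0 ^ 2 + u1 0 ^ 2 + u2 0 ^ 2) := by
      have h6 := mul_le_mul_of_nonneg_right (pwn 6 (by norm_num) 0 m0) (sq_nonneg (u2 0))
      have h4 := mul_le_mul_of_nonneg_right (pwn 4 (by norm_num) 0 m0) (sq_nonneg (u1 0))
      have h2 := mul_le_mul_of_nonneg_right (pwn 2 (by norm_num) 0 m0) (sq_nonneg (u 0))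
      have := sq3_le ((L - 0) ^ 3 * u2 0) (3 * (L - 0) ^ 2 * u1 0) (6 * (L - 0) * u 0)
      rw [← hq0] at this
      have p1 := mul_nonneg (by positivity : 0 ≤ M ^ 6) (sq_nonneg (u1 0))
      have p2 := mul_nonneg (by positivity : 0 ≤ M ^ 6) (sq_nonneg (u2 0))
      have p3 := mul_nonneg (by positivity : 0 ≤ M ^ 6) (sq_nonneg (u 0))
      have e0 : ((L - 0) ^ 3 * u2 0) ^ 2 + (3 * (L - 0) ^ 2 * u1 0) ^ 2 + (6 * (L - 0) * u 0) ^ 2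
        = (L - 0) ^ 6 * u2 0 ^ 2 + 9 * ((L - 0) ^ 4 * u1 0 ^ 2) + 36 * ((L - 0) ^ 2 * u 0 ^ 2) := by ring
      rw [e0] at this
      linarith
    rw [← integral_const_mul]
    have a2 : ∫ y, |q0| * (d / (y ^ 2 + d ^ 2) * |(L - y) ^ 3 * u y|) ∂(mu L)
       ≤ ∫ y, (q0 ^ 2 / 2 * (d / (y ^ 2 + d ^ 2)) + M ^ 6 * (d / (y ^ 2 + d ^ 2) * u y ^ 2)) ∂(mu L) := by
      have cp := cP (L := L) hd
      apply mu_mono (by fun_prop) (by fun_prop)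
      intro y hy
      have hp : 0 ≤ d / (y ^ 2 + d ^ 2) := by positivity
      have h6 := mul_le_mul_of_nonneg_right (pwn 6 (by norm_num) y hy) (sq_nonneg (u y))
      have : |q0| * |(L - y) ^ 3 * u y| ≤ q0 ^ 2 / 2 + M ^ 6 * u y ^ 2 := by
        nlinarith [sq_nonneg (|q0| - |(L - y) ^ 3 * u y|), sq_abs q0, sq_abs ((L - y) ^ 3 * u y), sq_nonneg ((L - y) ^ 3 * u y)]
      nlinarith [mul_le_mul_of_nonneg_left this hp]
    refine a2.trans ?_
    have cp := cP (L := L) hd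
    rw [integral_add (mu_int (by fun_prop)) (mu_int (by fun_prop)), integral_const_mul, integral_const_mul]
    have := P_int_le (L := L) hd
    nlinarith [sq_nonneg q0]
  -- kernel terms
  have cs : ContinuousOn (fun x => -6 * u x - (L - x) ^ 3 * u1 x) (Icc 0 L) := by fun_prop
  have k1 := kerR_bd hd k hb _ _ cs HF.cf
  have k2 := kerR_bd hd k hb _ _ HF.cf cs
  have cb : ∀ {a b : ℝ → ℝ}, ContinuousOn a (Icc 0 L) → ContinuousOn b (Icc 0 L) →
      ContinuousOn (fun p : ℝ × ℝ => a p.1 * b p.2) (Icc 0 L ×ˢ Icc 0 L) := fun ha hb =>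
    (ha.comp continuousOn_fst (fun p hp => hp.1)).mul (hb.comp continuousOn_snd (fun p hp => hp.2))
  have i1 := kerR_int hd k hK hb _ (cb cs HF.cf)
  have i2 := kerR_int hd k hK hb _ (cb HF.cf cs)
  have i3 := kerR_int hd k hK hb _ ((cb HF.cq1 HF.cf).add (cb HF.cf HF.cq1))
  have e : (∫ p, k p * ((L - p.1) ^ 3 * (L - p.2) ^ 3 * (v p.1 * u p.2 + u p.1 * v p.2)) ∂((mu L).prod (mu L)))
    = (∫ p, k p * ((-6 * u p.1 - (L - p.1) ^ 3 * u1 p.1) * ((L - p.2) ^ 3 * u p.2)) ∂((mu L).prod (mu L)))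
     + (∫ p, k p * (((L - p.1) ^ 3 * u p.1) * (-6 * u p.2 - (L - p.2) ^ 3 * u1 p.2)) ∂((mu L).prod (mu L)))
     - (∫ p, k p * (((L - p.1) ^ 3 * u3 p.1 - 6 * u p.1) * ((L - p.2) ^ 3 * u p.2) + ((L - p.1) ^ 3 * u p.1) * ((L - p.2) ^ 3 * u3 p.2 - 6 * u p.2)) ∂((mu L).prod (mu L))) := by
    rw [← integral_add i1 i2]
    refine Eq.trans ?_ (integral_sub (i1.add i2) i3)
    apply integral_congr_ae
    filter_upwards [box_ae_mem L] with p hp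
    have v1 : v p.1 = -u1 p.1 - u3 p.1 := by linarith [hv p.1 hp.1]
    have v2 : v p.2 = -u1 p.2 - u3 p.2 := by linarith [hv p.2 hp.2]
    rw [v1, v2]
    ring
  rw [e]
  set J1 := (∫ p, k p * ((-6 * u p.1 - (L - p.1) ^ 3 * u1 p.1) * ((L - p.2) ^ 3 * u p.2)) ∂((mu L).prod (mu L)))
  set J2 := (∫ p, k p * (((L - p.1) ^ 3 * u p.1) * (-6 * u p.2 - (L - p.2) ^ 3 * u1 p.2)) ∂((mu L).prod (mu L)))
  set J3 := (∫ p, k p * (((L - p.1) ^ 3 * u3 p.1 - 6 * u p.1) * ((L - p.2) ^ 3 * u p.2) + ((L - p.1) ^ 3 * u p.1) * ((L - p.2) ^ 3 * u3 p.2 - 6 * u p.2)) ∂((mu L).prod (mu L)))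
  have N0 : 0 ≤ M ^ 6 * N := by
    have : 0 ≤ N := integral_nonneg (fun x => by positivity)
    positivity
  have S0 : 0 ≤ M ^ 6 * (u 0 ^ 2 + u1 0 ^ 2 + u2 0 ^ 2) := by positivity
  have S1 : 0 ≤ M ^ 6 * ∫ y, d / (y ^ 2 + d ^ 2) * u y ^ 2 ∂(mu L) := by
    have : 0 ≤ ∫ y, d / (y ^ 2 + d ^ 2) * u y ^ 2 ∂(mu L) := integral_nonneg (fun x => by positivity)
    positivity
  have B6 := mul_le_mul_of_nonneg_left B5 hβ
  have S2 := mul_nonneg hβ S0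
  have S3 := mul_nonneg hβ S1
  have em : (((L - d) ^ 3) ^ 2 * (u d * u2 d + u1 d ^ 2) - 3 * (L - d) ^ 5 * (u d * u1 d) + 15 * (L - d) ^ 4 * u d ^ 2)
    = ((L - d) ^ 3 * u d * ((L - d) ^ 3 * u2 d + 3 * (L - d) ^ 2 * u1 d + 6 * (L - d) * u d) + (-3 * (L - d) ^ 2 * u d + (L - d) ^ 3 * u1 d) ^ 2) := by ring
  rw [em]
  obtain ⟨a1, a2⟩ := abs_le.1 key
  obtain ⟨a3, a4⟩ := abs_le.1 k1
  obtain ⟨a5, a6⟩ := abs_le.1 k2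
  rw [abs_le]
  constructor
  · linarith
  · linarith


structure Sol (L T : ℝ) (φ φt φx φxx φxxx : ℝ → ℝ → ℝ) : Prop where
  ht : ∀ x ∈ Icc (0:ℝ) L, ∀ t ∈ Icc (0:ℝ) T, HasDerivAt (fun s => φ x s) (φt x t) t
  h0 : ∀ x ∈ Icc (0:ℝ) L, ∀ t ∈ Icc (0:ℝ) T, HasDerivAt (fun y => φ y t) (φx x t) x
  h1 : ∀ x ∈ Icc (0:ℝ) L, ∀ t ∈ Icc (0:ℝ) T, HasDerivAt (fun y => φx y t) (φxx x t) x
  h2 : ∀ x ∈ Icc (0:ℝ) L, ∀ t ∈ Icc (0:ℝ) T, HasDerivAt (fun y => φxx y t) (φxxx x t) x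
  c : ContinuousOn (fun p : ℝ × ℝ => φ p.1 p.2) (Icc 0 L ×ˢ Icc 0 T)
  ct : ContinuousOn (fun p : ℝ × ℝ => φt p.1 p.2) (Icc 0 L ×ˢ Icc 0 T)
  c1 : ContinuousOn (fun p : ℝ × ℝ => φx p.1 p.2) (Icc 0 L ×ˢ Icc 0 T)
  c2 : ContinuousOn (fun p : ℝ × ℝ => φxx p.1 p.2) (Icc 0 L ×ˢ Icc 0 T)
  c3 : ContinuousOn (fun p : ℝ × ℝ => φxxx p.1 p.2) (Icc 0 L ×ˢ Icc 0 T)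
  eqn : ∀ x ∈ Icc (0:ℝ) L, ∀ t ∈ Icc (0:ℝ) T, φt x t + φx x t + φxxx x t = 0

section
variable {L T : ℝ}

lemma slT {φ : ℝ → ℝ → ℝ} (h : ContinuousOn (fun p : ℝ × ℝ => φ p.1 p.2) (Icc 0 L ×ˢ Icc 0 T))
    {x : ℝ} (hx : x ∈ Icc 0 L) : ContinuousOn (fun t => φ x t) (Icc 0 T) :=
  h.comp (f := fun t => (x, t)) (by fun_prop) (fun t ht => ⟨hx, ht⟩)

lemma slX {φ : ℝ → ℝ → ℝ} (h : ContinuousOn (fun p : ℝ × ℝ => φ p.1 p.2) (Icc 0 L ×ˢ Icc 0 T))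
    {t : ℝ} (ht : t ∈ Icc 0 T) : ContinuousOn (fun x => φ x t) (Icc 0 L) :=
  h.comp (f := fun x => (x, t)) (by fun_prop) (fun x hx => ⟨hx, ht⟩)

lemma dbl_int {f : ℝ → ℝ → ℝ} (hf : ContinuousOn (fun p : ℝ × ℝ => f p.1 p.2) (Icc 0 L ×ˢ Icc 0 T)) :
    Integrable (fun p : ℝ × ℝ => f p.1 p.2) ((mu L).prod (mu T)) := by
  have : Integrable (fun p : ℝ × ℝ => f p.1 p.2) ((volume.prod volume).restrict (Icc 0 L ×ˢ Icc 0 T)) :=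
    hf.integrableOn_compact (isCompact_Icc.prod isCompact_Icc)
  rwa [← Measure.prod_restrict] at this

lemma dbl_swap {f : ℝ → ℝ → ℝ} (hf : ContinuousOn (fun p : ℝ × ℝ => f p.1 p.2) (Icc 0 L ×ˢ Icc 0 T)) :
    ∫ t, ∫ x, f x t ∂(mu L) ∂(mu T) = ∫ x, ∫ t, f x t ∂(mu T) ∂(mu L) :=
  (integral_integral_swap (f := f) (dbl_int hf)).symm

lemma dbl_t {f : ℝ → ℝ → ℝ} (hf : ContinuousOn (fun p : ℝ × ℝ => f p.1 p.2) (Icc 0 L ×ˢ Icc 0 T)) :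
    Integrable (fun t => ∫ x, f x t ∂(mu L)) (mu T) := (dbl_int hf).integral_prod_right

lemma dbl_x {f : ℝ → ℝ → ℝ} (hf : ContinuousOn (fun p : ℝ × ℝ => f p.1 p.2) (Icc 0 L ×ˢ Icc 0 T)) :
    Integrable (fun x => ∫ t, f x t ∂(mu T)) (mu L) := (dbl_int hf).integral_prod_left

lemma trip_int {d : ℝ} (hd : 0 < d) (k : ℝ × ℝ → ℝ)
    (hK : AEStronglyMeasurable k ((mu L).prod (mu L)))
    (hb : ∀ᵐ p ∂((mu L).prod (mu L)), |k p| ≤ 54 * kap d p.1 p.2)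
    (G : (ℝ × ℝ) × ℝ → ℝ) (hG : ContinuousOn G ((Icc 0 L ×ˢ Icc 0 L) ×ˢ Icc 0 T)) :
    Integrable (fun z : (ℝ × ℝ) × ℝ => k z.1 * G z) (((mu L).prod (mu L)).prod (mu T)) := by
  have em : ((mu L).prod (mu L)).prod (mu T) =
      ((volume.prod volume).prod volume).restrict ((Icc 0 L ×ˢ Icc 0 L) ×ˢ Icc 0 T) := by
    rw [← Measure.prod_restrict, ← Measure.prod_restrict]
  have iG : Integrable G (((mu L).prod (mu L)).prod (mu T)) := by
    rw [em]
    exact hG.integrableOn_compact ((isCompact_Icc.prod isCompact_Icc).prod isCompact_Icc)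
  obtain ⟨M, hM⟩ := ((isCompact_Icc.prod isCompact_Icc).prod isCompact_Icc).exists_bound_of_continuousOn hG
  have ik : Integrable (fun z : (ℝ × ℝ) × ℝ => 54 * kap d z.1.1 z.1.2 * M) (((mu L).prod (mu L)).prod (mu T)) := by
    have := Integrable.mul_prod (ν := mu T) ((kap_int d L hd).const_mul 54) (integrable_const (M:ℝ))
    exact this
  refine Integrable.mono' ik (hK.comp_fst.mul iG.aestronglyMeasurable) ?_
  have hb' := (Measure.quasiMeasurePreserving_fst (μ := (mu L).prod (mu L)) (ν := mu T)).ae hb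
  have hm : ∀ᵐ z ∂(((mu L).prod (mu L)).prod (mu T)), z ∈ ((Icc (0:ℝ) L ×ˢ Icc (0:ℝ) L) ×ˢ Icc (0:ℝ) T) := by
    rw [em]
    exact ae_restrict_mem ((measurableSet_Icc.prod measurableSet_Icc).prod measurableSet_Icc)
  filter_upwards [hb', hm] with z h1 h2
  rw [norm_mul, Real.norm_eq_abs]
  have h3 := hM z h2
  exact mul_le_mul h1 h3 (norm_nonneg _) ((abs_nonneg _).trans h1)

lemma mu_ftcR (hT : 0 ≤ T) (f g : ℝ → ℝ) (h : ∀ x ∈ Icc 0 T, HasDerivAt f (g x) x)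
    (hg : ContinuousOn g (Icc 0 T)) : ∫ x, g x ∂(mu T) = f T - f 0 := by
  rw [mu_integral hT]
  apply intervalIntegral.integral_eq_sub_of_hasDerivAt
  · rw [uIcc_of_le hT]; exact h
  · rw [intervalIntegrable_iff_integrableOn_Icc_of_le hT]
    exact mu_int hg

variable {φ φt φx φxx φxxx : ℝ → ℝ → ℝ}

lemma c_a {f : ℝ → ℝ → ℝ} (hf : ContinuousOn (fun p : ℝ × ℝ => f p.1 p.2) (Icc 0 L ×ˢ Icc 0 T)) :
    ContinuousOn (fun z : (ℝ × ℝ) × ℝ => f z.1.1 z.2) ((Icc 0 L ×ˢ Icc 0 L) ×ˢ Icc 0 T) :=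
  hf.comp (f := fun z : (ℝ × ℝ) × ℝ => (z.1.1, z.2)) (by fun_prop) (fun z hz => ⟨hz.1.1, hz.2⟩)
lemma c_b {f : ℝ → ℝ → ℝ} (hf : ContinuousOn (fun p : ℝ × ℝ => f p.1 p.2) (Icc 0 L ×ˢ Icc 0 T)) :
    ContinuousOn (fun z : (ℝ × ℝ) × ℝ => f z.1.2 z.2) ((Icc 0 L ×ˢ Icc 0 L) ×ˢ Icc 0 T) :=
  hf.comp (f := fun z : (ℝ × ℝ) × ℝ => (z.1.2, z.2)) (by fun_prop) (fun z hz => ⟨hz.1.2, hz.2⟩)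

/-- integrand in time -/
lemma time_id (hT : 0 ≤ T) (S : Sol L T φ φt φx φxx φxxx) {d : ℝ} (hd : 0 < d) (k : ℝ × ℝ → ℝ)
    (hK : AEStronglyMeasurable k ((mu L).prod (mu L)))
    (hb : ∀ᵐ p ∂((mu L).prod (mu L)), |k p| ≤ 54 * kap d p.1 p.2) :
    Integrable (fun t => ∫ p, k p * ((L - p.1) ^ 3 * (L - p.2) ^ 3 *
      (φt p.1 t * φ p.2 t + φ p.1 t * φt p.2 t)) ∂((mu L).prod (mu L))) (mu T) ∧
    ∫ t, (∫ p, k p * ((L - p.1) ^ 3 * (L - p.2) ^ 3 *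
      (φt p.1 t * φ p.2 t + φ p.1 t * φt p.2 t)) ∂((mu L).prod (mu L))) ∂(mu T) =
    (∫ p, k p * (((L - p.1) ^ 3 * φ p.1 T) * ((L - p.2) ^ 3 * φ p.2 T)) ∂((mu L).prod (mu L)))
    - ∫ p, k p * (((L - p.1) ^ 3 * φ p.1 0) * ((L - p.2) ^ 3 * φ p.2 0)) ∂((mu L).prod (mu L)) := by
  have a1 := c_a S.c
  have a2 := c_b S.c
  have a3 := c_a S.ct
  have a4 := c_b S.ct
  have I := trip_int (T := T) hd k hK hb (fun z : (ℝ × ℝ) × ℝ => ((L - z.1.1) ^ 3 * (L - z.1.2) ^ 3 *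
      (φt z.1.1 z.2 * φ z.1.2 z.2 + φ z.1.1 z.2 * φt z.1.2 z.2))) (ContinuousOn.mul (by fun_prop) ((a3.mul a2).add (a1.mul a4)))
  refine ⟨I.integral_prod_right, ?_⟩
  have sw := integral_integral_swap (f := fun (p : ℝ × ℝ) (t : ℝ) => k p * ((L - p.1) ^ 3 * (L - p.2) ^ 3 *
      (φt p.1 t * φ p.2 t + φ p.1 t * φt p.2 t))) I
  rw [← sw]
  have mT : T ∈ Icc 0 T := ⟨hT, le_rfl⟩
  have m0 : (0:ℝ) ∈ Icc 0 T := ⟨le_rfl, hT⟩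
  have cb : ∀ t ∈ Icc 0 T, ContinuousOn (fun p : ℝ × ℝ => ((L - p.1) ^ 3 * φ p.1 t) * ((L - p.2) ^ 3 * φ p.2 t)) (Icc 0 L ×ˢ Icc 0 L) := by
    intro t ht
    have b1 : ContinuousOn (fun p : ℝ × ℝ => φ p.1 t) (Icc 0 L ×ˢ Icc 0 L) :=
      (slX S.c ht).comp continuousOn_fst (fun p hp => hp.1)
    have b2 : ContinuousOn (fun p : ℝ × ℝ => φ p.2 t) (Icc 0 L ×ˢ Icc 0 L) :=
      (slX S.c ht).comp continuousOn_snd (fun p hp => hp.2)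
    have b3 : ContinuousOn (fun p : ℝ × ℝ => (L - p.1) ^ 3) (Icc 0 L ×ˢ Icc 0 L) := by fun_prop
    have b4 : ContinuousOn (fun p : ℝ × ℝ => (L - p.2) ^ 3) (Icc 0 L ×ˢ Icc 0 L) := by fun_prop
    exact (b3.mul b1).mul (b4.mul b2)
  rw [← integral_sub (kerR_int hd k hK hb _ (cb T mT)) (kerR_int hd k hK hb _ (cb 0 m0))]
  apply integral_congr_ae
  filter_upwards [box_ae_mem L] with p hp
  rw [integral_const_mul, integral_const_mul, ← mul_sub]
  congr 1
  have cφ1 := slT S.c hp.1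
  have cφ2 := slT S.c hp.2
  have ct1 := slT S.ct hp.1
  have ct2 := slT S.ct hp.2
  rw [mu_ftcR hT (fun t => φ p.1 t * φ p.2 t) _ (fun t ht => (S.ht p.1 hp.1 t ht).mul (S.ht p.2 hp.2 t ht)) (by fun_prop)]
  ring

end


section
variable {L T : ℝ} {φ φt φx φxx φxxx : ℝ → ℝ → ℝ}

lemma L6_bd (hL : 0 < L) {Q : ℝ} {u : ℝ → ℝ} (c0 : ContinuousOn u (Icc 0 L)) (h : ∫ x, u x ^ 2 ∂(mu L) ≤ Q) :
    ∫ x, ((L - x) ^ 3 * u x) ^ 2 ∂(mu L) ≤ (1 + L) ^ 6 * Q := by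
  have : ∫ x, ((L - x) ^ 3 * u x) ^ 2 ∂(mu L) ≤ ∫ x, (1 + L) ^ 6 * u x ^ 2 ∂(mu L) := by
    apply mu_mono (by fun_prop) (by fun_prop)
    intro x hx
    have h1 : (L - x) ^ 6 ≤ (1 + L) ^ 6 := pow_le_pow_left₀ (by linarith [hx.2]) (by linarith [hx.1]) 6
    have := mul_le_mul_of_nonneg_right h1 (sq_nonneg (u x))
    calc _ = (L - x) ^ 6 * u x ^ 2 := by ring
      _ ≤ _ := this
  rw [integral_const_mul] at this
  exact this.trans (mul_le_mul_of_nonneg_left h (by positivity))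

set_option maxHeartbeats 1000000 in
lemma time_bd (hL : 0 < L) (hT : 0 < T) (S : Sol L T φ φt φx φxx φxxx) {d β Q : ℝ} (hd : 0 < d)
    (hdL : d ≤ L / 2) (hβ : 0 ≤ β) (hβ1 : β ≤ 1) (hGK : GK L d β)
    (h00 : β = 0 → ∀ t ∈ Icc 0 T, φ 0 t = 0 ∧ φx 0 t = 0)
    (Q0 : ∫ x, φ x 0 ^ 2 ∂(mu L) ≤ Q) (QT : ∫ x, φ x T ^ 2 ∂(mu L) ≤ Q)
    (Q1 : ∫ t, ∫ x, (φ x t ^ 2 + φx x t ^ 2) ∂(mu L) ∂(mu T) ≤ Q)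
    (Qg : ∀ y ∈ Icc 0 L, ∫ t, φ y t ^ 2 ∂(mu T) ≤ Q)
    (Qb : β * ∫ t, (φ 0 t ^ 2 + φx 0 t ^ 2 + φxx 0 t ^ 2) ∂(mu T) ≤ Q) :
    |∫ t, (φ d t * φxx d t + φx d t ^ 2) ∂(mu T)| ≤
      1 / 8 * (∫ t, φx d t ^ 2 ∂(mu T)) + 64 / L ^ 6 * (2000000 * (1 + L) ^ 6 * Q) := by
  obtain ⟨k, hK, hb, hG⟩ := hGK
  have md : d ∈ Icc 0 L := ⟨hd.le, by linarith⟩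
  have m0 : (0:ℝ) ∈ Icc 0 L := ⟨le_rfl, hL.le⟩
  have mT : T ∈ Icc 0 T := ⟨hT.le, le_rfl⟩
  have mT0 : (0:ℝ) ∈ Icc 0 T := ⟨le_rfl, hT.le⟩
  have Qn : 0 ≤ Q := le_trans (integral_nonneg (fun x => sq_nonneg _)) Q0
  have ft : ∀ t ∈ Icc 0 T, _ := fun t ht => fixed_time hL hd hβ k hK hb hG
    (u := fun x => φ x t) (u1 := fun x => φx x t) (u2 := fun x => φxx x t) (u3 := fun x => φxxx x t)
    (v := fun x => φt x t) ⟨fun x hx => S.h0 x hx t ht, fun x hx => S.h1 x hx t ht,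
      fun x hx => S.h2 x hx t ht, slX S.c3 ht⟩ (fun x hx => S.eqn x hx t ht) (fun h => h00 h t ht)
  obtain ⟨iJ, eJ⟩ := time_id hT.le S hd k hK hb
  have cu := slT S.c md
  have cu1 := slT S.c1 md
  have cu2 := slT S.c2 md
  have cv := slT S.c m0
  have cv1 := slT S.c1 m0
  have cv2 := slT S.c2 m0
  have S1 := S.c
  have S2 := S.c1
  have cE : ContinuousOn (fun p : ℝ × ℝ => φ p.1 p.2 ^ 2 + φx p.1 p.2 ^ 2) (Icc 0 L ×ˢ Icc 0 T) :=
    (S.c.pow 2).add (S.c1.pow 2)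
  have cPP : ContinuousOn (fun p : ℝ × ℝ => d / (p.1 ^ 2 + d ^ 2) * φ p.1 p.2 ^ 2) (Icc 0 L ×ˢ Icc 0 T) :=
    ((cP (L := L) hd).comp continuousOn_fst (fun p hp => hp.1)).mul (S.c.pow 2)
  set J : ℝ → ℝ := fun t => ∫ p, k p * ((L - p.1) ^ 3 * (L - p.2) ^ 3 *
      (φt p.1 t * φ p.2 t + φ p.1 t * φt p.2 t)) ∂((mu L).prod (mu L)) with hJ
  set m : ℝ → ℝ := fun t => ((L - d) ^ 3) ^ 2 * (φ d t * φxx d t + φx d t ^ 2)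
    - 3 * (L - d) ^ 5 * (φ d t * φx d t) + 15 * (L - d) ^ 4 * φ d t ^ 2 with hm
  have cm : ContinuousOn m (Icc 0 T) := by fun_prop
  set M := 1 + L with hM
  have hM1 : 1 ≤ M := by linarith
  have hM6 : 1 ≤ M ^ 6 := one_le_pow₀ hM1
  have iR1 := dbl_t (f := fun x t => φ x t ^ 2 + φx x t ^ 2) cE
  have iR2 := dbl_t (f := fun x t => d / (x ^ 2 + d ^ 2) * φ x t ^ 2) cPP
  have ib : Integrable (fun t => φ 0 t ^ 2 + φx 0 t ^ 2 + φxx 0 t ^ 2) (mu T) := mu_int (by fun_prop)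
  have iR3 : Integrable (fun t => (φ 0 t ^ 2 + φx 0 t ^ 2 + φxx 0 t ^ 2) + ∫ x, d / (x ^ 2 + d ^ 2) * φ x t ^ 2 ∂(mu L)) (mu T) := ib.add iR2
  have main : |∫ t, (J t - 2 * Real.pi * m t) ∂(mu T)| ≤
     300000 * M ^ 6 * (∫ t, ∫ x, (φ x t ^ 2 + φx x t ^ 2) ∂(mu L) ∂(mu T))
      + β * (100000 * M ^ 6 * ((∫ t, (φ 0 t ^ 2 + φx 0 t ^ 2 + φxx 0 t ^ 2) ∂(mu T)) +
        ∫ t, ∫ x, d / (x ^ 2 + d ^ 2) * φ x t ^ 2 ∂(mu L) ∂(mu T))) := by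
    have : |∫ t, (J t - 2 * Real.pi * m t) ∂(mu T)| ≤ ∫ t, (300000 * M ^ 6 * (∫ x, (φ x t ^ 2 + φx x t ^ 2) ∂(mu L))
      + β * (100000 * M ^ 6 * ((φ 0 t ^ 2 + φx 0 t ^ 2 + φxx 0 t ^ 2) + ∫ x, d / (x ^ 2 + d ^ 2) * φ x t ^ 2 ∂(mu L)))) ∂(mu T) := by
      rw [← Real.norm_eq_abs]
      apply norm_integral_le_of_norm_le ((iR1.const_mul _).add ((iR3.const_mul _).const_mul _))
      filter_upwards [mu_mem T] with t ht
      rw [Real.norm_eq_abs]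
      exact ft t ht
    refine this.trans (le_of_eq ?_)
    rw [integral_add (iR1.const_mul _) ((iR3.const_mul _).const_mul _), integral_const_mul, integral_const_mul,
      integral_const_mul]
    rw [← integral_add ib iR2]
  rw [integral_sub iJ ((mu_int cm).const_mul _), integral_const_mul, eJ] at main
  -- kernel at end times
  have kT := kerR_bd hd k hb (f := fun x => (L - x) ^ 3 * φ x T) (g := fun x => (L - x) ^ 3 * φ x T)
    (ContinuousOn.mul (by fun_prop) (slX S.c mT)) (ContinuousOn.mul (by fun_prop) (slX S.c mT))
  have k0 := kerR_bd hd k hb (f := fun x => (L - x) ^ 3 * φ x 0) (g := fun x => (L - x) ^ 3 * φ x 0)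
    (ContinuousOn.mul (by fun_prop) (slX S.c mT0)) (ContinuousOn.mul (by fun_prop) (slX S.c mT0))
  have bT := L6_bd hL (slX S.c mT) QT
  have b0 := L6_bd hL (slX S.c mT0) Q0
  have bP : ∫ t, ∫ x, d / (x ^ 2 + d ^ 2) * φ x t ^ 2 ∂(mu L) ∂(mu T) ≤ 4 * Q := by
    rw [dbl_swap (f := fun x t => d / (x ^ 2 + d ^ 2) * φ x t ^ 2) cPP]
    have : ∫ x, ∫ t, d / (x ^ 2 + d ^ 2) * φ x t ^ 2 ∂(mu T) ∂(mu L) ≤ ∫ x, d / (x ^ 2 + d ^ 2) * Q ∂(mu L) := by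
      apply integral_mono_ae (dbl_x (f := fun x t => d / (x ^ 2 + d ^ 2) * φ x t ^ 2) cPP)
        ((mu_int (cP hd)).mul_const Q)
      filter_upwards [mu_mem L] with x hx
      rw [integral_const_mul]
      exact mul_le_mul_of_nonneg_left (Qg x hx) (by positivity)
    refine this.trans ?_
    rw [integral_mul_const]
    exact mul_le_mul_of_nonneg_right (P_int_le hd) Qn
  have bP' : β * ∫ t, ∫ x, d / (x ^ 2 + d ^ 2) * φ x t ^ 2 ∂(mu L) ∂(mu T) ≤ 4 * Q :=
    (mul_le_mul_of_nonneg_left bP hβ).trans (by nlinarith)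
  -- pull apart m
  set c := L - d with hc
  have hcp : 0 < c := by linarith
  have hcM : c ^ 4 ≤ M ^ 6 := (pow_le_pow_left₀ hcp.le (by linarith) 4).trans (pow_le_pow_right₀ hM1 (by norm_num))
  set X := ∫ t, (φ d t * φxx d t + φx d t ^ 2) ∂(mu T) with hX
  set A := ∫ t, φx d t ^ 2 ∂(mu T) with hA
  have mm : |c ^ 6 * X - ∫ t, m t ∂(mu T)| ≤ c ^ 6 / 8 * A + 33 * c ^ 4 * Q := by
    rw [hX, ← integral_const_mul, ← integral_sub ((mu_int (by fun_prop)).const_mul _) (mu_int cm)]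
    have : |∫ t, (c ^ 6 * (φ d t * φxx d t + φx d t ^ 2) - m t) ∂(mu T)| ≤
        ∫ t, (c ^ 6 / 8 * φx d t ^ 2 + 33 * c ^ 4 * φ d t ^ 2) ∂(mu T) := by
      rw [← Real.norm_eq_abs]
      apply norm_integral_le_of_norm_le (mu_int (by fun_prop))
      filter_upwards with t
      have e : c ^ 6 * (φ d t * φxx d t + φx d t ^ 2) - m t
        = 3 * (c ^ 3 * φx d t) * (c ^ 2 * φ d t) - 15 * (c ^ 2 * φ d t) ^ 2 := by
        simp only [hm]; ring
      have e2 : c ^ 6 / 8 * φx d t ^ 2 + 33 * c ^ 4 * φ d t ^ 2 =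
        (c ^ 3 * φx d t) ^ 2 / 8 + 33 * (c ^ 2 * φ d t) ^ 2 := by ring
      rw [e, e2, Real.norm_eq_abs, abs_le]
      generalize c ^ 3 * φx d t = a
      generalize c ^ 2 * φ d t = b
      constructor
      · nlinarith [sq_nonneg (a + 12 * b), sq_nonneg b]
      · nlinarith [sq_nonneg (a - 12 * b), sq_nonneg b]
    refine this.trans ?_
    rw [integral_add (mu_int (by fun_prop)) (mu_int (by fun_prop)), integral_const_mul, integral_const_mul]
    have := mul_le_mul_of_nonneg_left (Qg d md) (by positivity : 0 ≤ 33 * c ^ 4)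
    linarith
  have hpi : 1 ≤ 2 * Real.pi := by linarith [Real.pi_gt_three]
  have mM : |∫ t, m t ∂(mu T)| ≤ 1500000 * M ^ 6 * Q := by
    set Y := ∫ t, m t ∂(mu T)
    have : |2 * Real.pi * Y| ≤ 1500000 * M ^ 6 * Q := by
      have q1 := mul_le_mul_of_nonneg_left Q1 (by positivity : 0 ≤ 300000 * M ^ 6)
      have q2 := mul_le_mul_of_nonneg_left Qb (by positivity : 0 ≤ 100000 * M ^ 6)
      have q3 := mul_le_mul_of_nonneg_left bP' (by positivity : 0 ≤ 100000 * M ^ 6)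
      have q4 : 0 ≤ M ^ 6 * Q := by positivity
      obtain ⟨a1, a2⟩ := abs_le.1 main
      obtain ⟨a3, a4⟩ := abs_le.1 kT
      obtain ⟨a5, a6⟩ := abs_le.1 k0
      rw [abs_le]
      constructor <;> linarith
    rw [abs_mul, abs_of_pos (by positivity)] at this
    nlinarith [abs_nonneg Y]
  have fin : c ^ 6 * |X| ≤ c ^ 6 * (1 / 8 * A) + 2000000 * M ^ 6 * Q := by
    have e : c ^ 6 * |X| = |c ^ 6 * X| := by rw [abs_mul, abs_of_pos (show 0 < c ^ 6 by positivity)]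
    rw [e]
    have q5 := mul_le_mul_of_nonneg_right hcM Qn
    have q4 : 0 ≤ M ^ 6 * Q := by positivity
    have := abs_sub_abs_le_abs_sub (c ^ 6 * X) (∫ t, m t ∂(mu T))
    linarith
  have c6 : L ^ 6 / 64 ≤ c ^ 6 := by
    have : (L / 2) ^ 6 ≤ c ^ 6 := pow_le_pow_left₀ (by positivity) (by linarith) 6
    calc _ = (L / 2) ^ 6 := by ring
      _ ≤ _ := this
  have c6p : 0 < c ^ 6 := by positivity
  have f2 : c ^ 6 * |X| ≤ c ^ 6 * (1 / 8 * A + 64 / L ^ 6 * (2000000 * M ^ 6 * Q)) := by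
    have q4 : 0 ≤ 2000000 * M ^ 6 * Q := by positivity
    have : 1 ≤ c ^ 6 * (64 / L ^ 6) := by
      rw [← mul_div_assoc, le_div_iff₀ (by positivity)]; linarith
    have := mul_le_mul_of_nonneg_right this q4
    linarith
  exact le_of_mul_le_mul_left f2 c6p
end


section
variable {L T : ℝ} {φ φt φx φxx φxxx : ℝ → ℝ → ℝ}

lemma mu_refl (hL : 0 ≤ L) (f : ℝ → ℝ) : ∫ x, f (L - x) ∂(mu L) = ∫ x, f x ∂(mu L) := by
  rw [mu_integral hL, mu_integral hL, intervalIntegral.integral_comp_sub_left]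
  simp

lemma mu_shift_le {a : ℝ} (ha : 0 ≤ a) (haL : a ≤ L) (f : ℝ → ℝ) (hf : ContinuousOn f (Icc 0 L))
    (h0 : ∀ x, 0 ≤ f x) : ∫ x, f (a + x) ∂(mu (L - a)) ≤ ∫ x, f x ∂(mu L) := by
  rw [mu_integral (by linarith), intervalIntegral.integral_comp_add_left, add_zero, add_sub_cancel,
    intervalIntegral.integral_of_le haL, ← integral_Icc_eq_integral_Ioc]
  apply setIntegral_mono_set (mu_int hf) (by filter_upwards with x using h0 x)
  exact (Icc_subset_Icc_left ha).eventuallyLE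

lemma Sol.shift (S : Sol L T φ φt φx φxx φxxx) {a s : ℝ} (ha : 0 ≤ a) (hs : s ≤ T) :
    Sol (L - a) s (fun x t => φ (a + x) t) (fun x t => φt (a + x) t) (fun x t => φx (a + x) t)
      (fun x t => φxx (a + x) t) (fun x t => φxxx (a + x) t) := by
  have mx : ∀ x ∈ Icc 0 (L - a), a + x ∈ Icc 0 L := fun x hx => ⟨by linarith [hx.1], by linarith [hx.2]⟩
  have mt : ∀ t ∈ Icc 0 s, t ∈ Icc 0 T := fun t ht => ⟨ht.1, ht.2.trans hs⟩
  have cc : ∀ {f : ℝ → ℝ → ℝ}, ContinuousOn (fun p : ℝ × ℝ => f p.1 p.2) (Icc 0 L ×ˢ Icc 0 T) →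
    ContinuousOn (fun p : ℝ × ℝ => f (a + p.1) p.2) (Icc 0 (L - a) ×ˢ Icc 0 s) := fun hf =>
      hf.comp (f := fun p : ℝ × ℝ => (a + p.1, p.2)) (by fun_prop) (fun p hp => ⟨mx _ hp.1, mt _ hp.2⟩)
  refine ⟨fun x hx t ht => S.ht _ (mx x hx) t (mt t ht), fun x hx t ht => ?_, fun x hx t ht => ?_,
    fun x hx t ht => ?_, cc S.c, cc S.ct, cc S.c1, cc S.c2, cc S.c3, fun x hx t ht => S.eqn _ (mx x hx) t (mt t ht)⟩
  · exact (S.h0 _ (mx x hx) t (mt t ht)).comp_const_add a x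
  · exact (S.h1 _ (mx x hx) t (mt t ht)).comp_const_add a x
  · exact (S.h2 _ (mx x hx) t (mt t ht)).comp_const_add a x

lemma Sol.refl (S : Sol L T φ φt φx φxx φxxx) :
    Sol L T (fun x t => φ (L - x) (T - t)) (fun x t => -φt (L - x) (T - t)) (fun x t => -φx (L - x) (T - t))
      (fun x t => φxx (L - x) (T - t)) (fun x t => -φxxx (L - x) (T - t)) := by
  have mx : ∀ {R : ℝ}, ∀ x ∈ Icc 0 R, R - x ∈ Icc 0 R := fun x hx => ⟨by linarith [hx.2], by linarith [hx.1]⟩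
  have cc : ∀ {f : ℝ → ℝ → ℝ}, ContinuousOn (fun p : ℝ × ℝ => f p.1 p.2) (Icc 0 L ×ˢ Icc 0 T) →
    ContinuousOn (fun p : ℝ × ℝ => f (L - p.1) (T - p.2)) (Icc 0 L ×ˢ Icc 0 T) := fun hf =>
      hf.comp (f := fun p : ℝ × ℝ => (L - p.1, T - p.2)) (by fun_prop) (fun p hp => ⟨mx _ hp.1, mx _ hp.2⟩)
  refine ⟨fun x hx t ht => ?_, fun x hx t ht => ?_, fun x hx t ht => ?_,
    fun x hx t ht => ?_, cc S.c, (cc S.ct).neg, (cc S.c1).neg, cc S.c2, (cc S.c3).neg, fun x hx t ht => ?_⟩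
  · exact (S.ht _ (mx x hx) _ (mx t ht)).comp_const_sub T t
  · exact (S.h0 _ (mx x hx) _ (mx t ht)).comp_const_sub L x
  · exact (((S.h1 _ (mx x hx) _ (mx t ht)).comp_const_sub L x).fun_neg).congr_deriv (by ring)
  · exact (S.h2 _ (mx x hx) _ (mx t ht)).comp_const_sub L x
  · linarith [S.eqn _ (mx x hx) _ (mx t ht)]

lemma energy (hL : 0 ≤ L) (hT : 0 ≤ T) (S : Sol L T φ φt φx φxx φxxx) (b0 : ∀ t ∈ Icc 0 T, φ L t = 0)
    (b1 : ∀ t ∈ Icc 0 T, φx L t = 0) (α β : ℝ) :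
    ∫ x, (α + β * x) * φ x T ^ 2 ∂(mu L) - ∫ x, (α + β * x) * φ x 0 ^ 2 ∂(mu L)
    = (∫ t, (α * (φ 0 t ^ 2 + 2 * φ 0 t * φxx 0 t - φx 0 t ^ 2) - 2 * β * (φ 0 t * φx 0 t)) ∂(mu T))
     + ∫ t, ∫ x, (β * φ x t ^ 2 - 3 * β * φx x t ^ 2) ∂(mu L) ∂(mu T) := by
  have mT : T ∈ Icc 0 T := ⟨hT, le_rfl⟩
  have m0 : (0:ℝ) ∈ Icc 0 T := ⟨le_rfl, hT⟩
  have l0 : (0:ℝ) ∈ Icc 0 L := ⟨le_rfl, hL⟩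
  have cT := slX S.c mT
  have c0 := slX S.c m0
  rw [← integral_sub (mu_int (by fun_prop)) (mu_int (by fun_prop))]
  have cw : ContinuousOn (fun p : ℝ × ℝ => α + β * p.1) (Icc 0 L ×ˢ Icc 0 T) := by fun_prop
  have cF : ContinuousOn (fun p : ℝ × ℝ => (α + β * p.1) * (2 * (φ p.1 p.2 * φt p.1 p.2))) (Icc 0 L ×ˢ Icc 0 T) :=
    cw.mul (continuousOn_const.mul (S.c.mul S.ct))
  have e1 : ∫ x, ((α + β * x) * φ x T ^ 2 - (α + β * x) * φ x 0 ^ 2) ∂(mu L)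
      = ∫ x, ∫ t, (α + β * x) * (2 * (φ x t * φt x t)) ∂(mu T) ∂(mu L) := by
    apply integral_congr_ae
    filter_upwards [mu_mem L] with x hx
    have a1 := slT S.c hx
    have a2 := slT S.ct hx
    rw [mu_ftcR hT (fun t => (α + β * x) * φ x t ^ 2) _ (fun t ht => (((S.ht x hx t ht).fun_pow 2).const_mul _).congr_deriv
      (by push_cast; ring)) (by fun_prop)]
  rw [e1, ← dbl_swap (f := fun x t => (α + β * x) * (2 * (φ x t * φt x t))) cF]
  have cG : ContinuousOn (fun p : ℝ × ℝ => β * φ p.1 p.2 ^ 2 - 3 * β * φx p.1 p.2 ^ 2) (Icc 0 L ×ˢ Icc 0 T) :=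
    (continuousOn_const.mul (S.c.pow 2)).sub (continuousOn_const.mul (S.c1.pow 2))
  have s0 := slT S.c l0
  have s1 := slT S.c1 l0
  have s2 := slT S.c2 l0
  rw [← integral_add (mu_int (by fun_prop)) (dbl_t (f := fun x t => β * φ x t ^ 2 - 3 * β * φx x t ^ 2) cG)]
  apply integral_congr_ae
  filter_upwards [mu_mem T] with t ht
  have x0 := slX S.c ht
  have x1 := slX S.c1 ht
  have x3 := slX S.c3 ht
  have xt := slX S.ct ht
  have hV := mu_ftcR hL (fun x => (α + β * x) * (φ x t ^ 2 + 2 * (φ x t * φxx x t) - φx x t ^ 2) - 2 * β * (φ x t * φx x t))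
    (fun x => (α + β * x) * (2 * (φ x t * φx x t) + 2 * (φ x t * φxxx x t)) + β * φ x t ^ 2 - 3 * β * φx x t ^ 2)
    (fun x hx => by
      have d0 := S.h0 x hx t ht
      have d1 := S.h1 x hx t ht
      have d2 := S.h2 x hx t ht
      have dw : HasDerivAt (fun x : ℝ => α + β * x) β x := by
        simpa using ((hasDerivAt_id x).const_mul β).const_add α
      exact ((dw.fun_mul (((d0.fun_pow 2).fun_add ((d0.fun_mul d2).const_mul 2)).fun_sub (d1.fun_pow 2))).fun_sub
        ((d0.fun_mul d1).const_mul (2 * β))).congr_deriv (by push_cast; ring))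
    (by fun_prop)
  simp only [b0 t ht, b1 t ht] at hV
  have : ∫ x, (α + β * x) * (2 * (φ x t * φt x t)) ∂(mu L) =
    ∫ x, ((β * φ x t ^ 2 - 3 * β * φx x t ^ 2) - ((α + β * x) * (2 * (φ x t * φx x t) + 2 * (φ x t * φxxx x t)) + β * φ x t ^ 2 - 3 * β * φx x t ^ 2)) ∂(mu L) := by
    apply integral_congr_ae
    filter_upwards [mu_mem L] with x hx
    have : φt x t = -φx x t - φxxx x t := by linarith [S.eqn x hx t ht]
    rw [this]; ring
  rw [this, integral_sub (mu_int (by fun_prop)) (mu_int (by fun_prop)), hV]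
  ring

structure EB (L T : ℝ) (φ φx φxx : ℝ → ℝ → ℝ) (E : ℝ) : Prop where
  e0 : ∀ s ∈ Icc 0 T, ∫ x, φ x s ^ 2 ∂(mu L) ≤ E
  eb : ∫ t, (φ 0 t ^ 2 + φx 0 t ^ 2) ∂(mu T) ≤ E
  e1 : ∫ t, ∫ x, (φ x t ^ 2 + φx x t ^ 2) ∂(mu L) ∂(mu T) ≤ (2 + 2 * T + L) * E
  eg : ∀ y ∈ Icc 0 L, ∫ t, φ y t ^ 2 ∂(mu T) ≤ (2 + 2 * T + L) * E
  ef : ∀ a ∈ Icc 0 L, |∫ t, (φ a t ^ 2 + 2 * φ a t * φxx a t - φx a t ^ 2) ∂(mu T)| ≤ E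

lemma energy_bounds (hL : 0 < L) (hT : 0 < T) (S : Sol L T φ φt φx φxx φxxx) (b0 : ∀ t ∈ Icc 0 T, φ L t = 0)
    (b1 : ∀ t ∈ Icc 0 T, φx L t = 0) (b2 : ∀ t ∈ Icc 0 T, φ 0 t + φxx 0 t = 0) :
    EB L T φ φx φxx (∫ x, φ x 0 ^ 2 ∂(mu L)) := by
  set E := ∫ x, φ x 0 ^ 2 ∂(mu L) with hE
  have E0 : 0 ≤ E := integral_nonneg (fun x => sq_nonneg _)
  have mT : T ∈ Icc 0 T := ⟨hT.le, le_rfl⟩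
  have m0 : (0:ℝ) ∈ Icc 0 T := ⟨le_rfl, hT.le⟩
  have l0 : (0:ℝ) ∈ Icc 0 L := ⟨le_rfl, hL.le⟩
  have en : ∀ s ∈ Icc 0 T, ∫ x, φ x s ^ 2 ∂(mu L) + ∫ t, (φ 0 t ^ 2 + φx 0 t ^ 2) ∂(mu s) = E := by
    intro s hs
    have S' := S.shift (a := 0) le_rfl hs.2
    simp only [sub_zero, zero_add] at S'
    have h := energy hL.le hs.1 S' (fun t ht => b0 t ⟨ht.1, ht.2.trans hs.2⟩)
      (fun t ht => b1 t ⟨ht.1, ht.2.trans hs.2⟩) 1 0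
    simp only [zero_mul, mul_zero, sub_zero, add_zero, one_mul, integral_zero] at h
    have : ∫ t, (φ 0 t ^ 2 + 2 * φ 0 t * φxx 0 t - φx 0 t ^ 2) ∂(mu s) = ∫ t, -(φ 0 t ^ 2 + φx 0 t ^ 2) ∂(mu s) := by
      apply integral_congr_ae
      filter_upwards [mu_mem s] with t ht
      have : φxx 0 t = -φ 0 t := by linarith [b2 t ⟨ht.1, ht.2.trans hs.2⟩]
      rw [this]; ring
    rw [this, integral_neg] at h
    linarith
  have e0 : ∀ s ∈ Icc 0 T, ∫ x, φ x s ^ 2 ∂(mu L) ≤ E := by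
    intro s hs
    have : 0 ≤ ∫ t, (φ 0 t ^ 2 + φx 0 t ^ 2) ∂(mu s) := integral_nonneg (fun t => by positivity)
    linarith [en s hs]
  have eb : ∫ t, (φ 0 t ^ 2 + φx 0 t ^ 2) ∂(mu T) ≤ E := by
    have : 0 ≤ ∫ x, φ x T ^ 2 ∂(mu L) := integral_nonneg (fun t => by positivity)
    linarith [en T mT]
  have cu : ContinuousOn (fun p : ℝ × ℝ => φ p.1 p.2 ^ 2) (Icc 0 L ×ˢ Icc 0 T) := S.c.pow 2
  have cu1 : ContinuousOn (fun p : ℝ × ℝ => φx p.1 p.2 ^ 2) (Icc 0 L ×ˢ Icc 0 T) := S.c1.pow 2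
  have cE : ContinuousOn (fun p : ℝ × ℝ => φ p.1 p.2 ^ 2 + φx p.1 p.2 ^ 2) (Icc 0 L ×ˢ Icc 0 T) := cu.add cu1
  have it0 := dbl_t (f := fun x t => φ x t ^ 2) cu
  have it1 := dbl_t (f := fun x t => φx x t ^ 2) cu1
  have itE := dbl_t (f := fun x t => φ x t ^ 2 + φx x t ^ 2) cE
  set U := ∫ t, ∫ x, φ x t ^ 2 ∂(mu L) ∂(mu T) with hU
  set U1 := ∫ t, ∫ x, φx x t ^ 2 ∂(mu L) ∂(mu T) with hU1
  have splitx : ∀ (a b : ℝ), ∀ t ∈ Icc 0 T, ∫ x, (a * φ x t ^ 2 + b * φx x t ^ 2) ∂(mu L)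
      = a * ∫ x, φ x t ^ 2 ∂(mu L) + b * ∫ x, φx x t ^ 2 ∂(mu L) := by
    intro a b t ht
    have x0 := slX S.c ht
    have x1 := slX S.c1 ht
    rw [integral_add (mu_int (by fun_prop)) (mu_int (by fun_prop)), integral_const_mul, integral_const_mul]
  have split : ∀ (a b : ℝ), ∫ t, ∫ x, (a * φ x t ^ 2 + b * φx x t ^ 2) ∂(mu L) ∂(mu T) = a * U + b * U1 := by
    intro a b
    rw [hU, hU1, ← integral_const_mul, ← integral_const_mul, ← integral_add (it0.const_mul a) (it1.const_mul b)]
    apply integral_congr_ae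
    filter_upwards [mu_mem T] with t ht using splitx a b t ht
  have hUE : U ≤ T * E := by
    have : U ≤ ∫ t, E ∂(mu T) := by
      apply integral_mono_ae it0 (integrable_const _)
      filter_upwards [mu_mem T] with t ht using e0 t ht
    rw [mu_integral hT.le] at this
    simpa using this
  have hE2 : 3 * U1 ≤ (L + 1 + T) * E := by
    have h := energy hL.le hT.le S b0 b1 0 1
    have h3 := split 1 (-3)
    have e : ∫ t, ∫ x, (1 * φ x t ^ 2 - 3 * 1 * φx x t ^ 2) ∂(mu L) ∂(mu T) = 1 * U + (-3) * U1 := by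
      rw [← h3]; congr 1; ext t; congr 1; ext x; ring
    rw [e] at h
    have p1 : 0 ≤ ∫ x, (0 + 1 * x) * φ x T ^ 2 ∂(mu L) := by
      apply integral_nonneg_of_ae
      filter_upwards [mu_mem L] with x hx
      have := hx.1
      simp only [zero_add, one_mul, Pi.zero_apply]
      positivity
    have p2 : ∫ x, (0 + 1 * x) * φ x 0 ^ 2 ∂(mu L) ≤ L * E := by
      rw [hE, ← integral_const_mul]
      have := slX S.c m0
      apply mu_mono (by fun_prop) (by fun_prop)
      intro x hx
      have := mul_le_mul_of_nonneg_right hx.2 (sq_nonneg (φ x 0))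
      linarith
    have p3 : ∫ t, (0 * (φ 0 t ^ 2 + 2 * φ 0 t * φxx 0 t - φx 0 t ^ 2) - 2 * 1 * (φ 0 t * φx 0 t)) ∂(mu T) ≤ E := by
      refine le_trans ?_ eb
      have s0 := slT S.c l0
      have s1 := slT S.c1 l0
      have s2 := slT S.c2 l0
      apply mu_mono (by fun_prop) (by fun_prop)
      intro t _
      nlinarith [sq_nonneg (φ 0 t + φx 0 t)]
    linarith
  have U1n : 0 ≤ U1 := integral_nonneg (fun t => integral_nonneg (fun x => sq_nonneg _))
  have e1 : ∫ t, ∫ x, (φ x t ^ 2 + φx x t ^ 2) ∂(mu L) ∂(mu T) ≤ (2 + 2 * T + L) * E := by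
    have h3 := split 1 1
    simp only [one_mul] at h3
    rw [h3]
    nlinarith [mul_nonneg hT.le E0, mul_nonneg hL.le E0]
  refine ⟨e0, eb, e1, ?_, ?_⟩
  · intro y hy
    refine le_trans ?_ e1
    have := slT S.c hy
    apply integral_mono_ae (mu_int (by fun_prop)) itE
    filter_upwards [mu_mem T] with t ht
    have x0 := slX S.c ht
    have x1 := slX S.c1 ht
    refine le_trans ?_ (mu_shift_le hy.1 hy.2 (fun x => φ x t ^ 2 + φx x t ^ 2) (by fun_prop) (fun x => by positivity))
    have S' := S.shift (a := y) hy.1 le_rfl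
    have z0 := slX (φ := fun x t => φ (y + x) t) S'.c ht
    have z1 := slX (φ := fun x t => φx (y + x) t) S'.c1 ht
    have hh := mu_ftcR (T := L - y) (by linarith [hy.2]) (fun r => φ (y + r) t ^ 2) (fun r => 2 * (φ (y + r) t * φx (y + r) t))
      (fun r hr => (((S'.h0 r hr t ht).fun_pow 2).congr_deriv (by push_cast; ring))) (continuousOn_const.mul (z0.mul z1))
    simp only [add_sub_cancel, add_zero, b0 t ht] at hh
    have h2 : φ y t ^ 2 = ∫ r, -(2 * (φ (y + r) t * φx (y + r) t)) ∂(mu (L - y)) := by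
      rw [integral_neg, hh]; ring
    rw [h2]
    apply mu_mono (continuousOn_const.mul (z0.mul z1)).neg ((z0.pow 2).add (z1.pow 2))
    intro r _
    show -(2 * (φ (y + r) t * φx (y + r) t)) ≤ φ (y + r) t ^ 2 + φx (y + r) t ^ 2
    nlinarith [sq_nonneg (φ (y + r) t + φx (y + r) t)]
  · intro a ha
    have S' := S.shift (a := a) ha.1 le_rfl
    have h := energy (by linarith [ha.2]) hT.le S' (fun t ht => by simpa using b0 t ht) (fun t ht => by simpa using b1 t ht) 1 0
    simp only [zero_mul, mul_zero, sub_zero, add_zero, one_mul, integral_zero] at h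
    rw [← h]
    have q : ∀ s ∈ Icc 0 T, 0 ≤ ∫ x, φ (a + x) s ^ 2 ∂(mu (L - a)) ∧ ∫ x, φ (a + x) s ^ 2 ∂(mu (L - a)) ≤ E := by
      intro s hs
      have x0 := slX S.c hs
      exact ⟨integral_nonneg (fun x => sq_nonneg _), (mu_shift_le ha.1 ha.2 (fun x => φ x s ^ 2) (by fun_prop) (fun x => by positivity)).trans (e0 s hs)⟩
    have q1 := q T mT
    have q2 := q 0 m0
    rw [abs_le]
    constructor <;> linarith [q1.1, q1.2, q2.1, q2.2]

end


lemma trace_bd {L T : ℝ} {φ φt φx φxx φxxx : ℝ → ℝ → ℝ} (hL : 0 < L) (hT : 0 < T)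
    (S : Sol L T φ φt φx φxx φxxx) (b0 : ∀ t ∈ Icc 0 T, φ L t = 0)
    (b1 : ∀ t ∈ Icc 0 T, φx L t = 0) (b2 : ∀ t ∈ Icc 0 T, φ 0 t + φxx 0 t = 0) :
    ∀ x ∈ Icc 0 L, ∫ t, φx x t ^ 2 ∂(mu T) ≤
      ((1 + (2 + 2 * T + L)) + 64 / L ^ 6 * (2000000 * (1 + L) ^ 6 * (2 + 2 * T + L))) * ∫ x, φ x 0 ^ 2 ∂(mu L) := by
  have B := energy_bounds hL hT S b0 b1 b2
  set E := ∫ x, φ x 0 ^ 2 ∂(mu L) with hE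
  have E0 : 0 ≤ E := integral_nonneg (fun x => sq_nonneg _)
  have mT : T ∈ Icc 0 T := ⟨hT.le, le_rfl⟩
  have m0 : (0:ℝ) ∈ Icc 0 T := ⟨le_rfl, hT.le⟩
  have l0 : (0:ℝ) ∈ Icc 0 L := ⟨le_rfl, hL.le⟩
  set K := 2 + 2 * T + L with hK
  have K2 : 2 ≤ K := by rw [hK]; linarith
  have EK : 2 * E ≤ K * E := mul_le_mul_of_nonneg_right K2 E0
  have CC : (1 + K + 64 / L ^ 6 * (2000000 * (1 + L) ^ 6 * K)) * E
    = E + K * E + 64 / L ^ 6 * (2000000 * (1 + L) ^ 6 * (K * E)) := by ring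
  have P0 : 0 ≤ 64 / L ^ 6 * (2000000 * (1 + L) ^ 6 * (K * E)) := by positivity
  intro x hx
  rw [CC]
  -- common end
  have fin : |∫ t, (φ x t * φxx x t + φx x t ^ 2) ∂(mu T)| ≤
      1 / 8 * (∫ t, φx x t ^ 2 ∂(mu T)) + 64 / L ^ 6 * (2000000 * (1 + L) ^ 6 * (K * E)) →
      ∫ t, φx x t ^ 2 ∂(mu T) ≤ E + K * E + 64 / L ^ 6 * (2000000 * (1 + L) ^ 6 * (K * E)) := by
    intro h
    have s0 := slT S.c hx
    have s1 := slT S.c1 hx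
    have s2 := slT S.c2 hx
    have hf := B.ef x hx
    have hg := B.eg x hx
    have r1 : ∫ t, (φ x t * φxx x t + φx x t ^ 2) ∂(mu T)
      = (∫ t, φ x t * φxx x t ∂(mu T)) + ∫ t, φx x t ^ 2 ∂(mu T) :=
      integral_add (mu_int (by fun_prop)) (mu_int (by fun_prop))
    have r2 : ∫ t, (φ x t ^ 2 + 2 * φ x t * φxx x t - φx x t ^ 2) ∂(mu T)
      = (∫ t, φ x t ^ 2 ∂(mu T)) + 2 * (∫ t, φ x t * φxx x t ∂(mu T)) - ∫ t, φx x t ^ 2 ∂(mu T) := by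
      rw [← integral_const_mul, ← integral_add (mu_int (by fun_prop)) (mu_int (by fun_prop)),
        ← integral_sub (mu_int (by fun_prop)) (mu_int (by fun_prop))]
      congr 1; ext t; ring
    rw [r1] at h
    rw [r2] at hf
    have A0 : 0 ≤ ∫ t, φx x t ^ 2 ∂(mu T) := integral_nonneg (fun t => sq_nonneg _)
    have := (abs_le.1 h).2
    have := (abs_le.1 hf).1
    linarith
  rcases eq_or_lt_of_le hx.1 with h0 | h0
  · subst h0
    have s0 := slT S.c l0
    have s1 := slT S.c1 l0
    have : ∫ t, φx 0 t ^ 2 ∂(mu T) ≤ ∫ t, (φ 0 t ^ 2 + φx 0 t ^ 2) ∂(mu T) := by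
      apply mu_mono (by fun_prop) (by fun_prop)
      intro t _
      nlinarith [sq_nonneg (φ 0 t)]
    linarith [B.eb]
  rcases eq_or_lt_of_le hx.2 with h1 | h1
  · subst h1
    have : ∫ t, φx x t ^ 2 ∂(mu T) = 0 := by
      apply integral_eq_zero_of_ae
      filter_upwards [mu_mem T] with t ht
      simp [b1 t ht]
    linarith
  rcases le_total x (L / 2) with h2 | h2
  · apply fin
    apply time_bd hL hT S h0 h2 zero_le_one le_rfl (gkN h0 h1) (fun h => absurd h one_ne_zero)
    · linarith
    · linarith [B.e0 T mT]
    · exact B.e1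
    · exact B.eg
    · have s0 := slT S.c l0
      have s1 := slT S.c1 l0
      have s2 := slT S.c2 l0
      have : ∫ t, (φ 0 t ^ 2 + φx 0 t ^ 2 + φxx 0 t ^ 2) ∂(mu T) ≤ ∫ t, 2 * (φ 0 t ^ 2 + φx 0 t ^ 2) ∂(mu T) := by
        apply mu_mono (by fun_prop) (by fun_prop)
        intro t ht
        have : φxx 0 t = -φ 0 t := by linarith [b2 t ht]
        rw [this]
        nlinarith [sq_nonneg (φx 0 t)]
      rw [integral_const_mul] at this
      linarith [B.eb]
  · apply fin
    have hd : 0 < L - x := by linarith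
    have h := time_bd hL hT S.refl (Q := K * E) hd (by linarith) le_rfl zero_le_one (gkD hd (by linarith))
      (fun _ t ht => by
        have mt : T - t ∈ Icc 0 T := ⟨by linarith [ht.2], by linarith [ht.1]⟩
        simp [b0 _ mt, b1 _ mt])
      (by
        simp only [sub_zero]
        rw [mu_refl hL.le (fun x => φ x T ^ 2)]
        linarith [B.e0 T mT])
      (by
        simp only [sub_self]
        rw [mu_refl hL.le (fun x => φ x 0 ^ 2)]
        linarith)
      (by
        simp only [neg_sq]
        have e : ∀ t, ∫ x, (φ (L - x) (T - t) ^ 2 + φx (L - x) (T - t) ^ 2) ∂(mu L)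
          = ∫ x, (φ x (T - t) ^ 2 + φx x (T - t) ^ 2) ∂(mu L) := fun t =>
          mu_refl hL.le (fun x => φ x (T - t) ^ 2 + φx x (T - t) ^ 2)
        simp only [e]
        rw [mu_refl hT.le (fun t => ∫ x, (φ x t ^ 2 + φx x t ^ 2) ∂(mu L))]
        exact B.e1)
      (fun y hy => by
        have := mu_refl hT.le (fun t => φ (L - y) t ^ 2)
        rw [this]
        exact B.eg _ ⟨by linarith [hy.2], by linarith [hy.1]⟩)
      (by rw [zero_mul]; positivity)
    simp only [sub_sub_cancel, neg_sq] at h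
    rw [mu_refl hT.le (fun t => φ x t * φxx x t + φx x t ^ 2), mu_refl hT.le (fun t => φx x t ^ 2)] at h
    exact h

/-- **Hidden (sharp trace) regularity for the adjoint linear KdV system, `j = 1` case.**
There is a constant `C > 0` depending only on `L` and `T` such that every classical solution
`φ` of the adjoint linear KdV system satisfies
`sup_{x ∈ [0,L]} ∫₀^T φ_x(x,t)² dt ≤ C ∫₀^L φ(x,0)² dx`. -/
theorem adjoint_kdv_hidden_regularity
    (L T : ℝ) (hL : 0 < L) (hT : 0 < T) :
    ∃ C : ℝ, 0 < C ∧
      ∀ (φ φt φx φxx φxxx : ℝ → ℝ → ℝ),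
        (∀ x ∈ Icc (0:ℝ) L, ∀ t ∈ Icc (0:ℝ) T,
          HasDerivAt (fun s => φ x s) (φt x t) t) →
        (∀ x ∈ Icc (0:ℝ) L, ∀ t ∈ Icc (0:ℝ) T,
          HasDerivAt (fun y => φ y t) (φx x t) x) →
        (∀ x ∈ Icc (0:ℝ) L, ∀ t ∈ Icc (0:ℝ) T,
          HasDerivAt (fun y => φx y t) (φxx x t) x) →
        (∀ x ∈ Icc (0:ℝ) L, ∀ t ∈ Icc (0:ℝ) T,
          HasDerivAt (fun y => φxx y t) (φxxx x t) x) →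
        ContinuousOn (fun p : ℝ × ℝ => φ p.1 p.2) (Icc 0 L ×ˢ Icc 0 T) →
        ContinuousOn (fun p : ℝ × ℝ => φt p.1 p.2) (Icc 0 L ×ˢ Icc 0 T) →
        ContinuousOn (fun p : ℝ × ℝ => φx p.1 p.2) (Icc 0 L ×ˢ Icc 0 T) →
        ContinuousOn (fun p : ℝ × ℝ => φxx p.1 p.2) (Icc 0 L ×ˢ Icc 0 T) →
        ContinuousOn (fun p : ℝ × ℝ => φxxx p.1 p.2) (Icc 0 L ×ˢ Icc 0 T) →
        (∀ x ∈ Icc (0:ℝ) L, ∀ t ∈ Icc (0:ℝ) T,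
          φt x t + φx x t + φxxx x t = 0) →
        (∀ t ∈ Icc (0:ℝ) T, φ L t = 0) →
        (∀ t ∈ Icc (0:ℝ) T, φx L t = 0) →
        (∀ t ∈ Icc (0:ℝ) T, φ 0 t + φxx 0 t = 0) →
          ∀ x ∈ Icc (0:ℝ) L,
            (∫ t in (0:ℝ)..T, (φx x t) ^ 2) ≤ C * ∫ x' in (0:ℝ)..L, (φ x' 0) ^ 2 := by
  refine ⟨(1 + (2 + 2 * T + L)) + 64 / L ^ 6 * (2000000 * (1 + L) ^ 6 * (2 + 2 * T + L)), by positivity, ?_⟩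
  intro φ φt φx φxx φxxx ht h0 h1 h2 c ct c1 c2 c3 eqn b0 b1 b2 x hx
  have h := trace_bd hL hT ⟨ht, h0, h1, h2, c, ct, c1, c2, c3, eqn⟩ b0 b1 b2 x hx
  rw [mu_integral hT.le, mu_integral hL.le] at h
  exact h
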